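/- arXiv:1712.07090 — 3 statements merged into one kernel-verified Lean document; each statement's English description precedes it below -/
import Mathlib

section
/- There exists a constant C > 0, depending only on (n₁,…,n_m), such that for every continuous (n₁,…,n_m)-homogeneous polynomial P : c₀ × ⋯ × c₀ → 𝕂 (m copies of c₀, 𝕂 ∈ {ℝ, ℂ}) one has ∑_{j=1}^∞ |P(e_j, e_j, …, e_j)| ≤ C ‖P‖, where (e_j) is the sequence of canonical unit vectors of c₀. -/
open scoped BigOperators

/-- `P` is a continuous `(n 0, …, n (m-1))`-homogeneous polynomial, i.e. it comes from a
continuous multilinear map in `n 0 + ⋯ + n (m-1)` variables (`n k` copies of `X k`). -/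
def IsMultiPoly (𝕂 : Type*) [RCLike 𝕂] {m : ℕ} (n : Fin m → ℕ)
    {X : Fin m → Type*} [∀ k, NormedAddCommGroup (X k)] [∀ k, NormedSpace 𝕂 (X k)]
    {Y : Type*} [NormedAddCommGroup Y] [NormedSpace 𝕂 Y]
    (P : (∀ k, X k) → Y) : Prop :=
  ∃ T : ContinuousMultilinearMap 𝕂 (fun i : Σ k : Fin m, Fin (n k) => X i.1) Y,
    ∀ x : ∀ k, X k, P x = T fun i => x i.1

/-- The sup norm of a multipolynomial over the product of unit balls. -/
noncomputable def multipolyNorm {m : ℕ} {X : Fin m → Type*}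
    [∀ k, NormedAddCommGroup (X k)] {Y : Type*} [NormedAddCommGroup Y]
    (P : (∀ k, X k) → Y) : ℝ :=
  sSup {c : ℝ | ∃ x : ∀ k, X k, (∀ k, ‖x k‖ ≤ 1) ∧ c = ‖P x‖}

/-- The canonical unit vectors of `c₀`. -/
noncomputable def c0Basis (𝕂 : Type*) [RCLike 𝕂] (j : ℕ) : ZeroAtInftyContinuousMap ℕ 𝕂 where
  toFun i := if i = j then 1 else 0
  continuous_toFun := continuous_of_discreteTopology
  zero_at_infty' := by
    rw [Filter.cocompact_eq_cofinite]
    refine Filter.Tendsto.congr' ?_ tendsto_const_nhds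
    have hmem : ({j}ᶜ : Set ℕ) ∈ (Filter.cofinite : Filter ℕ) :=
      Filter.mem_cofinite.mpr (by simp)
    filter_upwards [hmem] with i hi
    simp only [Set.mem_compl_iff, Set.mem_singleton_iff] at hi
    simp [hi]

theorem Finset.sum_eq_zero_of_mul_left_eq_neg {G R : Type*} [Group G] [Fintype G] [Field R]
    [CharZero R] (F : G → R) (d : G) (h : ∀ g, F (d * g) = -F g) : ∑ g, F g = 0 := by
  have h₁ : ∑ g, F (d * g) = ∑ g, F g := Equiv.sum_comp (Equiv.mulLeft d) F
  simp only [h, Finset.sum_neg_distrib] at h₁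
  exact self_eq_neg.mp h₁.symm

theorem sum_signs_prod_mul_prod_comp {R I : Type*} [Field R] [CharZero R] [Fintype I]
    [DecidableEq I] (f : I → I) [Decidable f.Bijective] :
    ∑ ε : I → ℤˣ, (∏ i, ((ε i : ℤ) : R)) * ∏ i, ((ε (f i) : ℤ) : R) =
      if f.Bijective then (Fintype.card (I → ℤˣ) : R) else 0 := by
  split_ifs with hf
  · have h (ε : I → ℤˣ) : (∏ i, ((ε i : ℤ) : R)) * ∏ i, ((ε (f i) : ℤ) : R) = 1 := by
      rw [hf.prod_comp fun i => ((ε i : ℤ) : R), ← Finset.prod_mul_distrib]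
      refine Finset.prod_eq_one fun i _ => ?_
      rcases Int.units_eq_one_or (ε i) with h | h <;> simp [h]
    simp [h]
  · have hs : ¬ f.Surjective := fun h => hf (Finite.surjective_iff_bijective.mp h)
    simp only [Function.Surjective, not_forall, not_exists] at hs
    obtain ⟨a, ha⟩ := hs
    refine Finset.sum_eq_zero_of_mul_left_eq_neg _ (Pi.mulSingle a (-1)) fun ε => ?_
    have h₁ : ∏ i, (((Pi.mulSingle a (-1) : I → ℤˣ) i : ℤ) : R) = -1 := by
      rw [Finset.prod_eq_single a] <;> simp +contextual
    simp [Finset.prod_mul_distrib, h₁, Pi.mulSingle_eq_of_ne (ha _)]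

/-- Polarization over the blocks given by the fibres of `π`, for a multilinear map that need not
be symmetric. -/
theorem MultilinearMap.sum_signs_blocks {R I K E : Type*} [Field R] [CharZero R] [Fintype I]
    [DecidableEq I] [DecidableEq K] [AddCommGroup E] [Module R E]
    [DecidablePred (Function.Bijective : (I → I) → Prop)]
    (T : MultilinearMap R (fun _ : I => E) R) (π : I → K) (y : I → E) :
    ∑ ε : I → ℤˣ, (∏ i, ((ε i : ℤ) : R)) *
        T (fun i => ∑ l with π l = π i, ((ε l : ℤ) : R) • y l) =
      Fintype.card (I → ℤˣ) *
        ∑ f ∈ Fintype.piFinset (fun i => {l | π l = π i}) with f.Bijective,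
          T (fun i => y (f i)) := by
  simp only [MultilinearMap.map_sum_finset, MultilinearMap.map_smul_univ, Finset.mul_sum,
    smul_eq_mul]
  rw [Finset.sum_comm, Finset.sum_filter]
  refine Finset.sum_congr rfl fun f _ => ?_
  simp only [← mul_assoc]
  rw [← Finset.sum_mul, sum_signs_prod_mul_prod_comp, ite_mul, zero_mul]

/-- Coefficients that are signs at every index but `i₀`, and whose product over all indices is
`c j`. -/
def signCoeff {R I α : Type*} [Field R] [Fintype I] [DecidableEq I] (i₀ : I) (c : α → R)
    (r : I → α → ℤˣ) (i : I) (j : α) : R :=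
  if i = i₀ then c j * ∏ l ∈ Finset.univ.erase i₀, ((r l j : ℤ) : R) else ((r i j : ℤ) : R)

theorem prod_signCoeff {R I α : Type*} [Field R] [Fintype I] [DecidableEq I] (i₀ : I)
    (c : α → R) (r : I → α → ℤˣ) (J : I → α) :
    ∏ i, signCoeff i₀ c r i (J i) =
      c (J i₀) * ∏ l ∈ Finset.univ.erase i₀, (((r l (J i₀) * r l (J l) : ℤˣ) : ℤ) : R) := by
  rw [← Finset.mul_prod_erase _ _ (Finset.mem_univ i₀)]
  simp only [signCoeff, if_true, Units.val_mul, Int.cast_mul, Finset.prod_mul_distrib, mul_assoc]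
  congr 2
  exact Finset.prod_congr rfl fun i hi => if_neg (Finset.ne_of_mem_erase hi)

theorem sum_prod_signCoeff {R I α : Type*} [Field R] [CharZero R] [Fintype I] [DecidableEq I]
    [Fintype α] [DecidableEq α] (i₀ : I) (c : α → R) (J : I → α) :
    ∑ r : I → α → ℤˣ, ∏ i, signCoeff i₀ c r i (J i) =
      if ∀ i, J i = J i₀ then Fintype.card (I → α → ℤˣ) * c (J i₀) else 0 := by
  simp only [prod_signCoeff]
  split_ifs with hJ
  · simp [hJ, ← sq, Int.units_sq]
  · simp only [not_forall] at hJ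
    obtain ⟨a, ha⟩ := hJ
    have ha₀ : a ≠ i₀ := by rintro rfl; exact ha rfl
    refine Finset.sum_eq_zero_of_mul_left_eq_neg _ (Pi.mulSingle a (Pi.mulSingle (J a) (-1)))
      fun r => ?_
    have h₁ : ∏ l ∈ Finset.univ.erase i₀,
        (((Pi.mulSingle a (Pi.mulSingle (J a) (-1)) : I → α → ℤˣ) l (J i₀) *
          (Pi.mulSingle a (Pi.mulSingle (J a) (-1)) : I → α → ℤˣ) l (J l) : ℤˣ) : ℤ) = -1 := by
      rw [Finset.prod_eq_single a]
      · simp [Pi.mulSingle_eq_of_ne (Ne.symm ha)]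
      · intro l _ hl
        simp [Pi.mulSingle_eq_of_ne hl]
      · simp [ha₀]
    have h₂ := congrArg (Int.cast : ℤ → R) h₁
    simp only [Int.cast_prod, Int.cast_neg, Int.cast_one] at h₂
    refine Eq.trans ?_ (neg_one_mul _)
    refine Eq.trans ?_ (congrArg (· * _) h₂)
    rw [mul_left_comm, ← Finset.prod_mul_distrib]
    congr 1
    refine Finset.prod_congr rfl fun l _ => ?_
    simp only [Pi.mul_apply, Units.val_mul, Int.cast_mul]
    ring

/-- Averaging over signs extracts the diagonal of a multilinear form. -/
theorem MultilinearMap.sum_signCoeff_diagonal {R I α E : Type*} [Field R] [CharZero R]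
    [Fintype I] [DecidableEq I] [Fintype α] [DecidableEq α] [AddCommGroup E] [Module R E]
    (T : MultilinearMap R (fun _ : I => E) R) (i₀ : I) (c : α → R) (e : α → E) :
    ∑ r : I → α → ℤˣ, T (fun i => ∑ j, signCoeff i₀ c r i j • e j) =
      Fintype.card (I → α → ℤˣ) * ∑ j, c j * T (fun _ => e j) := by
  simp only [MultilinearMap.map_sum, MultilinearMap.map_smul_univ, smul_eq_mul]
  rw [Finset.sum_comm]
  simp only [← Finset.sum_mul, sum_prod_signCoeff, ite_mul, zero_mul]
  rw [← Finset.sum_filter, Finset.mul_sum]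
  refine Finset.sum_nbij' (fun J => J i₀) (fun j _ => j) (by simp) (by simp) ?_ (by simp) ?_
  · intro J hJ
    funext i
    exact ((Finset.mem_filter.mp hJ).2 i).symm
  · intro J hJ
    have h : (fun i => e (J i)) = fun _ => e (J i₀) :=
      funext fun i => congrArg e ((Finset.mem_filter.mp hJ).2 i)
    rw [h, mul_assoc]

theorem norm_intUnit_cast {𝕂 : Type*} [RCLike 𝕂] (u : ℤˣ) : ‖((u : ℤ) : 𝕂)‖ = 1 := by
  rcases Int.units_eq_one_or u with h | h <;> simp [h]

theorem norm_signCoeff_le {𝕂 I α : Type*} [RCLike 𝕂] [Fintype I] [DecidableEq I] (i₀ : I)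
    {c : α → 𝕂} (hc : ∀ j, ‖c j‖ ≤ 1) (r : I → α → ℤˣ) (i : I) (j : α) :
    ‖signCoeff i₀ c r i j‖ ≤ 1 := by
  unfold signCoeff
  split_ifs
  · simpa [norm_prod, norm_intUnit_cast] using hc j
  · exact (norm_intUnit_cast _).le

theorem norm_sum_smul_c0Basis_le {𝕂 : Type*} [RCLike 𝕂] {M : ℕ} (g : Fin M → 𝕂)
    (hg : ∀ j, ‖g j‖ ≤ 1) : ‖∑ j : Fin M, g j • c0Basis 𝕂 j‖ ≤ 1 := by
  rw [← ZeroAtInftyContinuousMap.norm_toBCF_eq_norm,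
    BoundedContinuousFunction.norm_le zero_le_one]
  intro l
  have h : (∑ j : Fin M, g j • c0Basis 𝕂 j) l = ∑ j : Fin M, if l = j then g j else 0 := by
    let φ : ZeroAtInftyContinuousMap ℕ 𝕂 →+ 𝕂 :=
      { toFun := fun u => u l, map_zero' := rfl, map_add' := fun _ _ => rfl }
    refine (map_sum φ _ _).trans (Finset.sum_congr rfl fun j _ => ?_)
    change g j * (if l = (j : ℕ) then 1 else 0) = _
    simp
  change ‖(∑ j : Fin M, g j • c0Basis 𝕂 j) l‖ ≤ 1
  rw [h]
  by_cases hl : l < M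
  · rw [Finset.sum_eq_single ⟨l, hl⟩]
    · simpa using hg _
    · intro b _ hb
      exact if_neg fun h => hb (Fin.ext h.symm)
    · simp
  · rw [Finset.sum_eq_zero]
    · simp
    · intro b _
      exact if_neg fun h => hl (h.trans_lt b.2)

/-- The scaled form of the estimate `‖P x‖ ≤ ‖P‖` on the product of unit balls. -/
theorem IsMultiPoly.norm_le_pow_mul {𝕂 : Type*} [RCLike 𝕂] {m : ℕ} {n : Fin m → ℕ}
    {X : Fin m → Type*} [∀ k, NormedAddCommGroup (X k)] [∀ k, NormedSpace 𝕂 (X k)]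
    {Y : Type*} [NormedAddCommGroup Y] [NormedSpace 𝕂 Y] {P : (∀ k, X k) → Y}
    (hP : IsMultiPoly 𝕂 n P) {N : ℕ} (hN : 0 < N) {x : ∀ k, X k} (hx : ∀ k, ‖x k‖ ≤ N) :
    ‖P x‖ ≤ (N : ℝ) ^ Fintype.card (Σ k : Fin m, Fin (n k)) * multipolyNorm P := by
  obtain ⟨T, hT⟩ := hP
  have hN₀ : (N : 𝕂) ≠ 0 := Nat.cast_ne_zero.mpr hN.ne'
  have hbdd : BddAbove {c : ℝ | ∃ x : ∀ k, X k, (∀ k, ‖x k‖ ≤ 1) ∧ c = ‖P x‖} := by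
    refine ⟨‖T‖, ?_⟩
    rintro _ ⟨z, hz, rfl⟩
    rw [hT]
    refine (T.le_opNorm _).trans (mul_le_of_le_one_right (norm_nonneg _) ?_)
    exact Finset.prod_le_one (fun _ _ => norm_nonneg _) fun i _ => hz i.1
  have hscale : P x = (N : 𝕂) ^ Fintype.card (Σ k : Fin m, Fin (n k)) •
      P (fun k => (N : 𝕂)⁻¹ • x k) := by
    rw [hT, hT, ← Finset.card_univ, ← Finset.prod_const, ← T.map_smul_univ]
    simp [smul_smul, hN₀]
  rw [hscale, norm_smul, norm_pow, RCLike.norm_natCast]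
  refine mul_le_mul_of_nonneg_left (le_csSup hbdd ⟨_, fun k => ?_, rfl⟩) (by positivity)
  rw [norm_smul, norm_inv, RCLike.norm_natCast]
  exact inv_mul_le_one_of_le₀ (hx k) (Nat.cast_nonneg _)

theorem IsMultiPoly.norm_sum_mul_c0Basis_le {𝕂 : Type*} [RCLike 𝕂] {m : ℕ} {n : Fin m → ℕ}
    {P : (∀ _ : Fin m, ZeroAtInftyContinuousMap ℕ 𝕂) → 𝕂} (hP : IsMultiPoly 𝕂 n P)
    (i₀ : Σ k : Fin m, Fin (n k)) {M : ℕ} (c : Fin M → 𝕂) (hc : ∀ j, ‖c j‖ ≤ 1) :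
    ‖∑ j, c j * P (fun _ => c0Basis 𝕂 j)‖ ≤
      (Fintype.card (Σ k : Fin m, Fin (n k)) : ℝ) ^ Fintype.card (Σ k : Fin m, Fin (n k)) *
        multipolyNorm P := by
  classical
  obtain ⟨T, hT⟩ := id hP
  set I := Σ k : Fin m, Fin (n k)
  set N := Fintype.card I
  set B := (N : ℝ) ^ N * multipolyNorm P
  set S := ∑ j, c j * P (fun _ => c0Basis 𝕂 j)
  let T' : MultilinearMap 𝕂 (fun _ : I => ZeroAtInftyContinuousMap ℕ 𝕂) 𝕂 := T.toMultilinearMap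
  let y (r : I → Fin M → ℤˣ) (i : I) := ∑ j : Fin M, signCoeff i₀ c r i j • c0Basis 𝕂 j
  let x (r : I → Fin M → ℤˣ) (ε : I → ℤˣ) (k : Fin m) : ZeroAtInftyContinuousMap ℕ 𝕂 :=
    ∑ l : I with l.1 = k, ((ε l : ℤ) : 𝕂) • y r l
  let A : Finset (I → I) :=
    {f ∈ Fintype.piFinset (fun i => {l : I | l.1 = i.1}) | f.Bijective}
  have hid : id ∈ A := by simp [A]
  have hdiag : ∀ f ∈ A, ∑ r, T' (fun i => y r (f i)) = Fintype.card (I → Fin M → ℤˣ) * S := by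
    intro f hf
    have hb : f.Bijective := (Finset.mem_filter.mp hf).2
    have h := (T'.domDomCongr (Equiv.ofBijective f hb)).sum_signCoeff_diagonal i₀ c
      (fun j : Fin M => c0Basis 𝕂 j)
    simp only [MultilinearMap.domDomCongr_apply, Equiv.ofBijective_apply] at h
    refine h.trans ?_
    simp only [S, hT]
    rfl
  have hmain : ∑ r, ∑ ε : I → ℤˣ, (∏ i, ((ε i : ℤ) : 𝕂)) * P (x r ε) =
      Fintype.card (I → Fin M → ℤˣ) * Fintype.card (I → ℤˣ) * (A.card * S) := by
    have h (r : I → Fin M → ℤˣ) : ∑ ε : I → ℤˣ, (∏ i, ((ε i : ℤ) : 𝕂)) * P (x r ε) =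
        Fintype.card (I → ℤˣ) * ∑ f ∈ A, T' (fun i => y r (f i)) := by
      rw [← T'.sum_signs_blocks Sigma.fst (y r)]
      simp only [hT]
      rfl
    simp only [h]
    rw [← Finset.mul_sum, Finset.sum_comm, Finset.sum_congr rfl hdiag, Finset.sum_const,
      nsmul_eq_mul]
    ring
  have hx (r : I → Fin M → ℤˣ) (ε : I → ℤˣ) (k : Fin m) : ‖x r ε k‖ ≤ N := by
    refine (norm_sum_le_of_le _ fun l _ => (?_ : _ ≤ (1 : ℝ))).trans ?_
    · rw [norm_smul, norm_intUnit_cast, one_mul]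
      exact norm_sum_smul_c0Basis_le _ fun j => norm_signCoeff_le i₀ hc r l j
    · simpa using Finset.card_le_univ (Finset.univ.filter fun l : I => l.1 = k)
  have hbound : ‖∑ r, ∑ ε : I → ℤˣ, (∏ i, ((ε i : ℤ) : 𝕂)) * P (x r ε)‖ ≤
      Fintype.card (I → Fin M → ℤˣ) * Fintype.card (I → ℤˣ) * B := by
    have hterm (r : I → Fin M → ℤˣ) (ε : I → ℤˣ) :
        ‖(∏ i, ((ε i : ℤ) : 𝕂)) * P (x r ε)‖ ≤ B := by
      rw [norm_mul, norm_prod]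
      simp only [norm_intUnit_cast, Finset.prod_const_one, one_mul]
      exact hP.norm_le_pow_mul (Fintype.card_pos_iff.mpr ⟨i₀⟩) (hx r ε)
    refine (norm_sum_le_of_le _ fun r _ => norm_sum_le_of_le _ fun ε _ => hterm r ε).trans ?_
    simp only [Finset.sum_const, Finset.card_univ, nsmul_eq_mul, mul_assoc, le_refl]
  rw [hmain] at hbound
  simp only [norm_mul, RCLike.norm_natCast] at hbound
  have hpos : (0 : ℝ) < Fintype.card (I → Fin M → ℤˣ) * Fintype.card (I → ℤˣ) := by
    have h₁ : 0 < Fintype.card (I → Fin M → ℤˣ) := Fintype.card_pos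
    have h₂ : 0 < Fintype.card (I → ℤˣ) := Fintype.card_pos
    positivity
  refine le_trans ?_ (le_of_mul_le_mul_left hbound hpos)
  exact le_mul_of_one_le_left (norm_nonneg _)
    (Nat.one_le_cast.mpr (Finset.card_pos.mpr ⟨_, hid⟩))

theorem IsMultiPoly.sum_norm_c0Basis_le {𝕂 : Type*} [RCLike 𝕂] {m : ℕ} {n : Fin m → ℕ}
    {P : (∀ _ : Fin m, ZeroAtInftyContinuousMap ℕ 𝕂) → 𝕂} (hP : IsMultiPoly 𝕂 n P)
    (i₀ : Σ k : Fin m, Fin (n k)) (M : ℕ) :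
    ∑ j ∈ Finset.range M, ‖P (fun _ => c0Basis 𝕂 j)‖ ≤
      (Fintype.card (Σ k : Fin m, Fin (n k)) : ℝ) ^ Fintype.card (Σ k : Fin m, Fin (n k)) *
        multipolyNorm P := by
  have hphase (z : 𝕂) : ∃ c : 𝕂, ‖c‖ ≤ 1 ∧ c * z = (‖z‖ : ℝ) := by
    obtain ⟨c, hc, h⟩ := RCLike.exists_norm_mul_eq_self z
    refine ⟨c⁻¹, by simp [hc], ?_⟩
    have hc₀ : c ≠ 0 := norm_ne_zero_iff.mp (by simp [hc])
    rw [inv_mul_eq_iff_eq_mul₀ hc₀, h]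
  choose c hc hcz using hphase
  have h := hP.norm_sum_mul_c0Basis_le i₀ (fun j : Fin M => c (P fun _ => c0Basis 𝕂 j))
    fun _ => hc _
  simp only [hcz] at h
  rw [← RCLike.ofReal_sum, RCLike.norm_ofReal, abs_of_nonneg (by positivity)] at h
  rwa [← Fin.sum_univ_eq_sum_range fun j => ‖P (fun _ => c0Basis 𝕂 j)‖]

/-- There is a constant `C > 0`, depending only on `(n₁,…,n_m)`, such that for every
continuous `(n₁,…,n_m)`-homogeneous polynomial `P : c₀ × ⋯ × c₀ → 𝕂` one has
`∑_j ‖P (e_j,…,e_j)‖ ≤ C * ‖P‖`. -/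
theorem stmt1 (𝕂 : Type*) [RCLike 𝕂] (m : ℕ) (hm : 0 < m) (n : Fin m → ℕ)
    (hn : ∀ k, 0 < n k) :
    ∃ C : ℝ, 0 < C ∧ ∀ P : (∀ _ : Fin m, ZeroAtInftyContinuousMap ℕ 𝕂) → 𝕂,
      IsMultiPoly 𝕂 n P →
        Summable (fun j => ‖P fun _ => c0Basis 𝕂 j‖) ∧
        ∑' j, ‖P fun _ => c0Basis 𝕂 j‖ ≤ C * multipolyNorm P := by
  have i₀ : Σ k : Fin m, Fin (n k) := ⟨⟨0, hm⟩, ⟨0, hn _⟩⟩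
  have hN : 0 < Fintype.card (Σ k : Fin m, Fin (n k)) := Fintype.card_pos_iff.mpr ⟨i₀⟩
  refine ⟨(Fintype.card (Σ k : Fin m, Fin (n k)) : ℝ) ^ Fintype.card (Σ k : Fin m, Fin (n k)),
    by positivity, fun P hP => ⟨?_, ?_⟩⟩
  · exact summable_of_sum_range_le (fun _ => norm_nonneg _) (hP.sum_norm_c0Basis_le i₀)
  · exact Real.tsum_le_of_sum_range_le (fun _ => norm_nonneg _) (hP.sum_norm_c0Basis_le i₀)
end

section
/- (Maurey–Talagrand) Let X be a Banach space and 2 ≤ q < ∞. If X has cotype q, then the identity operator id_X : X → X is absolutely (q;1)-summing, i.e., ∑_j ‖x_j‖^q < ∞ for every weakly 1-summable sequence (x_j) in X. Conversely, if q ≠ 2 and id_X is absolutely (q;1)-summing, then X has cotype q. -/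
open scoped BigOperators

/-- A sequence in a normed space is *weakly 1-summable*. -/
def WeaklySummable (𝕂 : Type*) [RCLike 𝕂] {X : Type*} [NormedAddCommGroup X]
    [NormedSpace 𝕂 X] (x : ℕ → X) : Prop :=
  ∀ φ : X →L[𝕂] 𝕂, Summable fun j => ‖φ (x j)‖

/-- A normed space has cotype `q` (Rademacher averages written as an average over signs). -/
def HasCotype (X : Type*) [NormedAddCommGroup X] (q : ℝ) : Prop :=
  ∃ C : ℝ, 0 ≤ C ∧ ∀ (k : ℕ) (x : Fin k → X),
    (∑ j, ‖x j‖ ^ q) ^ (1 / q) ≤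
      C * Real.sqrt ((2 ^ k : ℝ)⁻¹ *
        ∑ ε : Fin k → Bool, ‖∑ j, (if ε j then x j else -x j)‖ ^ 2)

set_option linter.unusedSectionVars false

/-- The sign `±1` encoded by a Boolean. -/
def boolSign (b : Bool) : ℝ := if b then 1 else -1

@[simp] lemma boolSign_true : boolSign true = 1 := rfl
@[simp] lemma boolSign_false : boolSign false = -1 := rfl
lemma boolSign_not (b : Bool) : boolSign (!b) = -boolSign b := by cases b <;> simp

lemma abs_boolSign (b : Bool) : |boolSign b| = 1 := by cases b <;> simp
lemma boolSign_sq (b : Bool) : boolSign b ^ 2 = 1 := by cases b <;> simp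

lemma ciSup_add_abs_le {T : Type*} [Nonempty T] (A c : T → ℝ) (M : ℝ) (hA : ∀ t, |A t| ≤ M)
    (hc : ∀ t, |c t| ≤ M) :
    (⨆ t, (A t + |c t|)) + (⨆ t, (A t - |c t|)) ≤ (⨆ t, (A t + c t)) + (⨆ t, (A t - c t)) := by
  have hA' := fun t => abs_le.1 (hA t)
  have hc' := fun t => abs_le.1 (hc t)
  have b1 : BddAbove (Set.range fun t => A t + c t) :=
    ⟨2 * M, by rintro _ ⟨t, rfl⟩; have := hA' t; have := hc' t; simp only; linarith⟩
  have b2 : BddAbove (Set.range fun t => A t - c t) :=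
    ⟨2 * M, by rintro _ ⟨t, rfl⟩; have := hA' t; have := hc' t; simp only; linarith⟩
  rw [← le_sub_iff_add_le]
  refine ciSup_le fun t => ?_
  rw [le_sub_iff_add_le, ← le_sub_iff_add_le']
  refine ciSup_le fun t' => ?_
  have h1 := le_ciSup b1 t
  have h2 := le_ciSup b2 t
  have h3 := le_ciSup b1 t'
  have h4 := le_ciSup b2 t'
  rcases abs_cases (c t) with ⟨h, _⟩ | ⟨h, _⟩ <;> rcases abs_cases (c t') with ⟨h', _⟩ | ⟨h', _⟩ <;>
    rw [h, h'] <;> linarith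

section Contraction
variable {K : Type} [DecidableEq K]

/-- Flip the sign of one coordinate. -/
def flipAt (k : K) : (K → Bool) ≃ (K → Bool) :=
  Function.Involutive.toPerm (fun θ => Function.update θ k (!θ k)) (by
    intro θ; ext l; by_cases h : l = k
    · subst h; simp
    · simp [h])

lemma flipAt_same (k : K) (θ : K → Bool) : flipAt k θ k = !θ k := by
  simp [flipAt, Function.Involutive.toPerm]
lemma flipAt_ne {k l : K} (h : l ≠ k) (θ : K → Bool) : flipAt k θ l = θ l := by
  simp [flipAt, Function.Involutive.toPerm, h]

lemma expect_le_of_flip [Fintype K] (k : K) (F G : (K → Bool) → ℝ)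
    (h : ∀ θ, F θ + F (flipAt k θ) ≤ G θ + G (flipAt k θ)) : 𝔼 θ, F θ ≤ 𝔼 θ, G θ := by
  have e (F : (K → Bool) → ℝ) : 𝔼 θ, F (flipAt k θ) = 𝔼 θ, F θ :=
    Fintype.expect_equiv (flipAt k) _ _ fun _ => rfl
  have := Finset.expect_le_expect (s := Finset.univ) fun θ _ => h θ
  rw [Finset.expect_add_distrib, Finset.expect_add_distrib, e, e] at this
  linarith

lemma expect_ciSup_abs_le [Fintype K] {T : Type*} [Nonempty T] (a : T → K → ℝ) (M : ℝ)
    (ha : ∀ t k, |a t k| ≤ M) :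
    𝔼 θ : K → Bool, (⨆ t, ∑ k, boolSign (θ k) * |a t k|) ≤
      𝔼 θ : K → Bool, (⨆ t, ∑ k, boolSign (θ k) * a t k) := by
  suffices h : ∀ s : Finset K,
      𝔼 θ : K → Bool, (⨆ t, ∑ k, boolSign (θ k) * (if k ∈ s then |a t k| else a t k)) ≤
      𝔼 θ : K → Bool, (⨆ t, ∑ k, boolSign (θ k) * a t k) by
    simpa using h Finset.univ
  intro s
  induction s using Finset.induction_on with
  | empty => simp
  | insert k s hk ih =>
    refine le_trans (expect_le_of_flip k _ _ fun θ => ?_) ih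
    let A (t : T) : ℝ := ∑ l ∈ Finset.univ.erase k,
      boolSign (θ l) * (if l ∈ s then |a t l| else a t l)
    have split (θ' : K → Bool) (hθ : ∀ l ≠ k, θ' l = θ l) (t : T) :
        ∑ l, boolSign (θ' l) * (if l ∈ insert k s then |a t l| else a t l)
          = A t + boolSign (θ' k) * |a t k| := by
      rw [← Finset.sum_erase_add _ _ (Finset.mem_univ k)]
      congr 1
      · refine Finset.sum_congr rfl fun l hl => ?_
        have hl' := Finset.ne_of_mem_erase hl
        simp [hθ l hl', hl']
      · simp
    have split' (θ' : K → Bool) (hθ : ∀ l ≠ k, θ' l = θ l) (t : T) :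
        ∑ l, boolSign (θ' l) * (if l ∈ s then |a t l| else a t l)
          = A t + boolSign (θ' k) * a t k := by
      rw [← Finset.sum_erase_add _ _ (Finset.mem_univ k)]
      congr 1
      · refine Finset.sum_congr rfl fun l hl => ?_
        have hl' := Finset.ne_of_mem_erase hl
        simp [hθ l hl']
      · simp [hk]
    have M0 : 0 ≤ M := (abs_nonneg _).trans (ha (Classical.arbitrary T) k)
    have hA : ∀ t, |A t| ≤ Fintype.card K * M + M := fun t => by
      have : |A t| ≤ ∑ l ∈ Finset.univ.erase k, M := by
        refine (Finset.abs_sum_le_sum_abs _ _).trans (Finset.sum_le_sum fun l _ => ?_)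
        rw [abs_mul, abs_boolSign, one_mul]
        split_ifs
        · rw [abs_abs]; exact ha t l
        · exact ha t l
      refine this.trans ?_
      rw [Finset.sum_const, nsmul_eq_mul]
      have : ((Finset.univ.erase k).card : ℝ) ≤ Fintype.card K := by
        exact_mod_cast Finset.card_le_univ _
      nlinarith
    have hc : ∀ t, |a t k| ≤ Fintype.card K * M + M := fun t => by
      have := ha t k
      have : (0 : ℝ) ≤ Fintype.card K * M := by positivity
      linarith [ha t k]
    have key := ciSup_add_abs_le A (fun t => a t k) _ hA hc
    have hf := fun l (hl : l ≠ k) => flipAt_ne hl θ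
    simp only [split θ (fun _ _ => rfl), split' θ (fun _ _ => rfl), split _ hf, split' _ hf,
      flipAt_same]
    cases θ k <;> simp <;> simp only [sub_eq_add_neg] at key <;> linarith

end Contraction

section Decoupling
variable {ι K Ω : Type} [Fintype ι] [DecidableEq ι] [Fintype K] [DecidableEq K] [Fintype Ω]
  [Nonempty Ω]

lemma abs_sum_boolSign_le {K : Type} [Fintype K] (f : K → ℝ) (θ : K → Bool) (M : ℝ)
    (hf : ∀ k, |f k| ≤ M) :
    |∑ k, boolSign (θ k) * f k| ≤ Fintype.card K * M := by
  refine (Finset.abs_sum_le_sum_abs _ _).trans ?_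
  refine (Finset.sum_le_sum fun k _ => (?_ : _ ≤ M)).trans ?_
  · rw [abs_mul, abs_boolSign, one_mul]; exact hf k
  · simp

/-- Exchange two samples on the blocks marked by `θ`. -/
def swapBlocks (κ : ι → K) (θ : K → Bool) : ((ι → Ω) × (ι → Ω)) ≃ ((ι → Ω) × (ι → Ω)) :=
  Function.Involutive.toPerm
    (fun p =>
      (fun i => if θ (κ i) then p.1 i else p.2 i, fun i => if θ (κ i) then p.2 i else p.1 i))
    (by rintro ⟨p, p'⟩; ext i <;> by_cases h : θ (κ i) <;> simp [h])

/-- Decoupling and symmetrisation of a blockwise defined random process. -/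
lemma expect_ciSup_le {T : Type*} [Nonempty T] (κ : ι → K) (f : (ι → Ω) → T → K → ℝ) (M B : ℝ)
    (hf : ∀ ω t k, |f ω t k| ≤ M)
    (hloc : ∀ ω ω' t k, (∀ i, κ i = k → ω i = ω' i) → f ω t k = f ω' t k)
    (hB : ∀ t, 𝔼 ω, ∑ k, f ω t k ≤ B) :
    𝔼 ω, (⨆ t, ∑ k, f ω t k) ≤
      B + 2 * 𝔼 ω, 𝔼 θ : K → Bool, (⨆ t, ∑ k, boolSign (θ k) * f ω t k) := by
  set Mt : ℝ := Fintype.card K * M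
  have hbd (θ : K → Bool) (ω) (t) : |∑ k, boolSign (θ k) * f ω t k| ≤ Mt :=
    abs_sum_boolSign_le _ _ _ (hf ω t)
  have hbd1 (ω) (t) : |∑ k, f ω t k| ≤ Mt := by simpa using hbd (fun _ => true) ω t
  have hbdd (θ : K → Bool) (ω) :
      BddAbove (Set.range fun t => ∑ k, boolSign (θ k) * f ω t k) :=
    ⟨Mt, by rintro _ ⟨t, rfl⟩; exact (abs_le.1 (hbd θ ω t)).2⟩
  let D (p : (ι → Ω) × (ι → Ω)) : ℝ := ⨆ t, ∑ k, (f p.1 t k - f p.2 t k)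
  have h1 (ω) : (⨆ t, ∑ k, f ω t k) ≤ B + 𝔼 ω', D (ω, ω') := by
    refine ciSup_le fun t => ?_
    have hD (ω') : ∑ k, f ω t k - ∑ k, f ω' t k ≤ D (ω, ω') := by
      rw [← Finset.sum_sub_distrib]
      refine le_ciSup (f := fun t => ∑ k, (f ω t k - f ω' t k)) ⟨Mt + Mt, ?_⟩ t
      rintro _ ⟨t, rfl⟩
      simp only [Finset.sum_sub_distrib]
      have := abs_le.1 (hbd1 ω t); have := abs_le.1 (hbd1 ω' t); linarith
    have := Finset.expect_le_expect (s := Finset.univ) fun ω' _ => hD ω'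
    rw [Finset.expect_sub_distrib, Finset.expect_const Finset.univ_nonempty] at this
    linarith [hB t]
  have h2 : 𝔼 ω, (⨆ t, ∑ k, f ω t k) ≤ B + 𝔼 p, D p := by
    have := Finset.expect_le_expect (s := Finset.univ) fun ω _ => h1 ω
    rw [Finset.expect_add_distrib, Finset.expect_const Finset.univ_nonempty] at this
    refine this.trans_eq ?_
    rw [← Finset.univ_product_univ, Finset.expect_product]
  refine h2.trans ?_
  gcongr
  let U (θ : K → Bool) (ω) : ℝ := ⨆ t, ∑ k, boolSign (θ k) * f ω t k
  have h3 (θ : K → Bool) (p) : D (swapBlocks κ θ p) ≤ U θ p.1 + U (fun k => !θ k) p.2 := by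
    refine ciSup_le fun t => ?_
    have e : ∑ k, (f (swapBlocks κ θ p).1 t k - f (swapBlocks κ θ p).2 t k) =
        (∑ k, boolSign (θ k) * f p.1 t k) + ∑ k, boolSign (!θ k) * f p.2 t k := by
      rw [← Finset.sum_add_distrib]
      refine Finset.sum_congr rfl fun k _ => ?_
      cases h : θ k
      · rw [hloc (swapBlocks κ θ p).1 p.2, hloc (swapBlocks κ θ p).2 p.1]
        · simp; ring
        all_goals intro i hi; simp [swapBlocks, Function.Involutive.toPerm, hi, h]
      · rw [hloc (swapBlocks κ θ p).1 p.1, hloc (swapBlocks κ θ p).2 p.2]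
        · simp; ring
        all_goals intro i hi; simp [swapBlocks, Function.Involutive.toPerm, hi, h]
    rw [e]
    exact add_le_add (le_ciSup (hbdd θ p.1) t) (le_ciSup (hbdd (fun k => !θ k) p.2) t)
  have h4 (θ : K → Bool) : 𝔼 p, D p ≤ 𝔼 ω, U θ ω + 𝔼 ω, U (fun k => !θ k) ω := by
    rw [← Fintype.expect_equiv (swapBlocks κ θ) (fun p => D (swapBlocks κ θ p)) D fun _ => rfl]
    refine (Finset.expect_le_expect fun p _ => h3 θ p).trans_eq ?_
    rw [Finset.expect_add_distrib, ← Finset.univ_product_univ, Finset.expect_product,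
      Finset.expect_product]
    simp [Finset.expect_const]
  have h5 : 𝔼 p, D p ≤ 𝔼 θ : K → Bool, (𝔼 ω, U θ ω + 𝔼 ω, U (fun k => !θ k) ω) :=
    Finset.le_expect Finset.univ_nonempty fun θ _ => h4 θ
  rw [Finset.expect_add_distrib] at h5
  have h6 : 𝔼 θ : K → Bool, 𝔼 ω, U (fun k => !θ k) ω = 𝔼 θ, 𝔼 ω, U θ ω :=
    Fintype.expect_equiv (Equiv.arrowCongr (Equiv.refl K) Equiv.boolNot) _ _ fun _ => by
      rfl
  rw [h6, Finset.expect_comm] at h5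
  refine h5.trans_eq ?_
  ring

end Decoupling

section Moments
variable {ι Ω : Type} [Fintype ι] [DecidableEq ι] [Fintype Ω] [Nonempty Ω]

lemma expect_apply (g : Ω → ℝ) (i : ι) : 𝔼 ω : ι → Ω, g (ω i) = 𝔼 w, g w := by
  classical
  rw [Fintype.expect_equiv (Equiv.funSplitAt i Ω) (fun ω => g (ω i)) (fun p => g p.1) fun _ => rfl,
    ← Finset.univ_product_univ, Finset.expect_product]
  simp [Finset.expect_const]

lemma expect_sum_sq (r : Ω → ℝ) (σ : Ω ≃ Ω) (hσ : ∀ w, r (σ w) = -r w) (c : ι → ℝ) :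
    𝔼 ω : ι → Ω, (∑ i, r (ω i) * c i) ^ 2 = (𝔼 w, r w ^ 2) * ∑ i, c i ^ 2 := by
  have h : ∀ i j, 𝔼 ω : ι → Ω, r (ω i) * c i * (r (ω j) * c j) =
      if i = j then (𝔼 w, r w ^ 2) * c i ^ 2 else 0 := by
    intro i j
    split_ifs with hij
    · subst hij
      rw [← expect_apply (ι := ι) (fun w => r w ^ 2) i, Finset.expect_mul]
      refine Finset.expect_congr rfl fun ω _ => by ring
    · have e := Fintype.expect_equiv
        (Equiv.piCongrRight fun l => if l = i then σ else Equiv.refl Ω)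
        (fun ω : ι → Ω => -(r (ω i) * c i * (r (ω j) * c j)))
        (fun ω : ι → Ω => r (ω i) * c i * (r (ω j) * c j)) fun ω => by
          simp [Ne.symm hij, hσ]
      rw [Finset.expect_neg_distrib] at e
      linarith
  simp_rw [sq, Finset.sum_mul_sum, Finset.expect_sum_comm, h, Finset.mul_sum]
  simp [sq]

lemma sq_expect_le {α : Type*} [Fintype α] [Nonempty α] (f : α → ℝ) :
    (𝔼 a, f a) ^ 2 ≤ 𝔼 a, f a ^ 2 := by
  have h := Finset.expect_nonneg (s := Finset.univ) (f := fun a => (f a - 𝔼 b, f b) ^ 2)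
    fun _ _ => sq_nonneg _
  have e : 𝔼 a, (f a - 𝔼 b, f b) ^ 2 = 𝔼 a, f a ^ 2 - (𝔼 a, f a) ^ 2 := by
    simp_rw [sub_sq, Finset.expect_add_distrib, Finset.expect_sub_distrib, mul_assoc,
      ← Finset.mul_expect, ← Finset.expect_mul, Finset.expect_const Finset.univ_nonempty]
    ring
  linarith

end Moments

/-- `id_X` is absolutely `(q;1)`-summing with constant `π`, for finite families. -/
def SumIneq (X : Type*) [NormedAddCommGroup X] [NormedSpace ℝ X] (q π : ℝ) : Prop :=
  ∀ (K : Type) [Fintype K] (y : K → X) (A : ℝ),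
    (∀ t : X →L[ℝ] ℝ, ‖t‖ ≤ 1 → ∑ k, |t (y k)| ≤ A) → (∑ k, ‖y k‖ ^ q) ^ (1 / q) ≤ π * A

section
variable {X : Type*} [NormedAddCommGroup X] [NormedSpace ℝ X]

/-- The average of `‖∑ r(ω_i) x_i‖` over independent uniform `ω_i ∈ Ω`. -/
noncomputable def avgNorm {ι Ω : Type} [Fintype ι] [DecidableEq ι] [Fintype Ω] (r : Ω → ℝ)
    (x : ι → X) : ℝ := 𝔼 ω : ι → Ω, ‖∑ i, r (ω i) • x i‖

/-- Sum of a random family over one block of a partition. -/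
def blockSum {ι K Ω : Type} [Fintype ι] [DecidableEq K] (κ : ι → K) (r : Ω → ℝ) (x : ι → X)
    (ω : ι → Ω) (k : K) : X := ∑ i with κ i = k, r (ω i) • x i

variable {ι K Ω : Type} [Fintype ι] [DecidableEq ι] [Fintype K] [DecidableEq K] [Fintype Ω]
  [Nonempty Ω]

lemma abs_apply_le {t : X →L[ℝ] ℝ} (ht : ‖t‖ ≤ 1) (y : X) : |t y| ≤ ‖y‖ := by
  have := t.le_of_opNorm_le ht y
  simpa using this

lemma expect_abs_apply_blockSum_le (r : Ω → ℝ) (σ : Ω ≃ Ω) (hσ : ∀ w, r (σ w) = -r w) (ρ : ℝ)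
    (hρ0 : 0 ≤ ρ) (hρ : 𝔼 w, r w ^ 2 ≤ ρ ^ 2) (κ : ι → K) (x : ι → X) (t : X →L[ℝ] ℝ) (k : K) :
    𝔼 ω, |t (blockSum κ r x ω k)| ≤ ρ * Real.sqrt (∑ i with κ i = k, t (x i) ^ 2) := by
  have h1 := sq_expect_le fun ω : ι → Ω => |t (blockSum κ r x ω k)|
  have h2 := expect_sum_sq r σ hσ (fun i => if κ i = k then t (x i) else 0)
  have e1 : ∀ ω, t (blockSum κ r x ω k) = ∑ i, r (ω i) * (if κ i = k then t (x i) else 0) := by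
    intro ω
    simp [blockSum, Finset.sum_filter, apply_ite t]
  have e2 : ∑ i, (if κ i = k then t (x i) else 0) ^ 2 = ∑ i with κ i = k, t (x i) ^ 2 := by
    simp [Finset.sum_filter, ite_pow]
  simp_rw [sq_abs, e1] at h1
  simp_rw [e1]
  rw [h2, e2] at h1
  have h3 : 0 ≤ ∑ i with κ i = k, t (x i) ^ 2 := Finset.sum_nonneg fun _ _ => sq_nonneg _
  refine le_of_abs_le (abs_le_of_sq_le_sq ?_ (by positivity))
  rw [mul_pow, Real.sq_sqrt h3]
  exact h1.trans (mul_le_mul_of_nonneg_right hρ h3)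

/-- The core inequality. -/
lemma expect_blocks_le {q π : ℝ} (hπ : SumIneq X q π) (hπ0 : 0 ≤ π) (r : Ω → ℝ)
    (σ : Ω ≃ Ω)
    (hσ : ∀ w, r (σ w) = -r w) (ρ : ℝ) (hρ0 : 0 ≤ ρ) (hρ : 𝔼 w, r w ^ 2 ≤ ρ ^ 2)
    (κ : ι → K) (x : ι → X) (B : ℝ)
    (hB : ∀ t : X →L[ℝ] ℝ, ‖t‖ ≤ 1 → ∑ k, ρ * Real.sqrt (∑ i with κ i = k, t (x i) ^ 2) ≤ B) :
    𝔼 ω, (∑ k, ‖blockSum κ r x ω k‖ ^ q) ^ (1 / q) ≤ π * (B + 2 * avgNorm r x) := by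
  let T := {t : X →L[ℝ] ℝ // ‖t‖ ≤ 1}
  have : Nonempty T := ⟨⟨0, by simp⟩⟩
  obtain ⟨M, hM⟩ : ∃ M : ℝ, ∀ ω k, ‖blockSum κ r x ω k‖ ≤ M := by
    obtain ⟨M, hM⟩ := Finite.bddAbove_range fun p : (ι → Ω) × K => ‖blockSum κ r x p.1 p.2‖
    exact ⟨M, fun ω k => hM ⟨(ω, k), rfl⟩⟩
  have hf : ∀ ω (t : T) k, |(|t.1 (blockSum κ r x ω k)|)| ≤ M := fun ω t k => by
    rw [abs_abs]; exact (abs_apply_le t.2 _).trans (hM ω k)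
  have key := expect_ciSup_le κ (fun ω (t : T) k => |t.1 (blockSum κ r x ω k)|) M B hf
    (fun ω ω' t k h => by
      have : blockSum κ r x ω k = blockSum κ r x ω' k := by
        refine Finset.sum_congr rfl fun i hi => ?_
        rw [h i (by simpa using hi)]
      simp only [this])
    (fun t => by
      rw [Finset.expect_sum_comm]
      exact (Finset.sum_le_sum fun k _ =>
        expect_abs_apply_blockSum_le r σ hσ ρ hρ0 hρ κ x t.1 k).trans (hB t.1 t.2))
  have h1 : 𝔼 ω, (∑ k, ‖blockSum κ r x ω k‖ ^ q) ^ (1 / q) ≤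
      π * 𝔼 ω, (⨆ t : T, ∑ k, |t.1 (blockSum κ r x ω k)|) := by
    rw [Finset.mul_expect]
    refine Finset.expect_le_expect fun ω _ => hπ K _ _ fun t ht => ?_
    refine le_ciSup (f := fun t : T => ∑ k, |t.1 (blockSum κ r x ω k)|)
      ⟨Fintype.card K * M, ?_⟩ ⟨t, ht⟩
    rintro _ ⟨t, rfl⟩
    refine (Finset.sum_le_sum fun k _ => (abs_apply_le t.2 _).trans (hM ω k)).trans ?_
    simp
  refine h1.trans (mul_le_mul_of_nonneg_left (key.trans ?_) hπ0)
  gcongr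
  have h2 (ω : ι → Ω) : 𝔼 θ : K → Bool,
        (⨆ t : T, ∑ k, boolSign (θ k) * |t.1 (blockSum κ r x ω k)|) ≤
      𝔼 θ : K → Bool, ‖∑ k, boolSign (θ k) • blockSum κ r x ω k‖ := by
    refine (expect_ciSup_abs_le (fun (t : T) k => t.1 (blockSum κ r x ω k)) M fun t k =>
      (abs_apply_le t.2 _).trans (hM ω k)).trans (Finset.expect_le_expect fun θ _ =>
        ciSup_le fun t => ?_)
    have := abs_apply_le t.2 (∑ k, boolSign (θ k) • blockSum κ r x ω k)
    simp only [map_sum, map_smul, smul_eq_mul] at this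
    exact (le_abs_self _).trans this
  refine (Finset.expect_le_expect fun ω _ => h2 ω).trans ?_
  rw [Finset.expect_comm]
  refine Finset.expect_le Finset.univ_nonempty fun θ _ => le_of_eq ?_
  refine Fintype.expect_equiv
    (Equiv.piCongrRight fun i => if θ (κ i) then Equiv.refl Ω else σ) _ _ fun ω => ?_
  congr 1
  rw [← Finset.sum_fiberwise _ κ]
  refine Finset.sum_congr rfl fun k _ => ?_
  rw [blockSum, Finset.smul_sum]
  refine Finset.sum_congr rfl fun i hi => ?_
  obtain rfl : κ i = k := by simpa using hi
  cases h : θ (κ i) <;> simp [h, hσ]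

end

lemma expect_prod_apply {ι A : Type} [Fintype ι] [DecidableEq ι] [Fintype A] (f : ι → A → ℝ) :
    𝔼 c : ι → A, ∏ i, f i (c i) = ∏ i, 𝔼 a, f i a := by
  simp_rw [Fintype.expect_eq_sum_div_card, Finset.prod_div_distrib, Finset.prod_univ_sum]
  simp

section
variable {X : Type*} [NormedAddCommGroup X] [NormedSpace ℝ X]
variable {ι : Type} [Fintype ι] [DecidableEq ι]

/-- Restrict a family to a finite set of indices, filling in zeros. -/
def restrictFam (s : Finset ι) (x : ι → X) (i : ι) : X := if i ∈ s then x i else 0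

lemma restrictFam_of_mem {s : Finset ι} {i : ι} (h : i ∈ s) (x : ι → X) :
    restrictFam s x i = x i := by simp [restrictFam, h]

/-- The Rademacher `L²` average. -/
noncomputable def rad2 (x : ι → X) : ℝ :=
  Real.sqrt (𝔼 ε : ι → Bool, ‖∑ i, boolSign (ε i) • x i‖ ^ 2)

lemma rad2_nonneg (x : ι → X) : 0 ≤ rad2 x := Real.sqrt_nonneg _

lemma rad2_sq (x : ι → X) : rad2 x ^ 2 = 𝔼 ε : ι → Bool, ‖∑ i, boolSign (ε i) • x i‖ ^ 2 :=
  Real.sq_sqrt (Finset.expect_nonneg fun _ _ => by positivity)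

lemma avgNorm_nonneg {Ω : Type} [Fintype Ω] (r : Ω → ℝ) (x : ι → X) : 0 ≤ avgNorm r x :=
  Finset.expect_nonneg fun _ _ => by positivity

lemma avgNorm_le_rad2 (x : ι → X) : avgNorm boolSign x ≤ rad2 x :=
  Real.le_sqrt_of_sq_le (sq_expect_le _)

/-- Reverse the signs outside `s`. -/
def flipOff (s : Finset ι) : (ι → Bool) ≃ (ι → Bool) :=
  Equiv.piCongrRight fun i => if i ∈ s then Equiv.refl Bool else Equiv.boolNot

lemma sum_restrictFam (s : Finset ι) (x : ι → X) (ε : ι → Bool) :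
    ∑ i, boolSign (ε i) • restrictFam s x i = (1 / 2 : ℝ) •
      (∑ i, boolSign (ε i) • x i + ∑ i, boolSign (flipOff s ε i) • x i) := by
  rw [← Finset.sum_add_distrib, Finset.smul_sum]
  refine Finset.sum_congr rfl fun i _ => ?_
  by_cases h : i ∈ s
  · simp only [restrictFam, h, flipOff, Equiv.piCongrRight_apply, Pi.map_apply, if_true,
      Equiv.refl_apply, ← two_smul ℝ (boolSign (ε i) • x i)]
    module
  · simp only [restrictFam, h, flipOff, Equiv.piCongrRight_apply, Pi.map_apply, if_false,
      Equiv.boolNot_apply, boolSign_not]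
    module

lemma avgNorm_restrictFam_le (s : Finset ι) (x : ι → X) :
    avgNorm boolSign (restrictFam s x) ≤ avgNorm boolSign x := by
  have e := Fintype.expect_equiv (flipOff s)
    (fun ε => ‖∑ i, boolSign (flipOff s ε i) • x i‖)
    (fun ε => ‖∑ i, boolSign (ε i) • x i‖) fun _ => rfl
  have h : ∀ ε : ι → Bool, ‖∑ i, boolSign (ε i) • restrictFam s x i‖ ≤
      (1 / 2 : ℝ) * (‖∑ i, boolSign (ε i) • x i‖ + ‖∑ i, boolSign (flipOff s ε i) • x i‖) := by
    intro ε
    rw [sum_restrictFam, norm_smul]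
    norm_num
    exact norm_add_le _ _
  have := Finset.expect_le_expect (s := Finset.univ) fun ε _ => h ε
  rw [← Finset.mul_expect, Finset.expect_add_distrib, e] at this
  unfold avgNorm
  linarith

lemma rad2_add_le (x y : ι → X) : rad2 (fun i => x i + y i) ≤ rad2 x + rad2 y := by
  refine Real.sqrt_le_iff.2 ⟨add_nonneg (rad2_nonneg _) (rad2_nonneg _), ?_⟩
  have h1 : ∀ ε : ι → Bool, ‖∑ i, boolSign (ε i) • (x i + y i)‖ ^ 2 ≤
      ‖∑ i, boolSign (ε i) • x i‖ ^ 2 + 2 * (‖∑ i, boolSign (ε i) • x i‖ *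
        ‖∑ i, boolSign (ε i) • y i‖) + ‖∑ i, boolSign (ε i) • y i‖ ^ 2 := by
    intro ε
    simp only [smul_add, Finset.sum_add_distrib]
    have := norm_add_le (∑ i, boolSign (ε i) • x i) (∑ i, boolSign (ε i) • y i)
    have := norm_nonneg (∑ i, boolSign (ε i) • x i + ∑ i, boolSign (ε i) • y i)
    nlinarith
  refine (Finset.expect_le_expect fun ε _ => h1 ε).trans ?_
  rw [Finset.expect_add_distrib, Finset.expect_add_distrib, ← Finset.mul_expect, ← rad2_sq,
    ← rad2_sq]
  have h2 := Finset.expect_mul_sq_le_sq_mul_sq (Finset.univ : Finset (ι → Bool))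
    (fun ε => ‖∑ i, boolSign (ε i) • x i‖) fun ε => ‖∑ i, boolSign (ε i) • y i‖
  rw [← rad2_sq, ← rad2_sq, ← mul_pow] at h2
  have := le_of_abs_le (abs_le_of_sq_le_sq h2 (mul_nonneg (rad2_nonneg _) (rad2_nonneg _)))
  nlinarith

lemma rad2_smul (c : ℝ) (x : ι → X) : rad2 (fun i => c • x i) = |c| * rad2 x := by
  unfold rad2
  rw [← Real.sqrt_sq (abs_nonneg c), ← Real.sqrt_mul (by positivity), Finset.mul_expect]
  congr 1
  refine Finset.expect_congr rfl fun ε _ => ?_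
  simp_rw [smul_comm _ c, ← Finset.smul_sum, norm_smul, mul_pow, Real.norm_eq_abs]

lemma rad2_flip (s : Finset ι) (x : ι → X) :
    rad2 (fun i => if i ∈ s then x i else -x i) = rad2 x := by
  unfold rad2
  congr 1
  refine Fintype.expect_equiv (flipOff s) _ _ fun ε => ?_
  congr 3
  ext i
  by_cases h : i ∈ s <;> simp [h, flipOff, boolSign_not]

lemma rad2_restrictFam_le (s : Finset ι) (x : ι → X) : rad2 (restrictFam s x) ≤ rad2 x := by
  have h := rad2_add_le (fun i => (1 / 2 : ℝ) • x i)
    (fun i => (1 / 2 : ℝ) • (if i ∈ s then x i else -x i))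
  rw [rad2_smul, rad2_smul (1 / 2) (fun i => if i ∈ s then x i else -x i), rad2_flip] at h
  have e : (fun i => (1 / 2 : ℝ) • x i + (1 / 2 : ℝ) • (if i ∈ s then x i else -x i)) =
      restrictFam s x := by
    ext i
    by_cases h : i ∈ s <;> simp [h, restrictFam]
    rw [← add_smul]; norm_num
  rw [e] at h
  norm_num at h
  linarith

lemma norm_le_avgNorm (x : ι → X) (i : ι) : ‖x i‖ ≤ avgNorm boolSign x := by
  refine le_trans (le_of_eq ?_) (avgNorm_restrictFam_le {i} x)
  have : ∀ ε : ι → Bool, ‖∑ j, boolSign (ε j) • restrictFam {i} x j‖ = ‖x i‖ := by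
    intro ε
    rw [Finset.sum_eq_single i]
    · simp [restrictFam, norm_smul, abs_boolSign]
    · intro j _ hj; simp [restrictFam, hj]
    · simp
  simp [avgNorm, this]

lemma norm_le_rad2 (x : ι → X) (i : ι) : ‖x i‖ ≤ rad2 x :=
  (norm_le_avgNorm x i).trans (avgNorm_le_rad2 x)

lemma sum_apply_sq_le_rad2 (x : ι → X) {t : X →L[ℝ] ℝ} (ht : ‖t‖ ≤ 1) :
    ∑ i, t (x i) ^ 2 ≤ rad2 x ^ 2 := by
  have h := expect_sum_sq boolSign Equiv.boolNot boolSign_not fun i => t (x i)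
  simp only [boolSign_sq, Fintype.expect_const, one_mul] at h
  rw [← h, rad2_sq]
  refine Finset.expect_le_expect fun ε _ => ?_
  have := abs_apply_le ht (∑ i, boolSign (ε i) • x i)
  simp only [map_sum, map_smul, smul_eq_mul] at this
  rw [← sq_abs]
  gcongr

/-- A random sign, switched on when the random label equals `a`. -/
def labelSign {A : Type} [DecidableEq A] (a : A) (w : A × Bool) : ℝ :=
  if w.1 = a then boolSign w.2 else 0

/-- The average norm of the signed sum over a random part of a uniformly random partition indexed
by `A`. -/
noncomputable def partAvg (A : Type) [Fintype A] [DecidableEq A] (x : ι → X) : ℝ :=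
  𝔼 a : A, avgNorm (labelSign a) x

lemma partAvg_congr {A B : Type} [Fintype A] [DecidableEq A] [Fintype B] [DecidableEq B]
    (e : A ≃ B) (x : ι → X) : partAvg A x = partAvg B x := by
  refine Fintype.expect_equiv e _ _ fun a => ?_
  refine Fintype.expect_equiv (Equiv.arrowCongr (Equiv.refl ι) (Equiv.prodCongr e (Equiv.refl _)))
    _ _ fun ω => ?_
  simp [labelSign]

lemma avgNorm_labelSign {A : Type} [Fintype A] [DecidableEq A] (a : A) (x : ι → X) :
    avgNorm (labelSign a) x =
      𝔼 c : ι → A, avgNorm boolSign (restrictFam (Finset.univ.filter fun i => c i = a) x) := by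
  unfold avgNorm
  rw [Fintype.expect_equiv (Equiv.arrowProdEquivProdArrow ι (fun _ => A) fun _ => Bool)
    (fun ω => ‖∑ i, labelSign a (ω i) • x i‖)
    (fun p => ‖∑ i, labelSign a (p.1 i, p.2 i) • x i‖) fun ω => rfl,
    ← Finset.univ_product_univ, Finset.expect_product]
  refine Finset.expect_congr rfl fun c _ => Finset.expect_congr rfl fun ε _ => ?_
  congr 1
  refine Finset.sum_congr rfl fun i _ => ?_
  by_cases h : c i = a <;> simp [labelSign, restrictFam, h]

lemma partAvg_le_avgNorm (A : Type) [Fintype A] [DecidableEq A] [Nonempty A] (x : ι → X) :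
    partAvg A x ≤ avgNorm boolSign x := by
  refine Finset.expect_le Finset.univ_nonempty fun a _ => ?_
  rw [avgNorm_labelSign]
  exact Finset.expect_le Finset.univ_nonempty fun c _ => avgNorm_restrictFam_le _ _

lemma half_le_partAvg {M : ℕ} (hM : 0 < M) (x : ι → X) (s : Finset ι) (hs : M ≤ s.card) {α : ℝ}
    (hα : 0 ≤ α) (hx : ∀ i ∈ s, α ≤ ‖x i‖) : α / 2 ≤ partAvg (Fin M) x := by
  have : Nonempty (Fin M) := ⟨⟨0, hM⟩⟩
  refine Finset.le_expect Finset.univ_nonempty fun a _ => ?_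
  rw [avgNorm_labelSign]
  have h1 (c : ι → Fin M) : α * (1 - ∏ i, if i ∈ s ∧ c i = a then (0 : ℝ) else 1) ≤
      avgNorm boolSign (restrictFam (Finset.univ.filter fun i => c i = a) x) := by
    by_cases h : ∃ i ∈ s, c i = a
    · obtain ⟨i, hi, hc⟩ := h
      rw [Finset.prod_eq_zero (Finset.mem_univ i) (by simp [hi, hc])]
      have := norm_le_avgNorm (restrictFam (Finset.univ.filter fun i => c i = a) x) i
      rw [restrictFam_of_mem (by simpa using hc)] at this
      linarith [hx i hi]
    · push Not at h
      rw [Finset.prod_eq_one]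
      · simpa using avgNorm_nonneg _ _
      · intro i _
        simpa using h i
  refine le_trans ?_ (Finset.expect_le_expect fun c _ => h1 c)
  rw [← Finset.mul_expect, Finset.expect_sub_distrib, Fintype.expect_const,
    expect_prod_apply fun i j => if i ∈ s ∧ j = a then (0 : ℝ) else 1]
  have hM' : (1 : ℝ) ≤ M := by exact_mod_cast hM
  have h2 (i : ι) : 𝔼 j : Fin M, (if i ∈ s ∧ j = a then (0 : ℝ) else 1) =
      if i ∈ s then 1 - 1 / (M : ℝ) else 1 := by
    by_cases hi : i ∈ s
    · have : ∀ j : Fin M, (if i ∈ s ∧ j = a then (0 : ℝ) else 1) = 1 - if j = a then 1 else 0 := by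
        intro j; by_cases hj : j = a <;> simp [hi, hj]
      simp_rw [this, Finset.expect_sub_distrib, Fintype.expect_const, if_pos hi,
        Fintype.expect_eq_sum_div_card]
      simp
    · simp [hi]
  simp_rw [h2]
  rw [Finset.prod_ite_mem_eq]
  simp only [Finset.prod_const]
  have h3 : 0 ≤ 1 - 1 / (M : ℝ) := by
    rw [sub_nonneg, div_le_one (by positivity)]; exact hM'
  have h4 : (1 - 1 / (M : ℝ)) ^ s.card ≤ 1 / 2 := by
    refine (pow_le_pow_of_le_one h3 (by simp) hs).trans ?_
    refine (Real.one_sub_div_pow_le_exp_neg hM').trans ?_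
    rw [Real.exp_neg, inv_eq_one_div]
    refine one_div_le_one_div_of_le (by norm_num) ?_
    have := Real.add_one_le_exp 1
    linarith
  nlinarith

end

lemma sum_sqrt_le {K : Type} [Fintype K] (s : K → ℝ) (hs : ∀ k, 0 ≤ s k) {b : ℝ} (hb : 0 ≤ b)
    (h : ∑ k, s k ≤ b ^ 2) : ∑ k, Real.sqrt (s k) ≤ Real.sqrt (Fintype.card K) * b := by
  have h1 := sq_sum_le_card_mul_sum_sq (s := Finset.univ) (f := fun k => Real.sqrt (s k))
  simp only [Real.sq_sqrt (hs _), Finset.card_univ] at h1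
  refine le_of_abs_le (abs_le_of_sq_le_sq ?_ (by positivity))
  rw [mul_pow, Real.sq_sqrt (by positivity)]
  exact h1.trans (by gcongr)

lemma card_rpow_mul_expect_le {K : Type} [Fintype K] [Nonempty K] {q : ℝ} (hq : 1 ≤ q) (y : K → ℝ)
    (hy : ∀ k, 0 ≤ y k) :
    (Fintype.card K : ℝ) ^ (1 / q) * 𝔼 k, y k ≤ (∑ k, y k ^ q) ^ (1 / q) := by
  have hK : (0 : ℝ) < Fintype.card K := by exact_mod_cast Fintype.card_pos
  have h := Real.rpow_arith_mean_le_arith_mean_rpow Finset.univ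
    (fun _ : K => (1 : ℝ) / Fintype.card K) y (fun _ _ => by positivity)
    (by simp [hK.ne']) (fun k _ => hy k) hq
  rw [← Finset.mul_sum, ← Finset.mul_sum] at h
  have e : 𝔼 k, y k = 1 / (Fintype.card K : ℝ) * ∑ k, y k := by
    rw [Fintype.expect_eq_sum_div_card]; ring
  rw [← e] at h
  have h0 : 0 ≤ 𝔼 k, y k := Finset.expect_nonneg fun k _ => hy k
  have h1 : (Fintype.card K : ℝ) * (𝔼 k, y k) ^ q ≤ ∑ k, y k ^ q := by
    calc _ ≤ (Fintype.card K : ℝ) * (1 / Fintype.card K * ∑ k, y k ^ q) := by gcongr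
      _ = _ := by field_simp
  have h2 := Real.rpow_le_rpow (by positivity) h1 (by positivity : 0 ≤ 1 / q)
  rwa [Real.mul_rpow (by positivity) (by positivity), ← Real.rpow_mul h0,
    mul_one_div_cancel (by linarith), Real.rpow_one] at h2

section
variable {X : Type*} [NormedAddCommGroup X] [NormedSpace ℝ X]
variable {ι : Type} [Fintype ι] [DecidableEq ι]

lemma expect_labelSign_sq {A : Type} [Fintype A] [DecidableEq A] (a : A) :
    𝔼 w, labelSign a w ^ 2 = 1 / Fintype.card A := by
  rw [← Finset.univ_product_univ, Finset.expect_product]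
  have : ∀ c : A, 𝔼 b : Bool, labelSign a (c, b) ^ 2 = if c = a then 1 else 0 := by
    intro c
    by_cases h : c = a <;> simp [labelSign, h, boolSign_sq]
  simp_rw [this, Fintype.expect_eq_sum_div_card]
  simp

lemma partAvg_prod_step {q π : ℝ} (hq : 1 ≤ q) (hπ : SumIneq X q π) (hπ0 : 0 ≤ π)
    (K A : Type) [Fintype K] [DecidableEq K] [Nonempty K] [Fintype A] [DecidableEq A] [Nonempty A]
    (x : ι → X) {b : ℝ} (hb : 0 ≤ b)
    (hx : ∀ t : X →L[ℝ] ℝ, ‖t‖ ≤ 1 → ∑ i, t (x i) ^ 2 ≤ b ^ 2) :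
    (Fintype.card K : ℝ) ^ (1 / q) * partAvg (K × A) x ≤
      π * (Real.sqrt (Fintype.card K / Fintype.card A) * b + 2 * partAvg A x) := by
  have h1 (a : A) (κ : ι → K) :
      (Fintype.card K : ℝ) ^ (1 / q) * 𝔼 k, 𝔼 ω, ‖blockSum κ (labelSign a) x ω k‖ ≤
      π * (Real.sqrt (Fintype.card K / Fintype.card A) * b + 2 * avgNorm (labelSign a) x) := by
    refine le_trans ?_ (expect_blocks_le hπ hπ0 (labelSign a)
      (Equiv.prodCongr (Equiv.refl A) Equiv.boolNot) (fun w => ?_)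
      (Real.sqrt (1 / Fintype.card A)) (by positivity) ?_ κ x _ fun t ht => ?_)
    · rw [Finset.expect_comm, Finset.mul_expect]
      exact Finset.expect_le_expect fun ω _ => card_rpow_mul_expect_le hq _ fun k => norm_nonneg _
    · by_cases h : w.1 = a <;> simp [labelSign, h, boolSign_not]
    · rw [expect_labelSign_sq, Real.sq_sqrt (by positivity)]
    · rw [← Finset.mul_sum]
      have := sum_sqrt_le (fun k => ∑ i with κ i = k, t (x i) ^ 2)
        (fun k => Finset.sum_nonneg fun _ _ => sq_nonneg _) hb
        (by rw [Finset.sum_fiberwise]; exact hx t ht)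
      calc _ ≤ Real.sqrt (1 / Fintype.card A) * (Real.sqrt (Fintype.card K) * b) := by gcongr
        _ = _ := by
          rw [← mul_assoc, ← Real.sqrt_mul (by positivity), one_div_mul_eq_div]
  have h2 (a : A) (k : K) : 𝔼 κ : ι → K, 𝔼 ω, ‖blockSum κ (labelSign a) x ω k‖ =
      avgNorm (labelSign (k, a)) x := by
    unfold avgNorm
    rw [Fintype.expect_equiv ((Equiv.arrowCongr (Equiv.refl ι) (Equiv.prodAssoc K A Bool)).trans
      (Equiv.arrowProdEquivProdArrow ι (fun _ => K) fun _ => A × Bool))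
      (fun ω => ‖∑ i, labelSign (k, a) (ω i) • x i‖)
      (fun p => ‖blockSum p.1 (labelSign a) x p.2 k‖), ← Finset.univ_product_univ,
      Finset.expect_product]
    intro ω
    congr 1
    rw [blockSum, Finset.sum_filter]
    refine Finset.sum_congr rfl fun i _ => ?_
    simp only [labelSign, Prod.ext_iff]
    by_cases h : (ω i).1.1 = k <;> simp [h]
  have h3 (a : A) : (Fintype.card K : ℝ) ^ (1 / q) * 𝔼 k : K, avgNorm (labelSign (k, a)) x ≤
      π * (Real.sqrt (Fintype.card K / Fintype.card A) * b + 2 * avgNorm (labelSign a) x) := by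
    simp_rw [← h2]
    rw [Finset.expect_comm, Finset.mul_expect]
    exact Finset.expect_le Finset.univ_nonempty fun κ _ => h1 a κ
  have h4 := Finset.expect_le_expect (s := Finset.univ) fun a _ => h3 a
  simp_rw [← Finset.mul_expect, Finset.expect_add_distrib, ← Finset.mul_expect] at h4
  rw [Fintype.expect_const, Finset.expect_comm] at h4
  unfold partAvg
  rwa [← Finset.univ_product_univ, Finset.expect_product]

lemma partAvg_step {q π : ℝ} (hq : 1 ≤ q) (hπ : SumIneq X q π) (hπ0 : 0 ≤ π) {m n : ℕ}
    (hm : 0 < m) (hn : 0 < n) (x : ι → X) {b : ℝ} (hb : 0 ≤ b)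
    (hx : ∀ t : X →L[ℝ] ℝ, ‖t‖ ≤ 1 → ∑ i, t (x i) ^ 2 ≤ b ^ 2) :
    (m : ℝ) ^ (1 / q) * partAvg (Fin (m * n)) x ≤
      π * (Real.sqrt (m / n) * b + 2 * partAvg (Fin n) x) := by
  have : Nonempty (Fin m) := ⟨⟨0, hm⟩⟩
  have : Nonempty (Fin n) := ⟨⟨0, hn⟩⟩
  have := partAvg_prod_step hq hπ hπ0 (Fin m) (Fin n) x hb hx
  rw [partAvg_congr finProdFinEquiv] at this
  simpa using this

/-- Weak cotype: a bound for the number of large vectors in terms of the Rademacher average. -/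
lemma card_le_of_le_norm {q π : ℝ} (hq : 1 ≤ q) (hπ : SumIneq X q π) (hπ0 : 0 ≤ π) (x : ι → X)
    (s : Finset ι) {α : ℝ} (hα : 0 < α) (hx : ∀ i ∈ s, α ≤ ‖x i‖) :
    (s.card : ℝ) ≤ 4 * (6 * π) ^ (2 * q) * (rad2 x / α) ^ (2 * q) := by
  have hR := rad2_nonneg x
  rcases Nat.eq_zero_or_pos s.card with h0 | h0
  · rw [h0]; push_cast; positivity
  set m := Nat.sqrt s.card
  have hm : 0 < m := Nat.sqrt_pos.2 h0
  have : Nonempty (Fin m) := ⟨⟨0, hm⟩⟩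
  have hm2 : m * m ≤ s.card := Nat.sqrt_le s.card
  have h1 := half_le_partAvg (Nat.mul_pos hm hm) x s hm2 hα.le hx
  have h2 := partAvg_step hq hπ hπ0 hm hm x hR fun t ht => sum_apply_sq_le_rad2 x ht
  have h3 := (partAvg_le_avgNorm (Fin m) x).trans (avgNorm_le_rad2 x)
  have hm' : (0 : ℝ) < m := by exact_mod_cast hm
  rw [div_self hm'.ne', Real.sqrt_one, one_mul] at h2
  have h4 : (m : ℝ) ^ (1 / q) * (α / 2) ≤ π * (rad2 x + 2 * rad2 x) := by
    refine (mul_le_mul_of_nonneg_left h1 (by positivity)).trans (h2.trans ?_)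
    gcongr
  have h5 : (m : ℝ) ^ (1 / q) ≤ 6 * π * (rad2 x / α) := by
    rw [mul_div_assoc', le_div_iff₀ hα]; linarith
  have h6 := Real.rpow_le_rpow (by positivity) h5 (by positivity : 0 ≤ 2 * q)
  rw [← Real.rpow_mul hm'.le, Real.mul_rpow (by positivity) (by positivity)] at h6
  have e : 1 / q * (2 * q) = (2 : ℕ) := by field_simp; norm_num
  rw [e, Real.rpow_natCast] at h6
  have h7 : (s.card : ℝ) ≤ 4 * (m : ℝ) ^ 2 := by
    have h8 : s.card < (m + 1) * (m + 1) := Nat.lt_succ_sqrt _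
    have : s.card ≤ 4 * m ^ 2 := by nlinarith
    exact_mod_cast this
  rw [mul_assoc]
  linarith

end

section
variable {X : Type*} [NormedAddCommGroup X] [NormedSpace ℝ X]
variable {ι : Type} [Fintype ι] [DecidableEq ι]

lemma rad2_zero : rad2 (fun _ : ι => (0 : X)) = 0 := by simp [rad2]

lemma rad2_sum_le {α : Type*} (s : Finset α) (x : α → ι → X) :
    rad2 (fun i => ∑ a ∈ s, x a i) ≤ ∑ a ∈ s, rad2 (x a) := by
  classical
  induction s using Finset.induction_on with
  | empty => simp [rad2_zero]
  | insert a s ha ih =>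
    simp only [Finset.sum_insert ha]
    exact (rad2_add_le _ _).trans (by gcongr)

/-- The contraction principle. -/
lemma rad2_smul_le (c : ι → ℝ) (hc : ∀ i, |c i| ≤ 1) (x : ι → X) :
    rad2 (fun i => c i • x i) ≤ rad2 x := by
  suffices h : ∀ s : Finset ι, rad2 (fun i => if i ∈ s then c i • x i else x i) ≤ rad2 x by
    simpa using h Finset.univ
  intro s
  induction s using Finset.induction_on with
  | empty => simp
  | insert j s hj ih =>
    set y : ι → X := fun i => if i ∈ s then c i • x i else x i
    have h := rad2_add_le (fun i => ((1 + c j) / 2) • y i)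
      (fun i => ((1 - c j) / 2) • (if i ∈ Finset.univ.erase j then y i else -y i))
    rw [rad2_smul, rad2_smul ((1 - c j) / 2)
      (fun i => if i ∈ Finset.univ.erase j then y i else -y i), rad2_flip] at h
    have hcj := abs_le.1 (hc j)
    rw [abs_of_nonneg (by linarith), abs_of_nonneg (by linarith), ← add_mul] at h
    have e : (fun i => if i ∈ insert j s then c i • x i else x i) =
        fun i => ((1 + c j) / 2) • y i +
          ((1 - c j) / 2) • (if i ∈ Finset.univ.erase j then y i else -y i) := by
      ext i
      by_cases hij : i = j
      · subst hij
        simp only [Finset.mem_insert_self, if_true, Finset.mem_erase, ne_eq, not_true_eq_false,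
          false_and, if_false, y, hj]
        module
      · simp only [Finset.mem_insert, hij, false_or, Finset.mem_erase, ne_eq, not_false_eq_true,
          Finset.mem_univ, and_self, if_true, y, ← add_smul]
        rw [show (1 + c j) / 2 + (1 - c j) / 2 = 1 by ring, one_smul]
    rw [e]
    refine h.trans (le_trans (le_of_eq ?_) ih)
    ring

lemma rad2_smul_mono (c d : ι → ℝ) (h : ∀ i, |c i| ≤ d i) (x : ι → X) :
    rad2 (fun i => c i • x i) ≤ rad2 fun i => d i • x i := by
  refine le_trans (le_of_eq ?_) (rad2_smul_le (fun i => c i / d i) (fun i => ?_) _)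
  · congr 1; ext i
    rcases eq_or_ne (d i) 0 with h0 | h0
    · have : c i = 0 := by simpa [h0] using h i
      simp [this]
    · rw [smul_smul, div_mul_cancel₀ _ h0]
  · have := (abs_nonneg _).trans (h i)
    rw [abs_div, abs_of_nonneg this]
    exact div_le_one_of_le₀ (h i) this

/-- A consequence of weak cotype for the mean square of a family. -/
lemma sum_norm_sq_le {K : Type} [Fintype K] [DecidableEq K] {q π s : ℝ} (hq : 1 ≤ q)
    (hπ : SumIneq X q π) (hπ0 : 0 ≤ π) (hs : 0 < s) (z : K → X) :
    ∑ k, ‖z k‖ ^ 2 ≤ rad2 z ^ 2 *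
      (Fintype.card K * s ^ 2 + 4 * (6 * π) ^ (2 * q) * s⁻¹ ^ (2 * q)) := by
  have hR := rad2_nonneg z
  rcases hR.eq_or_lt with h0 | h0
  · rw [← h0]
    have : ∀ k, z k = 0 := fun k => by
      have := norm_le_rad2 z k
      rw [← h0] at this
      simpa using this
    simp [this]
  classical
  let S := Finset.univ.filter fun k => s * rad2 z ≤ ‖z k‖
  have hS := card_le_of_le_norm hq hπ hπ0 z S (α := s * rad2 z) (by positivity)
    (fun i hi => by simpa [S] using hi)
  have e : rad2 z / (s * rad2 z) = s⁻¹ := by field_simp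
  rw [e] at hS
  have h1 : ∀ k, ‖z k‖ ^ 2 ≤ rad2 z ^ 2 * (s ^ 2 + if k ∈ S then 1 else 0) := by
    intro k
    by_cases hk : k ∈ S
    · have := norm_le_rad2 z k
      have : ‖z k‖ ^ 2 ≤ rad2 z ^ 2 := by gcongr
      rw [if_pos hk]
      nlinarith [sq_nonneg (rad2 z * s)]
    · have h2 : ‖z k‖ ≤ s * rad2 z := by
        have : ¬ (s * rad2 z ≤ ‖z k‖) := by simpa [S] using hk
        linarith
      have : ‖z k‖ ^ 2 ≤ (s * rad2 z) ^ 2 := by gcongr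
      rw [if_neg hk]
      linarith [mul_pow s (rad2 z) 2]
  refine (Finset.sum_le_sum fun k _ => h1 k).trans ?_
  rw [← Finset.mul_sum, Finset.sum_add_distrib]
  gcongr
  · simp
  · simpa using hS

lemma rad2_comp_block {K : Type} [Fintype K] [DecidableEq K] (κ : ι → K) (z : ι → X) :
    𝔼 ε : ι → Bool, rad2 (blockSum κ boolSign z ε) ^ 2 = rad2 z ^ 2 := by
  simp_rw [rad2_sq]
  rw [Finset.expect_comm]
  have : ∀ θ : K → Bool, 𝔼 ε : ι → Bool, ‖∑ k, boolSign (θ k) • blockSum κ boolSign z ε k‖ ^ 2 =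
      𝔼 ε : ι → Bool, ‖∑ i, boolSign (ε i) • z i‖ ^ 2 := by
    intro θ
    refine Fintype.expect_equiv
      (Equiv.piCongrRight fun i => if θ (κ i) then Equiv.refl Bool else Equiv.boolNot) _ _
      fun ε => ?_
    congr 2
    rw [← Finset.sum_fiberwise _ κ]
    refine Finset.sum_congr rfl fun k _ => ?_
    rw [blockSum, Finset.smul_sum]
    refine Finset.sum_congr rfl fun i hi => ?_
    obtain rfl : κ i = k := by simpa using hi
    cases h : θ (κ i) <;> simp [h, boolSign_not]
  simp [this]

/-- Average over disjoint index sets. -/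
lemma sum_rad2_restrictFam_sq_le {M : ℕ} {q π s : ℝ} (hq : 1 ≤ q)
    (hπ : SumIneq X q π) (hπ0 : 0 ≤ π) (hs : 0 < s) (z : ι → X) (L : Fin M → Finset ι)
    (hL : Pairwise fun k l => Disjoint (L k) (L l)) :
    ∑ k, rad2 (restrictFam (L k) z) ^ 2 ≤ rad2 z ^ 2 *
      (M * s ^ 2 + 4 * (6 * π) ^ (2 * q) * s⁻¹ ^ (2 * q)) := by
  classical
  let κ : ι → Option (Fin M) := fun i => if h : ∃ k, i ∈ L k then some h.choose else none
  have hκ : ∀ i k, κ i = some k ↔ i ∈ L k := by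
    intro i k
    by_cases h : ∃ k, i ∈ L k
    · have hc := h.choose_spec
      simp only [κ, h, dif_pos, Option.some.injEq]
      constructor
      · intro e; rw [← e]; exact hc
      · intro hk
        by_contra hne
        exact Finset.disjoint_left.1 (hL hne) hc hk
    · simp only [κ, h, dif_neg, not_false_eq_true]
      simp only [not_exists] at h
      simp [h k]
  have e : ∀ k, rad2 (restrictFam (L k) z) ^ 2 =
      𝔼 ε : ι → Bool, ‖blockSum κ boolSign z ε (some k)‖ ^ 2 := by
    intro k
    rw [rad2_sq]
    refine Finset.expect_congr rfl fun ε _ => ?_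
    congr 2
    rw [blockSum, Finset.sum_filter]
    refine Finset.sum_congr rfl fun i _ => ?_
    by_cases h : i ∈ L k
    · rw [if_pos ((hκ i k).2 h), restrictFam_of_mem h]
    · rw [if_neg (mt (hκ i k).1 h)]; simp [restrictFam, h]
  simp_rw [e]
  rw [← Finset.expect_sum_comm]
  have h1 (ε : ι → Bool) := sum_norm_sq_le hq hπ hπ0 hs
    fun k : Fin M => blockSum κ boolSign z ε (some k)
  have h2 (ε : ι → Bool) : rad2 (fun k : Fin M => blockSum κ boolSign z ε (some k)) ≤
      rad2 (blockSum κ boolSign z ε) := by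
    refine le_trans (le_of_eq ?_)
      (rad2_restrictFam_le (Finset.univ.image some) (blockSum κ boolSign z ε))
    unfold rad2
    congr 1
    have h3 : ∀ θ : Option (Fin M) → Bool,
        ‖∑ k, boolSign (θ k) • restrictFam (Finset.univ.image some)
          (blockSum κ boolSign z ε) k‖ ^ 2 =
        ‖∑ k : Fin M, boolSign (θ (some k)) • blockSum κ boolSign z ε (some k)‖ ^ 2 := by
      intro θ
      rw [Fintype.sum_option]
      simp [restrictFam]
    simp_rw [h3]
    have h4 := Fintype.expect_equiv (Equiv.piOptionEquivProd (β := fun _ : Option (Fin M) => Bool))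
      (fun θ => ‖∑ k : Fin M, boolSign (θ (some k)) • blockSum κ boolSign z ε (some k)‖ ^ 2)
      (fun p => ‖∑ k : Fin M, boolSign (p.2 k) • blockSum κ boolSign z ε (some k)‖ ^ 2)
      fun _ => rfl
    rw [h4, ← Finset.univ_product_univ, Finset.expect_product]
    exact (Fintype.expect_const _).symm
  rw [← rad2_comp_block κ z, Finset.expect_mul]
  refine Finset.expect_le_expect fun ε _ => (h1 ε).trans ?_
  have := rad2_nonneg fun k : Fin M => blockSum κ boolSign z ε (some k)
  have := h2 ε
  simp only [Fintype.card_fin]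
  gcongr

lemma expect_perm_rad2_le {q π s : ℝ} (hq : 1 ≤ q) (hπ : SumIneq X q π) (hπ0 : 0 ≤ π)
    (hs : 0 < s) (z : ι → X) (Λ : Finset ι) :
    𝔼 σ : Equiv.Perm ι, rad2 (restrictFam (Λ.map σ.toEmbedding) z) ^ 2 ≤ rad2 z ^ 2 *
      (s ^ 2 + 2 * (4 * (6 * π) ^ (2 * q)) * s⁻¹ ^ (2 * q) * (Λ.card / Fintype.card ι)) := by
  rcases Λ.eq_empty_or_nonempty with rfl | hΛ
  · have : ∀ σ : Equiv.Perm ι,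
        rad2 (restrictFam ((∅ : Finset ι).map σ.toEmbedding) z) = 0 := by
      intro σ
      convert rad2_zero (ι := ι) (X := X) using 2
      ext i; simp [restrictFam]
    simp only [this]
    simp only [ne_eq, OfNat.ofNat_ne_zero, not_false_eq_true, zero_pow, Fintype.expect_const]
    positivity
  set u := Λ.card
  have hu : 0 < u := Finset.card_pos.2 hΛ
  have hun : u ≤ Fintype.card ι := Finset.card_le_univ _
  set n := Fintype.card ι
  set M := n / u
  have hM : 0 < M := Nat.div_pos hun hu
  have : Nonempty (Fin M) := ⟨⟨0, hM⟩⟩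
  have hMu : M * u ≤ n := Nat.div_mul_le_self n u
  have hn2 : n ≤ 2 * (M * u) := by
    have h1 := Nat.div_add_mod n u
    have h2 := Nat.mod_lt n hu
    have h3 : u * 1 ≤ u * (n / u) := Nat.mul_le_mul_left u hM
    have : M * u = u * (n / u) := Nat.mul_comm _ _
    omega
  obtain ⟨f⟩ : Nonempty (Fin M × Λ ↪ ι) := by
    refine Function.Embedding.nonempty_of_card_le ?_
    simpa using hMu
  have hex (k : Fin M) : ∃ τ : Equiv.Perm ι, ∀ i (hi : i ∈ Λ), τ i = f (k, ⟨i, hi⟩) := by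
    let φ : ι → ι := fun i => if hi : i ∈ Λ then f (k, ⟨i, hi⟩) else i
    obtain ⟨g, hg⟩ := Finset.exists_equiv_extend_of_card_eq (α := ι) (β := ι) (t := Finset.univ)
      (by simp) (s := Λ) (f := φ) (Finset.subset_univ _) (by
        intro i hi j hj hij
        have hi' : i ∈ Λ := hi
        have hj' : j ∈ Λ := hj
        simp only [φ, hi', hj', dif_pos] at hij
        have := f.injective hij
        simpa using this)
    refine ⟨g.trans (Equiv.subtypeUnivEquiv (by simp)), fun i hi => ?_⟩
    have := hg i hi
    simp only [φ, hi, dif_pos] at this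
    simpa using this
  choose τ hτ using hex
  have h1 (σ : Equiv.Perm ι) := sum_rad2_restrictFam_sq_le hq hπ hπ0 hs z
    (fun k => Λ.map ((τ k).trans σ).toEmbedding) (by
      intro k l hkl
      rw [Finset.disjoint_left]
      intro a ha hb
      simp only [Finset.mem_map, Equiv.coe_toEmbedding, Equiv.trans_apply] at ha hb
      obtain ⟨i, hi, rfl⟩ := ha
      obtain ⟨j, hj, he⟩ := hb
      have := σ.injective he
      rw [hτ _ _ hj, hτ _ _ hi] at this
      have := f.injective this
      exact hkl (by simpa using (congrArg Prod.fst this).symm))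
  have h2 := Finset.expect_le_expect (s := Finset.univ) fun σ _ => h1 σ
  rw [Finset.expect_sum_comm, Fintype.expect_const] at h2
  have h3 (k : Fin M) : 𝔼 σ : Equiv.Perm ι,
      rad2 (restrictFam (Λ.map ((τ k).trans σ).toEmbedding) z) ^ 2 =
      𝔼 σ : Equiv.Perm ι, rad2 (restrictFam (Λ.map σ.toEmbedding) z) ^ 2 :=
    Fintype.expect_equiv (Equiv.mulRight (τ k)) _ _ fun σ => rfl
  simp_rw [h3] at h2
  simp only [Finset.sum_const, Finset.card_univ, Fintype.card_fin, nsmul_eq_mul] at h2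
  have hM' : (0 : ℝ) < M := by exact_mod_cast hM
  have hn : (0 : ℝ) < n := by exact_mod_cast hu.trans_le hun
  have hu' : (0 : ℝ) < u := by exact_mod_cast hu
  have hn2' : (n : ℝ) ≤ 2 * (M * u) := by exact_mod_cast hn2
  set C := 4 * (6 * π) ^ (2 * q)
  have hC : 0 ≤ C := by positivity
  have h4 : (M : ℝ) * s ^ 2 + C * s⁻¹ ^ (2 * q) ≤
      M * (s ^ 2 + 2 * C * s⁻¹ ^ (2 * q) * (u / n)) := by
    rw [mul_add]
    refine add_le_add le_rfl ?_
    have : (1 : ℝ) ≤ M * (2 * (u / n)) := by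
      rw [mul_div_assoc', mul_div_assoc', one_le_div hn]; linarith
    calc C * s⁻¹ ^ (2 * q) = C * s⁻¹ ^ (2 * q) * 1 := by ring
      _ ≤ C * s⁻¹ ^ (2 * q) * (M * (2 * (u / n))) := by gcongr
      _ = _ := by ring
  have h5 := h2.trans (mul_le_mul_of_nonneg_left h4 (sq_nonneg (rad2 z)))
  rw [mul_left_comm] at h5
  exact le_of_mul_le_mul_left h5 hM'

end

open MeasureTheory ProbabilityTheory in
/-- The standard Gaussian measure on `ℝ^ι`. -/
noncomputable def piGauss (ι : Type) [Fintype ι] : Measure (ι → ℝ) :=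
  Measure.pi fun _ => gaussianReal 0 1

section
open MeasureTheory ProbabilityTheory
open scoped ENNReal
variable {X : Type*} [NormedAddCommGroup X] [NormedSpace ℝ X]
variable {ι : Type} [Fintype ι] [DecidableEq ι]

instance : IsProbabilityMeasure (piGauss ι) := by unfold piGauss; infer_instance

/-- The Gaussian second moment. -/
noncomputable def gauss2 (z : ι → X) : ℝ≥0∞ := ∫⁻ g, ‖∑ i, g i • z i‖ₑ ^ 2 ∂(piGauss ι)

lemma ofReal_norm_sq (y : X) : ENNReal.ofReal (‖y‖ ^ 2) = ‖y‖ₑ ^ 2 := by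
  rw [ENNReal.ofReal_pow (norm_nonneg y), ofReal_norm]

lemma continuous_comb (z : ι → X) : Continuous fun g : ι → ℝ => ∑ i, g i • z i := by fun_prop

lemma gauss2_sign (z : ι → X) (ε : ι → Bool) :
    gauss2 (fun i => boolSign (ε i) • z i) = gauss2 z := by
  have hmp : MeasurePreserving (fun (g : ι → ℝ) i => boolSign (ε i) * g i) (piGauss ι)
      (piGauss ι) := by
    refine measurePreserving_pi _ _ fun i => ⟨by fun_prop, ?_⟩
    rw [gaussianReal_map_const_mul]
    congr 1
    · simp
    · ext; simp [boolSign_sq]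
  unfold gauss2
  have hm : Measurable fun g : ι → ℝ => ‖∑ i, g i • z i‖ₑ ^ 2 :=
    (continuous_comb z).enorm.measurable.pow_const 2
  rw [← hmp.lintegral_comp hm]
  simp only [smul_smul, mul_comm]

lemma card_mul_ofReal_rad2_sq (z : ι → X) :
    (Fintype.card (ι → Bool) : ℝ≥0∞) * ENNReal.ofReal (rad2 z ^ 2) =
      ∑ ε : ι → Bool, ‖∑ i, boolSign (ε i) • z i‖ₑ ^ 2 := by
  simp_rw [← ofReal_norm_sq]
  rw [← ENNReal.ofReal_sum_of_nonneg fun _ _ => by positivity, rad2_sq,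
    ← Fintype.card_mul_expect, ENNReal.ofReal_mul (by positivity), ENNReal.ofReal_natCast]

lemma gauss2_eq (z : ι → X) :
    gauss2 z = ∫⁻ g, ENNReal.ofReal (rad2 (fun i => g i • z i) ^ 2) ∂(piGauss ι) := by
  have h0 : (Fintype.card (ι → Bool) : ℝ≥0∞) ≠ 0 := by simp
  refine (ENNReal.mul_right_inj h0 (ENNReal.natCast_ne_top _)).1 ?_
  rw [← lintegral_const_mul' _ _ (ENNReal.natCast_ne_top _)]
  simp_rw [card_mul_ofReal_rad2_sq]
  rw [lintegral_finsetSum]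
  · rw [Finset.sum_congr rfl fun ε _ => ?_, Finset.sum_const (gauss2 z), nsmul_eq_mul,
      Finset.card_univ]
    rw [← gauss2_sign z ε]
    simp [gauss2, smul_smul, mul_comm]
  · intro ε _
    have : Continuous fun g : ι → ℝ => ∑ i, boolSign (ε i) • g i • z i := by fun_prop
    exact this.enorm.measurable.pow_const 2

lemma rad2_abs (g : ι → ℝ) (z : ι → X) :
    rad2 (fun i => |g i| • z i) = rad2 fun i => g i • z i := by
  refine le_antisymm ?_ ?_
  · have := rad2_smul_le (fun i => if 0 ≤ g i then 1 else -1)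
      (fun i => by split_ifs <;> simp) fun i => g i • z i
    refine le_trans (le_of_eq ?_) this
    congr 1; ext i
    split_ifs with h
    · rw [abs_of_nonneg h, one_smul]
    · rw [abs_of_neg (not_le.1 h)]; module
  · exact rad2_smul_mono _ _ (fun i => le_rfl) z

/-- The first absolute moment of a standard Gaussian variable. -/
noncomputable def gaussAbs : ℝ := ∫ x, |x| ∂(gaussianReal 0 1)

lemma integrable_abs_gaussian : Integrable (fun x : ℝ => |x|) (gaussianReal 0 1) :=
  ((memLp_id_gaussianReal (μ := 0) (v := 1) 1).integrable le_rfl).abs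

lemma gaussAbs_pos : 0 < gaussAbs := by
  unfold gaussAbs
  rw [integral_pos_iff_support_of_nonneg (fun x => abs_nonneg x) integrable_abs_gaussian]
  have : Function.support (fun x : ℝ => |x|) = {0}ᶜ := by ext x; simp
  rw [this, prob_compl_eq_one_sub (measurableSet_singleton 0)]
  have := nullSingletonClass_gaussianReal (μ := 0) (v := 1) one_ne_zero
  simp

lemma enorm_sum_abs_le [CompleteSpace X] (y : ι → X) :
    ‖gaussAbs • ∑ i, y i‖ₑ ^ 2 ≤ ∫⁻ g, ‖∑ i, |g i| • y i‖ₑ ^ 2 ∂(piGauss ι) := by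
  have hc : Continuous fun g : ι → ℝ => ∑ i, |g i| • y i := by fun_prop
  have hsm : AEStronglyMeasurable (fun g : ι → ℝ => ∑ i, |g i| • y i) (piGauss ι) :=
    hc.aestronglyMeasurable
  have hint (i : ι) : Integrable (fun g : ι → ℝ => |g i|) (piGauss ι) :=
    (measurePreserving_eval (fun _ : ι => gaussianReal 0 1) i).integrable_comp_of_integrable
      integrable_abs_gaussian
  have e : gaussAbs • ∑ i, y i = ∫ g, ∑ i, |g i| • y i ∂(piGauss ι) := by
    rw [integral_finsetSum _ fun i _ => (hint i).smul_const (y i), Finset.smul_sum]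
    refine Finset.sum_congr rfl fun i _ => ?_
    rw [integral_smul_const]
    congr 1
    exact (integral_comp_eval (μ := fun _ : ι => gaussianReal 0 1) (f := fun x : ℝ => |x|)
      (by fun_prop)).symm
  have h1 := eLpNorm_le_eLpNorm_of_exponent_le (p := 1) (q := 2) (by norm_num) hsm
  rw [eLpNorm_one_eq_lintegral_enorm,
    eLpNorm_eq_lintegral_rpow_enorm_toReal (by norm_num) (by norm_num)] at h1
  have h2 := (enorm_integral_le_lintegral_enorm _).trans h1
  rw [← e] at h2
  have h3 := pow_le_pow_left' h2 2
  refine h3.trans (le_of_eq ?_)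
  rw [← ENNReal.rpow_natCast, ← ENNReal.rpow_mul]
  norm_num

lemma rad2_le_gauss2 [CompleteSpace X] (z : ι → X) :
    ENNReal.ofReal (gaussAbs ^ 2 * rad2 z ^ 2) ≤ gauss2 z := by
  have h0 : (Fintype.card (ι → Bool) : ℝ≥0∞) ≠ 0 := by simp
  refine (ENNReal.mul_le_mul_iff_right h0 (ENNReal.natCast_ne_top _)).1 ?_
  have hg : gauss2 z = ∫⁻ g, ENNReal.ofReal (rad2 (fun i => |g i| • z i) ^ 2) ∂(piGauss ι) := by
    rw [gauss2_eq]
    simp only [rad2_abs]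
  rw [hg, ← lintegral_const_mul' _ _ (ENNReal.natCast_ne_top _)]
  have : gaussAbs ^ 2 * rad2 z ^ 2 = rad2 (fun i => gaussAbs • z i) ^ 2 := by
    rw [rad2_smul, mul_pow, sq_abs]
  rw [this]
  simp_rw [card_mul_ofReal_rad2_sq]
  rw [lintegral_finsetSum]
  · refine Finset.sum_le_sum fun ε _ => ?_
    have := enorm_sum_abs_le fun i => boolSign (ε i) • z i
    rw [Finset.smul_sum] at this
    simp_rw [fun i (c : ℝ) => smul_comm (boolSign (ε i)) c (z i)]
    exact this
  · intro ε _
    have : Continuous fun g : ι → ℝ => ∑ i, boolSign (ε i) • |g i| • z i := by fun_prop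
    exact this.enorm.measurable.pow_const 2

end

section
open MeasureTheory ProbabilityTheory
open scoped ENNReal
variable {X : Type*} [NormedAddCommGroup X] [NormedSpace ℝ X]
variable {ι : Type} [Fintype ι] [DecidableEq ι]

open scoped Classical in
/-- The coordinates larger than `r` in absolute value. -/
noncomputable def largeCoords (r : ℕ) (g : ι → ℝ) : Finset ι := {i | (r : ℝ) < |g i|}

lemma mem_largeCoords {r : ℕ} {g : ι → ℝ} {i : ι} : i ∈ largeCoords r g ↔ (r : ℝ) < |g i| := by
  simp [largeCoords]

lemma measurable_largeCoords (r : ℕ) (F : Finset ι → ℝ) :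
    Measurable fun g : ι → ℝ => F (largeCoords r g) := by
  let _ : MeasurableSpace (Finset ι) := ⊤
  have h : Measurable (largeCoords r : (ι → ℝ) → Finset ι) := by
    refine measurable_to_countable' fun S => ?_
    have : largeCoords r ⁻¹' {S} = ⋂ i, {g : ι → ℝ | i ∈ S ↔ (r : ℝ) < |g i|} := by
      ext g
      simp [Finset.ext_iff, mem_largeCoords, iff_comm]
    rw [this]
    refine MeasurableSet.iInter fun i => ?_
    have hm : MeasurableSet {g : ι → ℝ | (r : ℝ) < |g i|} :=
      measurableSet_lt measurable_const (by fun_prop)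
    by_cases hi : i ∈ S
    · have e : {g : ι → ℝ | i ∈ S ↔ (r : ℝ) < |g i|} = {g | (r : ℝ) < |g i|} := by
        ext g; simp [hi]
      rw [e]; exact hm
    · have e : {g : ι → ℝ | i ∈ S ↔ (r : ℝ) < |g i|} = {g | (r : ℝ) < |g i|}ᶜ := by
        ext g; simp [hi]
      rw [e]; exact hm.compl
  exact (measurable_from_top (f := F)).comp h

lemma integrable_largeCoords (r : ℕ) (F : Finset ι → ℝ) :
    Integrable (fun g : ι → ℝ => F (largeCoords r g)) (piGauss ι) := by
  obtain ⟨M, hM⟩ := Finite.bddAbove_range fun S => ‖F S‖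
  exact Integrable.of_bound (measurable_largeCoords r F).aestronglyMeasurable M
    (ae_of_all _ fun g => hM ⟨_, rfl⟩)

lemma integral_largeCoords_perm (r : ℕ) (F : Finset ι → ℝ) (σ : Equiv.Perm ι) :
    ∫ g, F ((largeCoords r g).map σ.toEmbedding) ∂(piGauss ι) =
      ∫ g, F (largeCoords r g) ∂(piGauss ι) := by
  have hmp : MeasurePreserving (MeasurableEquiv.piCongrLeft (fun _ : ι => ℝ) σ) (piGauss ι)
      (piGauss ι) :=
    measurePreserving_piCongrLeft (fun _ : ι => gaussianReal 0 1) σ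
  rw [← hmp.integral_comp' fun g => F (largeCoords r g)]
  refine integral_congr_ae (ae_of_all _ fun g => ?_)
  simp only
  congr 1
  ext i
  rw [Finset.mem_map_equiv, mem_largeCoords, mem_largeCoords, MeasurableEquiv.coe_piCongrLeft]
  have := Equiv.piCongrLeft_apply_apply (fun _ : ι => ℝ) σ g (σ.symm i)
  rw [Equiv.apply_symm_apply] at this
  rw [this]

/-- The tail of the standard Gaussian distribution. -/
noncomputable def gaussTail (r : ℕ) : ℝ :=
  ∫ x : ℝ, (if (r : ℝ) < |x| then 1 else 0) ∂(gaussianReal 0 1)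

lemma integral_card_largeCoords (r : ℕ) :
    ∫ g : ι → ℝ, ((largeCoords r g).card : ℝ) ∂(piGauss ι) = Fintype.card ι * gaussTail r := by
  have e : ∀ g : ι → ℝ, ((largeCoords r g).card : ℝ) =
      ∑ i, (if (r : ℝ) < |g i| then (1 : ℝ) else 0) := by
    intro g
    simp [largeCoords]
  have hm : Measurable fun x : ℝ => if (r : ℝ) < |x| then (1 : ℝ) else 0 :=
    Measurable.ite (measurableSet_lt measurable_const (by fun_prop)) measurable_const
      measurable_const
  simp_rw [e]
  rw [integral_finsetSum]
  · have : ∀ i : ι, ∫ g : ι → ℝ, (if (r : ℝ) < |g i| then (1 : ℝ) else 0) ∂(piGauss ι) =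
        gaussTail r := fun i =>
      integral_comp_eval (μ := fun _ : ι => gaussianReal 0 1)
        (f := fun x : ℝ => if (r : ℝ) < |x| then (1 : ℝ) else 0) hm.aestronglyMeasurable
    simp [this]
  · intro i _
    refine Integrable.of_bound (hm.comp (measurable_pi_apply i)).aestronglyMeasurable 1
      (ae_of_all _ fun g => ?_)
    split_ifs <;> simp

lemma exists_gaussTail_le (l : ℝ) (hl : 0 ≤ l) :
    ∃ A : ℝ, 0 ≤ A ∧ ∀ r : ℕ, gaussTail r ≤ A * Real.exp (-l * r) := by
  have hi (t : ℝ) : Integrable (fun x => Real.exp (t * x)) (gaussianReal 0 1) :=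
    integrable_exp_mul_gaussianReal t
  refine ⟨∫ x, (Real.exp (l * x) + Real.exp (-l * x)) ∂(gaussianReal 0 1),
    integral_nonneg fun x => by positivity, fun r => ?_⟩
  unfold gaussTail
  rw [← integral_mul_const]
  refine integral_mono_of_nonneg (ae_of_all _ fun x => ?_) (((hi l).add (hi (-l))).mul_const _)
    (ae_of_all _ fun x => ?_)
  · simp only [Pi.zero_apply]
    split_ifs <;> simp
  · simp only
    split_ifs with h
    · rw [add_mul, ← Real.exp_add, ← Real.exp_add]
      rcases lt_abs.1 h with h | h
      · have : 1 ≤ Real.exp (l * x + -l * r) := Real.one_le_exp (by nlinarith)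
        have := Real.exp_pos (-l * x + -l * r)
        linarith
      · have : 1 ≤ Real.exp (-l * x + -l * r) := Real.one_le_exp (by nlinarith)
        have := Real.exp_pos (l * x + -l * r)
        linarith
    · positivity

lemma integral_rad2_largeCoords_le {q π s : ℝ} (hq : 1 ≤ q) (hπ : SumIneq X q π) (hπ0 : 0 ≤ π)
    (hs : 0 < s) (z : ι → X) (r : ℕ) [Nonempty ι] :
    ∫ g, rad2 (restrictFam (largeCoords r g) z) ^ 2 ∂(piGauss ι) ≤ rad2 z ^ 2 *
      (s ^ 2 + 2 * (4 * (6 * π) ^ (2 * q)) * s⁻¹ ^ (2 * q) * gaussTail r) := by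
  let F : Finset ι → ℝ := fun Λ => rad2 (restrictFam Λ z) ^ 2
  have h1 : ∫ g, F (largeCoords r g) ∂(piGauss ι) =
      ∫ g, 𝔼 σ : Equiv.Perm ι, F ((largeCoords r g).map σ.toEmbedding) ∂(piGauss ι) := by
    simp_rw [Fintype.expect_eq_sum_div_card]
    rw [integral_div, integral_finsetSum]
    · simp_rw [integral_largeCoords_perm]
      rw [Finset.sum_const, nsmul_eq_mul, Finset.card_univ,
        mul_div_cancel_left₀ _ (by simp [Fintype.card_ne_zero])]
    · intro σ _
      exact integrable_largeCoords r fun Λ => F (Λ.map σ.toEmbedding)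
  change ∫ g, F (largeCoords r g) ∂(piGauss ι) ≤ _
  rw [h1]
  have hn : (Fintype.card ι : ℝ) ≠ 0 := by simp [Fintype.card_ne_zero]
  have h2 := integral_card_largeCoords (ι := ι) r
  refine (integral_mono (integrable_largeCoords r fun Λ => 𝔼 σ : Equiv.Perm ι,
    F (Λ.map σ.toEmbedding)) (integrable_largeCoords r fun Λ => rad2 z ^ 2 *
      (s ^ 2 + 2 * (4 * (6 * π) ^ (2 * q)) * s⁻¹ ^ (2 * q) * (Λ.card / Fintype.card ι)))
    fun g => expect_perm_rad2_le hq hπ hπ0 hs z (largeCoords r g)).trans (le_of_eq ?_)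
  rw [integral_const_mul, integral_add (integrable_const _)
    (integrable_largeCoords r fun Λ => 2 * (4 * (6 * π) ^ (2 * q)) * s⁻¹ ^ (2 * q) *
      (Λ.card / Fintype.card ι)), integral_const_mul, integral_div, h2,
      mul_div_cancel_left₀ _ hn]
  simp

lemma le_sum_indicator (x : ℝ) (L : ℕ) (hx : x ≤ L) :
    x ≤ ∑ r ∈ Finset.range L, if (r : ℝ) < x then (1 : ℝ) else 0 := by
  suffices h : ∀ L : ℕ, min x L ≤ ∑ r ∈ Finset.range L, if (r : ℝ) < x then (1 : ℝ) else 0 by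
    simpa [min_eq_left hx] using h L
  intro L
  induction L with
  | zero => simp
  | succ L ih =>
    rw [Finset.sum_range_succ]
    push_cast
    split_ifs with h
    · rw [min_eq_right h.le] at ih
      linarith [min_le_right x ((L : ℝ) + 1)]
    · push Not at h
      rw [min_eq_left h] at ih
      linarith [min_le_left x ((L : ℝ) + 1)]

lemma sq_sum_le_sum_two_pow (L : ℕ) (a : ℕ → ℝ) :
    (∑ r ∈ Finset.range L, a r) ^ 2 ≤ ∑ r ∈ Finset.range L, 2 ^ (r + 1) * a r ^ 2 := by
  have h := Finset.sum_mul_sq_le_sq_mul_sq (Finset.range L)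
    (fun r => Real.sqrt ((1 / 2) ^ (r + 1))) fun r => Real.sqrt (2 ^ (r + 1)) * a r
  have e1 : ∀ r : ℕ, Real.sqrt ((1 / 2) ^ (r + 1)) * (Real.sqrt (2 ^ (r + 1)) * a r) = a r := by
    intro r
    rw [← mul_assoc, ← Real.sqrt_mul (by positivity), ← mul_pow]
    norm_num
  have e2 : ∀ r : ℕ, Real.sqrt ((1 / 2) ^ (r + 1)) ^ 2 = (1 / 2) ^ (r + 1) := fun r =>
    Real.sq_sqrt (by positivity)
  have e3 : ∀ r : ℕ, (Real.sqrt (2 ^ (r + 1)) * a r) ^ 2 = 2 ^ (r + 1) * a r ^ 2 := fun r => by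
    rw [mul_pow, Real.sq_sqrt (by positivity)]
  simp_rw [e1, e2, e3] at h
  have h4 : ∑ r ∈ Finset.range L, (1 / 2 : ℝ) ^ (r + 1) ≤ 1 := by
    have := geom_sum_eq (x := (1 / 2 : ℝ)) (by norm_num) L
    simp_rw [pow_succ, ← Finset.sum_mul, this]
    have h0 : 0 < (1 / 2 : ℝ) ^ L := by positivity
    have e : ((1 / 2 : ℝ) ^ L - 1) / (1 / 2 - 1) * (1 / 2) = 1 - (1 / 2) ^ L := by ring
    rw [e]; linarith
  have h5 : 0 ≤ ∑ r ∈ Finset.range L, 2 ^ (r + 1) * a r ^ 2 :=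
    Finset.sum_nonneg fun _ _ => by positivity
  nlinarith

lemma rad2_sq_le_tsum (g : ι → ℝ) (z : ι → X) :
    ENNReal.ofReal (rad2 (fun i => g i • z i) ^ 2) ≤
      ∑' r : ℕ, ENNReal.ofReal (2 ^ (r + 1) * rad2 (restrictFam (largeCoords r g) z) ^ 2) := by
  obtain ⟨L, hL⟩ : ∃ L : ℕ, ∀ i, |g i| ≤ L := by
    obtain ⟨M, hM⟩ := Finite.bddAbove_range fun i => |g i|
    obtain ⟨L, hL⟩ := exists_nat_ge M
    exact ⟨L, fun i => (hM ⟨i, rfl⟩).trans hL⟩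
  have h1 : rad2 (fun i => g i • z i) ≤
      ∑ r ∈ Finset.range L, rad2 (restrictFam (largeCoords r g) z) := by
    refine (rad2_smul_mono g _ (fun i => le_sum_indicator |g i| L (hL i)) z).trans ?_
    refine le_trans (le_of_eq ?_)
      (rad2_sum_le (Finset.range L) fun r => restrictFam (largeCoords r g) z)
    congr 1; ext i
    rw [Finset.sum_smul]
    refine Finset.sum_congr rfl fun r _ => ?_
    by_cases h : (r : ℝ) < |g i| <;> simp [restrictFam, mem_largeCoords, h]
  have h2 := (pow_le_pow_left₀ (rad2_nonneg _) h1 2).trans (sq_sum_le_sum_two_pow L _)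
  refine (ENNReal.ofReal_le_ofReal h2).trans ?_
  rw [ENNReal.ofReal_sum_of_nonneg fun _ _ => by positivity]
  exact ENNReal.sum_le_tsum _

lemma gauss2_le {q π : ℝ} (hq : 1 ≤ q) (hπ : SumIneq X q π) (hπ0 : 0 ≤ π) :
    ∃ C : ℝ, 0 ≤ C ∧ ∀ (ι : Type) [Fintype ι] [DecidableEq ι] (z : ι → X),
      gauss2 z ≤ ENNReal.ofReal (C * rad2 z ^ 2) := by
  obtain ⟨A, hA0, hA⟩ := exists_gaussTail_le ((2 * q + 2) * Real.log 2)
    (mul_nonneg (by linarith) (Real.log_nonneg (by norm_num)))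
  set C₀ := 2 * (4 * (6 * π) ^ (2 * q)) with hC₀
  have hC₀' : 0 ≤ C₀ := by positivity
  refine ⟨4 * (1 + C₀ * A), by positivity, fun ι _ _ z => ?_⟩
  rcases isEmpty_or_nonempty ι with hι | hι
  · simp [gauss2]
  have hterm (r : ℕ) :
      ∫⁻ g, ENNReal.ofReal (2 ^ (r + 1) * rad2 (restrictFam (largeCoords r g) z) ^ 2)
        ∂(piGauss ι) ≤ ENNReal.ofReal (2 * (1 + C₀ * A) * rad2 z ^ 2 * (1 / 2) ^ r) := by
    rw [← ofReal_integral_eq_lintegral_ofReal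
      (integrable_largeCoords r fun Λ => 2 ^ (r + 1) * rad2 (restrictFam Λ z) ^ 2)
      (ae_of_all _ fun g => by positivity), integral_const_mul]
    refine ENNReal.ofReal_le_ofReal ?_
    have h1 := integral_rad2_largeCoords_le hq hπ hπ0 (s := (1 / 2) ^ r) (by positivity) z r
    have e : ((1 / 2 : ℝ) ^ r)⁻¹ ^ (2 * q) * Real.exp (-((2 * q + 2) * Real.log 2) * r) =
        (1 / 2) ^ r * (1 / 2) ^ r := by
      have e2 : (1 / 2 : ℝ) ^ r = Real.exp (-(Real.log 2 * r)) := by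
        rw [Real.exp_neg, mul_comm, Real.exp_nat_mul, Real.exp_log (by norm_num)]
        simp
      rw [e2, ← Real.exp_neg, ← Real.exp_mul, ← Real.exp_add, ← Real.exp_add]
      congr 1; ring
    have h2 : C₀ * ((1 / 2 : ℝ) ^ r)⁻¹ ^ (2 * q) * gaussTail r ≤
        C₀ * A * ((1 / 2) ^ r * (1 / 2) ^ r) := by
      calc _ ≤ C₀ * ((1 / 2 : ℝ) ^ r)⁻¹ ^ (2 * q) *
            (A * Real.exp (-((2 * q + 2) * Real.log 2) * r)) := by
            gcongr; exact hA r
        _ = C₀ * A * (((1 / 2 : ℝ) ^ r)⁻¹ ^ (2 * q) *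
            Real.exp (-((2 * q + 2) * Real.log 2) * r)) := by ring
        _ = _ := by rw [e]
    have h3 : (2 : ℝ) ^ (r + 1) * (1 / 2) ^ r = 2 := by
      rw [pow_succ, mul_right_comm, ← mul_pow]; norm_num
    calc _ ≤ 2 ^ (r + 1) * (rad2 z ^ 2 *
          (((1 / 2) ^ r) ^ 2 + C₀ * A * ((1 / 2) ^ r * (1 / 2) ^ r))) := by
          gcongr
          exact h1.trans (by gcongr)
      _ = (2 ^ (r + 1) * (1 / 2) ^ r) * ((1 + C₀ * A) * rad2 z ^ 2 * (1 / 2) ^ r) := by ring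
      _ = _ := by rw [h3]; ring
  rw [gauss2_eq]
  calc _ ≤ ∫⁻ g, ∑' r : ℕ,
        ENNReal.ofReal (2 ^ (r + 1) * rad2 (restrictFam (largeCoords r g) z) ^ 2) ∂(piGauss ι) :=
        lintegral_mono fun g => rad2_sq_le_tsum g z
    _ = ∑' r : ℕ, ∫⁻ g,
        ENNReal.ofReal (2 ^ (r + 1) * rad2 (restrictFam (largeCoords r g) z) ^ 2) ∂(piGauss ι) :=
        lintegral_tsum fun r => (measurable_largeCoords r fun Λ =>
          2 ^ (r + 1) * rad2 (restrictFam Λ z) ^ 2).ennreal_ofReal.aemeasurable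
    _ ≤ ∑' r : ℕ, ENNReal.ofReal (2 * (1 + C₀ * A) * rad2 z ^ 2 * (1 / 2) ^ r) :=
        ENNReal.tsum_le_tsum hterm
    _ = ENNReal.ofReal (∑' r : ℕ, 2 * (1 + C₀ * A) * rad2 z ^ 2 * (1 / 2) ^ r) :=
        (ENNReal.ofReal_tsum_of_nonneg (fun r => by positivity)
          (summable_geometric_two.mul_left _)).symm
    _ = _ := by
        rw [tsum_mul_left, tsum_geometric_two]
        congr 1; ring

lemma gauss2_orthonormalBasis (v : EuclideanSpace ℝ ι →ₗ[ℝ] X)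
    (β : OrthonormalBasis ι ℝ (EuclideanSpace ℝ ι)) :
    gauss2 (fun i => v (β i)) = ∫⁻ y, ‖v y‖ₑ ^ 2 ∂(stdGaussian (EuclideanSpace ℝ ι)) := by
  have hv : Continuous v := v.continuous_of_finiteDimensional
  rw [stdGaussian_eq_map_pi_orthonormalBasis β, lintegral_map]
  · simp [gauss2, piGauss]
  · exact hv.enorm.measurable.pow_const 2
  · fun_prop

/-- Rademacher averages of the images of two orthonormal bases are equivalent. -/
lemma exists_rad2_orthonormalBasis_le [CompleteSpace X] {q π : ℝ} (hq : 1 ≤ q)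
    (hπ : SumIneq X q π) (hπ0 : 0 ≤ π) :
    ∃ C : ℝ, 0 < C ∧ ∀ (ι : Type) [Fintype ι] [DecidableEq ι] (v : EuclideanSpace ℝ ι →ₗ[ℝ] X)
      (β β' : OrthonormalBasis ι ℝ (EuclideanSpace ℝ ι)),
      rad2 (fun i => v (β i)) ≤ C * rad2 (fun i => v (β' i)) := by
  obtain ⟨C, hC0, hC⟩ := gauss2_le hq hπ hπ0
  refine ⟨Real.sqrt C / gaussAbs + 1, by have := gaussAbs_pos; positivity,
    fun ι _ _ v β β' => ?_⟩
  have ha := gaussAbs_pos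
  have h1 := rad2_le_gauss2 fun i => v (β i)
  rw [gauss2_orthonormalBasis, ← gauss2_orthonormalBasis v β'] at h1
  have hR := rad2_nonneg fun i => v (β' i)
  have h2 := (ENNReal.ofReal_le_ofReal_iff (by positivity)).1 (h1.trans (hC ι _))
  have h3 : gaussAbs * rad2 (fun i => v (β i)) ≤ Real.sqrt C * rad2 (fun i => v (β' i)) := by
    refine le_of_abs_le (abs_le_of_sq_le_sq ?_ (by positivity))
    rw [mul_pow, mul_pow, Real.sq_sqrt hC0]
    exact h2
  have h4 : rad2 (fun i => v (β i)) ≤ Real.sqrt C / gaussAbs * rad2 (fun i => v (β' i)) := by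
    rw [div_mul_eq_mul_div, le_div_iff₀ ha]; linarith
  linarith

end

section
variable {X : Type*} [NormedAddCommGroup X] [NormedSpace ℝ X]
variable {ι : Type} [Fintype ι] [DecidableEq ι]

/-- The orthogonal projection onto the span of the basis vectors indexed by `s`. -/
noncomputable def basisProj (β : OrthonormalBasis ι ℝ (EuclideanSpace ℝ ι)) (s : Finset ι) :
    EuclideanSpace ℝ ι →ₗ[ℝ] EuclideanSpace ℝ ι where
  toFun y := ∑ i ∈ s, inner ℝ (β i) y • β i
  map_add' y z := by simp [inner_add_right, add_smul, Finset.sum_add_distrib]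
  map_smul' c y := by simp [inner_smul_right, mul_smul, Finset.smul_sum]

lemma basisProj_apply (β : OrthonormalBasis ι ℝ (EuclideanSpace ℝ ι)) (s : Finset ι)
    (y : EuclideanSpace ℝ ι) : basisProj β s y = ∑ i ∈ s, inner ℝ (β i) y • β i := rfl

lemma basisProj_basis (β : OrthonormalBasis ι ℝ (EuclideanSpace ℝ ι)) (s : Finset ι) (k : ι) :
    basisProj β s (β k) = if k ∈ s then β k else 0 := by
  simp [basisProj_apply, β.inner_eq_ite]

lemma inner_sub_basisProj (β : OrthonormalBasis ι ℝ (EuclideanSpace ℝ ι)) (s : Finset ι)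
    (y : EuclideanSpace ℝ ι) {k : ι} (hk : k ∈ s) :
    inner ℝ (β k) (y - basisProj β s y) = 0 := by
  simp [basisProj_apply, inner_sub_right, inner_sum, inner_smul_right, β.inner_eq_ite, hk]

lemma inner_basisProj_sub (β : OrthonormalBasis ι ℝ (EuclideanSpace ℝ ι)) (s : Finset ι)
    (y z : EuclideanSpace ℝ ι) : inner ℝ (basisProj β s z) (y - basisProj β s y) = 0 := by
  rw [basisProj_apply β s z, sum_inner]
  refine Finset.sum_eq_zero fun k hk => ?_
  rw [inner_smul_left, inner_sub_basisProj β s y hk, mul_zero]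

lemma norm_basisProj_sq (β : OrthonormalBasis ι ℝ (EuclideanSpace ℝ ι)) (s : Finset ι)
    (y : EuclideanSpace ℝ ι) : ‖basisProj β s y‖ ^ 2 = ∑ i ∈ s, inner ℝ (β i) y ^ 2 := by
  have h := inner_basisProj_sub β s y y
  rw [inner_sub_right, sub_eq_zero, real_inner_self_eq_norm_sq] at h
  rw [← h, basisProj_apply, sum_inner]
  simp [inner_smul_left, sq]

lemma norm_sub_basisProj_le (β : OrthonormalBasis ι ℝ (EuclideanSpace ℝ ι)) (s : Finset ι)
    (y : EuclideanSpace ℝ ι) : ‖y - basisProj β s y‖ ≤ ‖y‖ := by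
  have h := norm_add_sq_real (basisProj β s y) (y - basisProj β s y)
  rw [inner_basisProj_sub, add_sub_cancel] at h
  exact le_of_sq_le_sq (by nlinarith [sq_nonneg ‖basisProj β s y‖]) (norm_nonneg _)

/-- An orthonormal family `β i`, `i ∈ s`, of vectors supported in a level set of `j` on which `v`
is large, together with a unit vector of the same type orthogonal to it, can be enlarged. -/
lemma exists_orthonormalBasis_insert (β : OrthonormalBasis ι ℝ (EuclideanSpace ℝ ι)) (s : Finset ι)
    (f : EuclideanSpace ℝ ι) (hf : ‖f‖ = 1) (hfs : ∀ i ∈ s, inner ℝ (β i) f = 0) :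
    ∃ (β' : OrthonormalBasis ι ℝ (EuclideanSpace ℝ ι)) (k : ι), k ∉ s ∧ β' k = f ∧
      ∀ i ∈ s, β' i = β i := by
  obtain ⟨k, hk⟩ : ∃ k, k ∉ s := by
    by_contra! h
    have h0 : f = 0 := by
      rw [← β.sum_repr' f]
      exact Finset.sum_eq_zero fun i _ => by rw [hfs i (h i), zero_smul]
    simp [h0] at hf
  have hor' : ∀ i ∈ insert k (s : Set ι), ∀ l ∈ insert k (s : Set ι),
      inner ℝ (Function.update β k f i) (Function.update β k f l) = if i = l then 1 else 0 := by
    intro i hi l hl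
    rcases Set.mem_insert_iff.1 hi with rfl | his <;> rcases Set.mem_insert_iff.1 hl with rfl | hls
    · simp [hf]
    · have hne : l ≠ i := fun h => hk (h ▸ hls)
      rw [Function.update_self, Function.update_of_ne hne, real_inner_comm, hfs l hls,
        if_neg hne.symm]
    · have hne : i ≠ l := fun h => hk (h ▸ his)
      rw [Function.update_self, Function.update_of_ne hne, hfs i his, if_neg hne]
    · have h1 : i ≠ k := fun h => hk (h ▸ his)
      have h2 : l ≠ k := fun h => hk (h ▸ hls)
      rw [Function.update_of_ne h1, Function.update_of_ne h2, β.inner_eq_ite]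
  have hor : Orthonormal ℝ ((insert k (s : Set ι)).domRestrict (Function.update β k f)) := by
    rw [orthonormal_iff_ite]
    rintro ⟨i, hi⟩ ⟨l, hl⟩
    simpa only [Set.domRestrict_apply, Subtype.mk.injEq] using hor' i hi l hl
  obtain ⟨β', hβ'⟩ := hor.exists_orthonormalBasis_extension_of_card_eq (by simp)
  refine ⟨β', k, hk, ?_, fun i hi => ?_⟩
  · rw [hβ' k (Set.mem_insert _ _), Function.update_self]
  · have hne : i ≠ k := fun h => hk (h ▸ hi)
    rw [hβ' i (Set.mem_insert_of_mem _ hi), Function.update_of_ne hne]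

lemma exists_maximal_orthonormal_family (G : EuclideanSpace ℝ ι → Prop) :
    ∃ (β : OrthonormalBasis ι ℝ (EuclideanSpace ℝ ι)) (s : Finset ι), (∀ i ∈ s, G (β i)) ∧
      ∀ f, ‖f‖ = 1 → (∀ i ∈ s, inner ℝ (β i) f = 0) → ¬ G f := by
  let N : Set ℕ := {n | ∃ (β : OrthonormalBasis ι ℝ (EuclideanSpace ℝ ι)) (s : Finset ι),
    (∀ i ∈ s, G (β i)) ∧ s.card = n}
  have hN : N.Nonempty := ⟨0, EuclideanSpace.basisFun ι ℝ, ∅, by simp, by simp⟩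
  have hb : BddAbove N := ⟨Fintype.card ι, by
    rintro n ⟨β, s, -, rfl⟩
    exact s.card_le_univ⟩
  obtain ⟨β, s, hs, hn⟩ := Nat.sSup_mem hN hb
  refine ⟨β, s, hs, fun f hf hfs hG => ?_⟩
  obtain ⟨β', k, hk, hβk, hβ⟩ := exists_orthonormalBasis_insert β s f hf hfs
  have : (insert k s).card ∈ N := ⟨β', insert k s, by
    intro i hi
    rcases Finset.mem_insert.1 hi with rfl | hi
    · rwa [hβk]
    · rw [hβ i hi]; exact hs i hi, rfl⟩
  have := le_csSup hb this
  rw [Finset.card_insert_of_notMem hk] at this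
  omega

lemma norm_map_le_rad2 {C : ℝ} (v : EuclideanSpace ℝ ι →ₗ[ℝ] X)
    (hC : ∀ β : OrthonormalBasis ι ℝ (EuclideanSpace ℝ ι),
      rad2 (fun i => v (β i)) ≤ C) (y : EuclideanSpace ℝ ι) : ‖v y‖ ≤ ‖y‖ * C := by
  rcases eq_or_ne y 0 with rfl | hy
  · simp
  have hy' : ‖y‖ ≠ 0 := norm_ne_zero_iff.2 hy
  obtain ⟨β, k, -, hk, -⟩ := exists_orthonormalBasis_insert (EuclideanSpace.basisFun ι ℝ) ∅
    (‖y‖⁻¹ • y) (by simp [norm_smul, hy']) (by simp)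
  have h := (norm_le_rad2 (fun i => v (β i)) k).trans (hC β)
  simp only [hk, map_smul, norm_smul, norm_inv, norm_norm] at h
  rwa [inv_mul_le_iff₀ (by positivity)] at h

/-- Removal of the directions in which a family of vectors is weakly large: the family `x` splits,
simultaneously on all level sets of `j`, into a family `x'` which is weakly small there and an
error which is concentrated on few indices. -/
lemma exists_weakly_small [CompleteSpace X] {q π : ℝ} (hq : 1 ≤ q) (hπ : SumIneq X q π)
    (hπ0 : 0 ≤ π) :
    ∃ C : ℝ, 0 < C ∧ ∀ (ι : Type) [Fintype ι] [DecidableEq ι] (x : ι → X) (j : ι → ℕ)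
      (b : ℕ → ℝ), (∀ k, 0 < b k) → ∃ (x' : ι → X) (p : ι → ℝ),
        (∀ (t : X →L[ℝ] ℝ), ‖t‖ ≤ 1 → ∀ k, ∑ i with j i = k, t (x' i) ^ 2 ≤ b k ^ 2) ∧
        rad2 x' ≤ C * rad2 x ∧ (∀ i, 0 ≤ p i) ∧ (∀ i, ‖x i‖ ≤ ‖x' i‖ + p i * (C * rad2 x)) ∧
        ∀ k, ∑ i with j i = k, p i ^ 2 ≤ C * (rad2 x / b k) ^ (2 * q) := by
  obtain ⟨K, hK0, hK⟩ := exists_rad2_orthonormalBasis_le (X := X) hq hπ hπ0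
  set C₁ := 4 * (6 * π) ^ (2 * q) with hC₁
  have hC₁0 : 0 ≤ C₁ := by positivity
  refine ⟨K + K * K + C₁ * K ^ (2 * q), by positivity, fun ι _ _ x j b hb => ?_⟩
  let e : OrthonormalBasis ι ℝ (EuclideanSpace ℝ ι) := EuclideanSpace.basisFun ι ℝ
  let v : EuclideanSpace ℝ ι →ₗ[ℝ] X := e.toBasis.constr ℝ x
  have hv : ∀ i, v (e i) = x i := fun i => by
    rw [← e.coe_toBasis]; exact e.toBasis.constr_basis ℝ x i
  have he : ∀ (y : EuclideanSpace ℝ ι) i, inner ℝ y (e i) = y i := fun y i => by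
    simp [e, EuclideanSpace.inner_single_right]
  have hR : ∀ β : OrthonormalBasis ι ℝ (EuclideanSpace ℝ ι),
      rad2 (fun i => v (β i)) ≤ K * rad2 x := fun β => by
    have := hK ι v β e
    simpa only [hv] using this
  have hR0 := rad2_nonneg x
  obtain ⟨β, s, hs, hmax⟩ := exists_maximal_orthonormal_family fun f : EuclideanSpace ℝ ι =>
    ∃ k, (∀ i, j i ≠ k → f i = 0) ∧ b k ≤ ‖v f‖
  set P := basisProj β s with hP
  have hweak : ∀ (t : X →L[ℝ] ℝ), ‖t‖ ≤ 1 → ∀ k,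
      ∑ i with j i = k, t (v (e i - P (e i))) ^ 2 ≤ b k ^ 2 := by
    intro t ht k
    set T := ∑ i with j i = k, t (v (e i - P (e i))) ^ 2 with hT
    have hT0 : 0 ≤ T := Finset.sum_nonneg fun _ _ => sq_nonneg _
    let w : EuclideanSpace ℝ ι := ∑ i with j i = k, t (v (e i - P (e i))) • e i
    set u := w - P w with hu
    have htu : t (v u) = T := by
      simp only [hu, w, map_sum, map_smul, ← Finset.sum_sub_distrib, ← smul_sub, smul_eq_mul, hT,
        sq, map_sub]
    have hwn : ‖w‖ ^ 2 = T := by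
      rw [← real_inner_self_eq_norm_sq]
      simp only [w, sum_inner, inner_sum, inner_smul_left, inner_smul_right, e.inner_eq_ite, hT,
        sq, mul_ite, mul_one, mul_zero]
      exact Finset.sum_congr rfl fun i hi => by rw [Finset.sum_ite_eq', if_pos hi]; rfl
    have hun : ‖u‖ ≤ ‖w‖ := norm_sub_basisProj_le β s w
    have hws : ∀ i, j i ≠ k → w i = 0 := by
      intro i hi
      rw [← he, sum_inner]
      refine Finset.sum_eq_zero fun l hl => ?_
      have : l ≠ i := by rintro rfl; exact hi (Finset.mem_filter.1 hl).2
      rw [inner_smul_left, e.inner_eq_ite, if_neg this, mul_zero]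
    have hus : ∀ i, j i ≠ k → u i = 0 := by
      intro i hi
      rw [← he, hu, inner_sub_left, he, hws i hi, hP, basisProj_apply, sum_inner, zero_sub,
        neg_eq_zero]
      refine Finset.sum_eq_zero fun l hl => ?_
      rw [inner_smul_left, he]
      obtain ⟨k', hk', -⟩ := hs l hl
      by_cases hik : j i = k'
      · have : inner ℝ (β l) w = 0 := by
          simp only [w, inner_sum, inner_smul_right, he]
          refine Finset.sum_eq_zero fun m hm => ?_
          rw [hk' m, mul_zero]
          rw [(Finset.mem_filter.1 hm).2, ← hik]; exact hi.symm
        simp [this]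
      · rw [hk' i hik, mul_zero]
    have hvu : ‖v u‖ ≤ b k * ‖u‖ := by
      rcases eq_or_ne u 0 with h0 | h0
      · simp [h0]
      have hun0 : 0 < ‖u‖ := norm_pos_iff.2 h0
      by_contra! hlt
      refine hmax (‖u‖⁻¹ • u) (by simp [norm_smul, hun0.ne']) (fun i hi => ?_) ⟨k, ?_, ?_⟩
      · rw [inner_smul_right, hu, inner_sub_basisProj β s w hi, mul_zero]
      · intro i hi
        simp [hus i hi]
      · rw [map_smul, norm_smul, norm_inv, norm_norm, inv_mul_eq_div, le_div_iff₀ hun0]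
        exact hlt.le
    have h1 : T ≤ b k * ‖w‖ := by
      rw [← htu]
      exact ((le_abs_self _).trans (abs_apply_le ht _)).trans
        (hvu.trans (mul_le_mul_of_nonneg_left hun (hb k).le))
    rw [← hwn] at h1 ⊢
    have h2 : ‖w‖ ≤ b k := by
      rcases (norm_nonneg w).eq_or_lt with h | h
      · rw [← h]; exact (hb k).le
      · nlinarith
    gcongr
  refine ⟨fun i => v (e i - P (e i)), fun i => ‖P (e i)‖, hweak, ?_, fun i => norm_nonneg _, ?_, ?_⟩
  · have h1 := hK ι (v.comp (LinearMap.id - P)) e β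
    have h2 : (fun i => (v.comp (LinearMap.id - P)) (β i)) =
        restrictFam sᶜ fun i => v (β i) := by
      ext i
      by_cases hi : i ∈ s <;> simp [restrictFam, hi, hP, basisProj_basis]
    rw [h2] at h1
    have h3 := (rad2_restrictFam_le sᶜ fun i => v (β i)).trans (hR β)
    calc rad2 (fun i => v (e i - P (e i))) ≤ K * (K * rad2 x) :=
          h1.trans (mul_le_mul_of_nonneg_left h3 hK0.le)
      _ = K * K * rad2 x := by ring
      _ ≤ _ := by
        refine mul_le_mul_of_nonneg_right ?_ hR0
        have : 0 ≤ C₁ * K ^ (2 * q) := by positivity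
        linarith
  · intro i
    have h1 : ‖v (P (e i))‖ ≤ ‖P (e i)‖ * (K * rad2 x) := norm_map_le_rad2 v hR _
    have h2 : x i = v (e i - P (e i)) + v (P (e i)) := by rw [← map_add, sub_add_cancel, hv]
    calc ‖x i‖ ≤ ‖v (e i - P (e i))‖ + ‖v (P (e i))‖ := by
          conv_lhs => rw [h2]
          exact norm_add_le _ _
      _ ≤ ‖v (e i - P (e i))‖ + ‖P (e i)‖ * (K * rad2 x) := by gcongr
      _ ≤ _ := by
        gcongr
        have : 0 ≤ C₁ * K ^ (2 * q) := by positivity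
        nlinarith
  · intro k
    classical
    let S := s.filter fun f => b k ≤ ‖v (β f)‖
    have hcard : (S.card : ℝ) ≤ C₁ * (rad2 (fun i => v (β i)) / b k) ^ (2 * q) :=
      card_le_of_le_norm hq hπ hπ0 (fun i => v (β i)) S (hb k)
        fun i hi => (Finset.mem_filter.1 hi).2
    have h1 : ∑ i with j i = k, ‖P (e i)‖ ^ 2 ≤ S.card := by
      calc ∑ i with j i = k, ‖P (e i)‖ ^ 2 = ∑ i with j i = k, ∑ f ∈ S, (β f i) ^ 2 := by
            refine Finset.sum_congr rfl fun i hi => ?_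
            rw [hP, norm_basisProj_sq]
            simp only [he]
            refine (Finset.sum_subset (Finset.filter_subset _ _) fun f hf hfS => ?_).symm
            obtain ⟨k', hk', hb'⟩ := hs f hf
            have hne : j i ≠ k' := by
              rw [(Finset.mem_filter.1 hi).2]
              rintro rfl
              exact hfS (Finset.mem_filter.2 ⟨hf, hb'⟩)
            simp [hk' i hne]
        _ ≤ ∑ i, ∑ f ∈ S, (β f i) ^ 2 :=
            Finset.sum_le_sum_of_subset_of_nonneg (Finset.filter_subset _ _) fun _ _ _ =>
              Finset.sum_nonneg fun _ _ => sq_nonneg _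
        _ = ∑ f ∈ S, ‖β f‖ ^ 2 := by
            rw [Finset.sum_comm]
            simp only [EuclideanSpace.norm_sq_eq, Real.norm_eq_abs, sq_abs]
        _ = S.card := by simp
    calc _ ≤ C₁ * (rad2 (fun i => v (β i)) / b k) ^ (2 * q) := h1.trans hcard
      _ ≤ C₁ * (K * (rad2 x / b k)) ^ (2 * q) := by
        have h0 := rad2_nonneg fun i => v (β i)
        have hbk := hb k
        rw [← mul_div_assoc]
        gcongr
        exact hR β
      _ = C₁ * K ^ (2 * q) * (rad2 x / b k) ^ (2 * q) := by
        rw [Real.mul_rpow hK0.le (by have := hb k; positivity), ← mul_assoc]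
      _ ≤ _ := by
        have := hb k
        gcongr
        have : 0 ≤ K + K * K := by positivity
        linarith

end

section
variable {X : Type*} [NormedAddCommGroup X] [NormedSpace ℝ X]
variable {ι : Type} [Fintype ι] [DecidableEq ι]

lemma half_mul_rpow_le {q m : ℝ} (hq : 1 ≤ q) (hm : 0 ≤ m) :
    (2 * m) ^ (1 / q) ≤ 2 * m ^ (1 / q) := by
  rw [Real.mul_rpow (by norm_num) hm]
  gcongr
  calc (2 : ℝ) ^ (1 / q) ≤ 2 ^ (1 : ℝ) :=
        Real.rpow_le_rpow_of_exponent_le (by norm_num) (by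
          rw [div_le_one (by linarith)]; exact hq)
    _ = 2 := Real.rpow_one 2

lemma partAvg_nonneg (A : Type) [Fintype A] [DecidableEq A] (x : ι → X) : 0 ≤ partAvg A x :=
  Finset.expect_nonneg fun _ _ => avgNorm_nonneg _ _

/-- Lower bound for the partition averages, for partitions into few enough parts. -/
lemma card_rpow_mul_le_partAvg {q π : ℝ} (hq : 2 ≤ q) (hπ : SumIneq X q π) (hπ1 : 1 ≤ π)
    {D h e : ℕ} (hD : 8 * π ≤ D) (he : (h : ℝ) * q / 2 ≤ e * (1 - 1 / q) + 2) (x : ι → X)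
    (hx : ∀ t : X →L[ℝ] ℝ, ‖t‖ ≤ 1 → ∑ i, t (x i) ^ 2 ≤ (((D : ℝ) ^ 3)⁻¹) ^ 2) (s : Finset ι)
    (hs : ∀ i ∈ s, ((D : ℝ) ^ h)⁻¹ / 2 ≤ ‖x i‖) (hN : D ^ e ≤ s.card)
    (hN' : (s.card : ℝ) ≤ ((D : ℝ) ^ h) ^ q) :
    (s.card : ℝ) ^ (1 / q) * ((D : ℝ) ^ h)⁻¹ ≤
      32 * π * ((D : ℝ) ^ (1 / q)) ^ e * partAvg (Fin (D ^ e)) x := by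
  have hq0 : 0 < q := by linarith
  have hD1 : (1 : ℝ) ≤ D := by linarith
  have hD0 : (0 : ℝ) < D := by linarith
  have hDn : 0 < D := by exact_mod_cast hD0
  set n := D ^ e with hn
  have hn0 : 0 < n := pow_pos hDn e
  set m := s.card / n with hm
  have hm0 : 0 < m := Nat.div_pos hN hn0
  have hmn : m * n ≤ s.card := Nat.div_mul_le_self _ _
  have hmn' : s.card ≤ 2 * m * n := by
    have := Nat.lt_div_mul_add hn0 (a := s.card)
    have h1 : n ≤ m * n := Nat.le_mul_of_pos_left n hm0
    rw [← hm] at this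
    nlinarith
  have hm1 : (0 : ℝ) < m := by exact_mod_cast hm0
  have hn1 : (0 : ℝ) < n := by exact_mod_cast hn0
  have hnD : (n : ℝ) = (D : ℝ) ^ (e : ℝ) := by rw [hn]; push_cast; rw [Real.rpow_natCast]
  set a := ((D : ℝ) ^ h)⁻¹ with ha
  have ha0 : 0 < a := by positivity
  have haD : a = (D : ℝ) ^ (-(h : ℝ)) := by rw [Real.rpow_neg hD0.le, Real.rpow_natCast]
  have h1 : a / 2 / 2 ≤ partAvg (Fin (m * n)) x :=
    half_le_partAvg (Nat.mul_pos hm0 hn0) x s hmn (by positivity) hs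
  have h2 := partAvg_step (by linarith) hπ (by linarith) hm0 hn0 x
    (b := ((D : ℝ) ^ 3)⁻¹) (by positivity) hx
  have h3 : Real.sqrt (m / n) * ((D : ℝ) ^ 2)⁻¹ ≤ (m : ℝ) ^ (1 / q) * a := by
    have hmD : (m : ℝ) ≤ (D : ℝ) ^ ((h : ℝ) * q - e) := by
      rw [Real.rpow_sub hD0, ← hnD, le_div_iff₀ hn1, Real.rpow_mul hD0.le, Real.rpow_natCast]
      refine le_trans ?_ hN'
      exact_mod_cast hmn
    have hmm : (m : ℝ) ^ (1 / 2 - 1 / q) ≤ (D : ℝ) ^ ((e : ℝ) / 2 + 2 - h) := by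
      have h0 : 0 ≤ 1 / 2 - 1 / q := by
        rw [sub_nonneg]; exact one_div_le_one_div_of_le (by norm_num) hq
      calc (m : ℝ) ^ (1 / 2 - 1 / q) ≤ ((D : ℝ) ^ ((h : ℝ) * q - e)) ^ (1 / 2 - 1 / q) := by
            gcongr
        _ = (D : ℝ) ^ (((h : ℝ) * q - e) * (1 / 2 - 1 / q)) := (Real.rpow_mul hD0.le _ _).symm
        _ ≤ _ := by
          refine Real.rpow_le_rpow_of_exponent_le hD1 ?_
          have : ((h : ℝ) * q - e) * (1 / 2 - 1 / q) = h * q / 2 - h - e / 2 + e * (1 / q) := by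
            field_simp
            ring
          nlinarith
    have e1 : Real.sqrt (m / n) = (m : ℝ) ^ (1 / q) * (m : ℝ) ^ (1 / 2 - 1 / q) *
        (D : ℝ) ^ (-((e : ℝ) / 2)) := by
      rw [Real.sqrt_div hm1.le, ← Real.rpow_add hm1, Real.sqrt_eq_rpow, Real.sqrt_eq_rpow, hnD,
        ← Real.rpow_mul hD0.le, Real.rpow_neg hD0.le, div_eq_mul_inv]
      congr 2
      · ring
      · rw [mul_one_div]
    have e2 : ((D : ℝ) ^ 2)⁻¹ = (D : ℝ) ^ (-2 : ℝ) := by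
      rw [Real.rpow_neg hD0.le]; norm_cast
    calc Real.sqrt (m / n) * ((D : ℝ) ^ 2)⁻¹ ≤ (m : ℝ) ^ (1 / q) *
          (D : ℝ) ^ ((e : ℝ) / 2 + 2 - h) * (D : ℝ) ^ (-((e : ℝ) / 2)) * (D : ℝ) ^ (-2 : ℝ) := by
          rw [e1, e2]; gcongr
      _ = (m : ℝ) ^ (1 / q) * a := by
          rw [haD, mul_assoc, mul_assoc, ← Real.rpow_add hD0, ← Real.rpow_add hD0]
          congr 2; ring
  have h4 : π * (Real.sqrt (m / n) * ((D : ℝ) ^ 3)⁻¹) ≤ (m : ℝ) ^ (1 / q) * a / 8 := by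
    calc π * (Real.sqrt (m / n) * ((D : ℝ) ^ 3)⁻¹) =
          8 * π * (Real.sqrt (m / n) * ((D : ℝ) ^ 3)⁻¹) / 8 := by ring
      _ ≤ D * (Real.sqrt (m / n) * ((D : ℝ) ^ 3)⁻¹) / 8 := by gcongr
      _ = Real.sqrt (m / n) * ((D : ℝ) ^ 2)⁻¹ / 8 := by field_simp
      _ ≤ _ := by gcongr
  have h5 : (m : ℝ) ^ (1 / q) * a ≤ 16 * π * partAvg (Fin n) x := by
    have := mul_le_mul_of_nonneg_left h1 (Real.rpow_nonneg hm1.le (1 / q))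
    nlinarith
  have h6 : (s.card : ℝ) ^ (1 / q) ≤ 2 * (m : ℝ) ^ (1 / q) * ((D : ℝ) ^ (1 / q)) ^ e := by
    calc (s.card : ℝ) ^ (1 / q) ≤ ((2 * m) * n : ℝ) ^ (1 / q) := by
          gcongr; exact_mod_cast hmn'
      _ = (2 * m : ℝ) ^ (1 / q) * ((D : ℝ) ^ (1 / q)) ^ e := by
          rw [Real.mul_rpow (by positivity) hn1.le, hnD, ← Real.rpow_natCast, ← Real.rpow_mul hD0.le,
            ← Real.rpow_mul hD0.le, mul_comm (e : ℝ)]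
      _ ≤ _ := by
          gcongr
          exact half_mul_rpow_le (by linarith) hm1.le
  calc (s.card : ℝ) ^ (1 / q) * a ≤ 2 * (m : ℝ) ^ (1 / q) * ((D : ℝ) ^ (1 / q)) ^ e * a := by
        gcongr
    _ = 2 * ((D : ℝ) ^ (1 / q)) ^ e * ((m : ℝ) ^ (1 / q) * a) := by ring
    _ ≤ 2 * ((D : ℝ) ^ (1 / q)) ^ e * (16 * π * partAvg (Fin n) x) := by gcongr
    _ = _ := by ring

/-- Passing from partitions into `D ^ (e + 1)` parts to partitions into `D ^ e` parts. -/
lemma le_partAvg_of_le_partAvg_succ {q π : ℝ} (hq : 2 ≤ q) (hπ : SumIneq X q π) (hπ1 : 1 ≤ π)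
    {D e : ℕ} {A u : ℝ} (hA : 1 ≤ A) (hD : 4 * π * A ≤ D) (hu : (D : ℝ)⁻¹ / 2 ≤ u) (x : ι → X)
    (hx : ∀ t : X →L[ℝ] ℝ, ‖t‖ ≤ 1 → ∑ i, t (x i) ^ 2 ≤ (((D : ℝ) ^ 3)⁻¹) ^ 2)
    (h : u ≤ A * ((D : ℝ) ^ (1 / q)) ^ (e + 1) * partAvg (Fin (D ^ (e + 1))) x) :
    u ≤ 4 * π * A * ((D : ℝ) ^ (1 / q)) ^ e * partAvg (Fin (D ^ e)) x := by
  have hD1 : (1 : ℝ) ≤ D := by nlinarith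
  have hD0 : (0 : ℝ) < D := by linarith
  have hDn : 0 < D := by exact_mod_cast hD0
  have h2 := partAvg_step (by linarith) hπ (by linarith) hDn (pow_pos hDn e) x
    (b := ((D : ℝ) ^ 3)⁻¹) (by positivity) hx
  rw [partAvg_congr (finCongr (pow_succ' D e).symm)] at h2
  set δ := (D : ℝ) ^ (1 / q) with hδ
  have hδ0 : 0 < δ := by positivity
  have hδD : δ ≤ Real.sqrt D := by
    rw [Real.sqrt_eq_rpow]
    exact Real.rpow_le_rpow_of_exponent_le hD1 (one_div_le_one_div_of_le (by norm_num) hq)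
  have h3 : δ ^ e * Real.sqrt (D / ((D ^ e : ℕ) : ℝ)) ≤ D := by
    have hs : Real.sqrt ((D ^ e : ℕ) : ℝ) = Real.sqrt D ^ e := by
      push_cast
      rw [Real.sqrt_eq_iff_eq_sq (by positivity) (by positivity), ← pow_mul, mul_comm, pow_mul,
        Real.sq_sqrt hD0.le]
    rw [Real.sqrt_div hD0.le, hs, mul_div_assoc', div_le_iff₀ (by positivity)]
    have h4 : Real.sqrt D ≤ D := by
      rw [Real.sqrt_le_left hD0.le]; nlinarith
    calc δ ^ e * Real.sqrt D ≤ Real.sqrt D ^ e * D := by gcongr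
      _ = _ := mul_comm _ _
  have h4 : A * π * (δ ^ e * Real.sqrt (D / ((D ^ e : ℕ) : ℝ))) * ((D : ℝ) ^ 3)⁻¹ ≤ u / 2 := by
    calc _ ≤ A * π * D * ((D : ℝ) ^ 3)⁻¹ := by gcongr
      _ = 4 * π * A * ((D : ℝ) ^ 2)⁻¹ / 4 := by field_simp
      _ ≤ D * ((D : ℝ) ^ 2)⁻¹ / 4 := by gcongr
      _ = (D : ℝ)⁻¹ / 2 / 2 := by field_simp; norm_num
      _ ≤ u / 2 := by gcongr
  have h5 := mul_le_mul_of_nonneg_left h2 (by positivity : 0 ≤ A * δ ^ e)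
  rw [pow_succ] at h
  nlinarith

/-- The lower bound for partitions into `D` parts. -/
lemma card_rpow_mul_le_partAvg_fin {q π : ℝ} (hq : 2 ≤ q) (hπ : SumIneq X q π) (hπ1 : 1 ≤ π)
    {D h e : ℕ} (hD : 4 * π * (32 * π * (4 * π) ^ e) ≤ D) (he0 : 1 ≤ e)
    (he : (h : ℝ) * q / 2 ≤ e * (1 - 1 / q) + 2)
    (x : ι → X)
    (hx : ∀ t : X →L[ℝ] ℝ, ‖t‖ ≤ 1 → ∑ i, t (x i) ^ 2 ≤ (((D : ℝ) ^ 3)⁻¹) ^ 2) (s : Finset ι)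
    (hs : ∀ i ∈ s, ((D : ℝ) ^ h)⁻¹ / 2 ≤ ‖x i‖) (hN : D ^ e ≤ s.card)
    (hN' : (s.card : ℝ) ≤ ((D : ℝ) ^ h) ^ q)
    (hu : (D : ℝ)⁻¹ / 2 ≤ (s.card : ℝ) ^ (1 / q) * ((D : ℝ) ^ h)⁻¹) :
    (s.card : ℝ) ^ (1 / q) * ((D : ℝ) ^ h)⁻¹ ≤
      32 * π * (4 * π) ^ e * (D : ℝ) ^ (1 / q) * partAvg (Fin D) x := by
  have h4π : 1 ≤ 4 * π := by linarith
  have hpow : ∀ k, 1 ≤ 32 * π * (4 * π) ^ k := fun k => by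
    have := one_le_pow₀ h4π (n := k)
    nlinarith
  set u := (s.card : ℝ) ^ (1 / q) * ((D : ℝ) ^ h)⁻¹ with hudef
  have key : ∀ k, k + 1 ≤ e → u ≤ 32 * π * (4 * π) ^ k * ((D : ℝ) ^ (1 / q)) ^ (e - k) *
      partAvg (Fin (D ^ (e - k))) x := by
    intro k
    induction k with
    | zero =>
      intro _
      have h8 : 8 * π ≤ D := by
        have h2 : 2 ≤ 32 * π * (4 * π) ^ e := by
          have := one_le_pow₀ h4π (n := e)
          nlinarith
        nlinarith
      simpa [hudef] using card_rpow_mul_le_partAvg hq hπ hπ1 h8 he x hx s hs hN hN'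
    | succ k ih =>
      intro hk
      have h1 := ih (by omega)
      obtain ⟨f, hf⟩ : ∃ f, e - k = f + 1 := ⟨e - k - 1, by omega⟩
      have hf' : e - (k + 1) = f := by omega
      rw [hf] at h1
      rw [hf']
      refine (le_partAvg_of_le_partAvg_succ hq hπ hπ1 (hpow k) (le_trans ?_ hD) hu x hx h1).trans
        (le_of_eq (by ring))
      gcongr
      omega
  have h1 := key (e - 1) (by omega)
  have h2 : e - (e - 1) = 1 := by omega
  rw [h2, pow_one, partAvg_congr (finCongr (pow_one D))] at h1
  refine h1.trans ?_
  have := partAvg_nonneg (Fin D) x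
  gcongr
  omega

end

section
variable {X : Type*} [NormedAddCommGroup X] [NormedSpace ℝ X]
variable {ι : Type} [Fintype ι] [DecidableEq ι]

lemma rpow_sum_sum_le {α K : Type} [Fintype K] {q : ℝ} (hq : 1 ≤ q) (s : Finset α)
    (f : α → K → ℝ) (hf : ∀ a k, 0 ≤ f a k) :
    (∑ k, (∑ a ∈ s, f a k) ^ q) ^ (1 / q) ≤ ∑ a ∈ s, (∑ k, f a k ^ q) ^ (1 / q) := by
  classical
  have hq0 : q ≠ 0 := by linarith
  induction s using Finset.induction_on with
  | empty => simp [Real.zero_rpow hq0, Real.zero_rpow (inv_ne_zero hq0)]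
  | insert a s ha ih =>
    simp only [Finset.sum_insert ha]
    exact (Real.Lp_add_le_of_nonneg Finset.univ hq (fun k _ => hf a k)
      (fun k _ => Finset.sum_nonneg fun b _ => hf b k)).trans (add_le_add_right ih _)

/-- Minkowski's inequality for averages. -/
lemma rpow_sum_expect_le {α K : Type} [Fintype α] [Fintype K] {q : ℝ} (hq : 1 ≤ q)
    (f : α → K → ℝ) (hf : ∀ a k, 0 ≤ f a k) :
    (∑ k, (𝔼 a, f a k) ^ q) ^ (1 / q) ≤ 𝔼 a, (∑ k, f a k ^ q) ^ (1 / q) := by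
  have hq0 : 0 < q := by linarith
  simp only [Fintype.expect_eq_sum_div_card]
  have h := rpow_sum_sum_le hq Finset.univ f hf
  have hc : (0 : ℝ) ≤ (Fintype.card α : ℝ) := by positivity
  calc (∑ k, ((∑ a, f a k) / Fintype.card α) ^ q) ^ (1 / q) =
        ((∑ k, (∑ a, f a k) ^ q) / (Fintype.card α : ℝ) ^ q) ^ (1 / q) := by
        congr 1
        rw [Finset.sum_div]
        exact Finset.sum_congr rfl fun k _ =>
          Real.div_rpow (Finset.sum_nonneg fun a _ => hf a k) hc q
    _ = (∑ k, (∑ a, f a k) ^ q) ^ (1 / q) / Fintype.card α := by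
        rw [Real.div_rpow (Finset.sum_nonneg fun k _ => Real.rpow_nonneg
          (Finset.sum_nonneg fun a _ => hf a k) q) (by positivity), one_div,
          Real.rpow_rpow_inv hc hq0.ne']
    _ ≤ _ := by gcongr

lemma exists_partAvg_le (A : Type) [Fintype A] [DecidableEq A] [Nonempty A] (x : ι → X) :
    ∃ c : ι → A, partAvg A x ≤
      𝔼 a, avgNorm boolSign (restrictFam (Finset.univ.filter fun i => c i = a) x) := by
  have h : partAvg A x = 𝔼 c : ι → A, 𝔼 a,
      avgNorm boolSign (restrictFam (Finset.univ.filter fun i => c i = a) x) := by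
    rw [Finset.expect_comm]
    exact Finset.expect_congr rfl fun a _ => avgNorm_labelSign a x
  obtain ⟨c, -, hc⟩ := Finset.exists_le_of_le_expect (Finset.univ_nonempty (α := ι → A)) h.le
  exact ⟨c, hc⟩

/-- The partition averages on the different level sets of `j` combine. -/
lemma sum_partAvg_le {q π : ℝ} (hq : 1 ≤ q) (hπ : SumIneq X q π) (hπ0 : 0 ≤ π) (J : ℕ) (j : ι → ℕ)
    (hj : ∀ i, j i < J) (D : ℕ → ℕ) (hD : ∀ k, 0 < D k) (b : ℕ → ℝ) (hb : ∀ k, 0 ≤ b k) (y : ι → X)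
    (hy : ∀ t : X →L[ℝ] ℝ, ‖t‖ ≤ 1 → ∀ k, ∑ i with j i = k, t (y i) ^ 2 ≤ b k ^ 2) :
    (∑ k ∈ Finset.range J, (D k : ℝ) *
      partAvg (Fin (D k)) (restrictFam (Finset.univ.filter fun i => j i = k) y) ^ q) ^ (1 / q) ≤
      π * (∑ k ∈ Finset.range J, Real.sqrt (D k) * b k + 2 * avgNorm boolSign y) := by
  have hq0 : 0 < q := by linarith
  have hne : ∀ k, Nonempty (Fin (D k)) := fun k => ⟨⟨0, hD k⟩⟩
  choose κ hκ using fun k =>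
    exists_partAvg_le (Fin (D k)) (restrictFam (Finset.univ.filter fun i => j i = k) y)
  let κ' : ι → Σ k : Fin J, Fin (D k) := fun i => ⟨⟨j i, hj i⟩, κ (j i) i⟩
  have hκ' : ∀ i (k : Fin J) (a : Fin (D k)), κ' i = ⟨k, a⟩ ↔ j i = k ∧ κ k i = a := by
    rintro i ⟨k, hk⟩ a
    constructor
    · intro h
      have h1 := congrArg Fin.val (congrArg Sigma.fst h)
      simp only [κ'] at h1
      subst h1
      exact ⟨rfl, eq_of_heq (Sigma.mk.inj_iff.1 h).2⟩
    · rintro ⟨h1, h2⟩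
      simp only at h1
      subst h1
      subst h2
      rfl
  have hB : ∀ t : X →L[ℝ] ℝ, ‖t‖ ≤ 1 →
      ∑ p, 1 * Real.sqrt (∑ i with κ' i = p, t (y i) ^ 2) ≤
        ∑ k ∈ Finset.range J, Real.sqrt (D k) * b k := by
    intro t ht
    simp only [one_mul]
    rw [Fintype.sum_sigma, ← Fin.sum_univ_eq_sum_range (fun k => Real.sqrt (D k) * b k)]
    refine Finset.sum_le_sum fun k _ => ?_
    refine (sum_sqrt_le _ (fun _ => Finset.sum_nonneg fun _ _ => sq_nonneg _) (hb k)
      (le_trans (le_of_eq ?_) (hy t ht k))).trans (le_of_eq (by rw [Fintype.card_fin]))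
    rw [← Finset.sum_fiberwise_of_maps_to (s := Finset.univ.filter fun i => j i = k)
      (t := Finset.univ) (g := κ k) (fun _ _ => Finset.mem_univ _)]
    refine Finset.sum_congr rfl fun a _ => Finset.sum_congr ?_ fun _ _ => rfl
    ext i
    simp [hκ']
  have h1 := expect_blocks_le hπ hπ0 boolSign Equiv.boolNot (fun w => boolSign_not w) 1 zero_le_one
    (by simp [boolSign_sq]) κ' y _ hB
  refine le_trans ?_ ((rpow_sum_expect_le hq (fun ω p => ‖blockSum κ' boolSign y ω p‖)
    fun _ _ => norm_nonneg _).trans h1)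
  refine Real.rpow_le_rpow (Finset.sum_nonneg fun k _ => mul_nonneg (Nat.cast_nonneg _)
    (Real.rpow_nonneg (partAvg_nonneg _ _) _)) ?_ (by positivity)
  rw [Fintype.sum_sigma, ← Fin.sum_univ_eq_sum_range (fun k => (D k : ℝ) *
      partAvg (Fin (D k)) (restrictFam (Finset.univ.filter fun i => j i = k) y) ^ q)]
  refine Finset.sum_le_sum fun k _ => ?_
  have h2 : ∀ a, 𝔼 ω : ι → Bool, ‖blockSum κ' boolSign y ω ⟨k, a⟩‖ =
      avgNorm boolSign (restrictFam (Finset.univ.filter fun i => κ k i = a)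
        (restrictFam (Finset.univ.filter fun i => j i = k) y)) := by
    intro a
    refine Finset.expect_congr rfl fun ω _ => ?_
    rw [blockSum, Finset.sum_filter]
    congr 1
    refine Finset.sum_congr rfl fun i _ => ?_
    by_cases h3 : j i = k <;> by_cases h4 : κ k i = a <;> simp [restrictFam, hκ', h3, h4]
  simp only [h2]
  have h3 := card_rpow_mul_expect_le hq (fun a : Fin (D k) =>
    avgNorm boolSign (restrictFam (Finset.univ.filter fun i => κ k i = a)
        (restrictFam (Finset.univ.filter fun i => j i = k) y))) fun a => avgNorm_nonneg _ _
  have hp := partAvg_nonneg (Fin (D k)) (restrictFam (Finset.univ.filter fun i => j i = k) y)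
  have h4 := (mul_le_mul_of_nonneg_left (hκ k)
    (Real.rpow_nonneg (Nat.cast_nonneg (D k)) (1 / q))).trans (by simpa using h3)
  have h5 := Real.rpow_le_rpow (by positivity) h4 hq0.le
  rw [Real.mul_rpow (by positivity) hp, ← one_div, ← Real.rpow_mul (Nat.cast_nonneg _),
    ← Real.rpow_mul (Finset.sum_nonneg fun _ _ => Real.rpow_nonneg (avgNorm_nonneg _ _) _),
    one_div_mul_cancel hq0.ne', Real.rpow_one, Real.rpow_one] at h5
  exact h5

end

section
variable {X : Type*} [NormedAddCommGroup X] [NormedSpace ℝ X]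
variable {ι : Type} [Fintype ι] [DecidableEq ι]

lemma exists_scale_exponents {q : ℝ} (hq : 2 < q) : ∃ h e : ℕ, 1 ≤ h ∧ 1 ≤ e ∧
    (h : ℝ) * q / 2 ≤ e * (1 - 1 / q) + 2 ∧ 2 * (h : ℝ) + 6 * q + 1 ≤ h * q - q ∧
      (e : ℝ) + 1 ≤ h * q - q := by
  have hq2 : 0 < q - 2 := by linarith
  have hq1 : 0 < 2 * (q - 1) := by linarith
  obtain ⟨h, hh⟩ : ∃ h : ℕ, h = ⌈(7 * q + 1) / (q - 2)⌉₊ := ⟨_, rfl⟩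
  have h1 : 7 * q + 1 ≤ h * (q - 2) := by
    rw [← div_le_iff₀ hq2, hh]; exact Nat.le_ceil _
  have h0 : 1 ≤ h := by
    by_contra! h0
    have : h = 0 := by omega
    subst this
    norm_num at h1
    linarith
  have h0' : (1 : ℝ) ≤ h := by exact_mod_cast h0
  obtain ⟨e, he⟩ : ∃ e : ℕ, e = ⌈(h : ℝ) * q ^ 2 / (2 * (q - 1))⌉₊ := ⟨_, rfl⟩
  have hpos : 0 < (h : ℝ) * q ^ 2 / (2 * (q - 1)) := by positivity
  have he1 : (h : ℝ) * q ^ 2 / (2 * (q - 1)) ≤ e := he ▸ Nat.le_ceil _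
  have he2 : (e : ℝ) < (h : ℝ) * q ^ 2 / (2 * (q - 1)) + 1 := he ▸ Nat.ceil_lt_add_one hpos.le
  refine ⟨h, e, h0, he ▸ Nat.one_le_iff_ne_zero.2 (Nat.ceil_pos.2 hpos).ne', ?_, by linarith, ?_⟩
  · have h2 : (h : ℝ) * q ^ 2 / (2 * (q - 1)) * (1 - 1 / q) = h * q / 2 := by
      have : q - 1 ≠ 0 := by linarith
      field_simp
    have h3 : 0 ≤ 1 - 1 / q := by
      rw [sub_nonneg, div_le_one (by linarith)]; linarith
    have := mul_le_mul_of_nonneg_right he1 h3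
    linarith
  · have h2 : (h : ℝ) * q ^ 2 / (2 * (q - 1)) ≤ h * q - q - 2 := by
      rw [div_le_iff₀ hq1]
      nlinarith
    linarith

/-- The number of vectors on one scale is controlled by a partition average. -/
lemma card_mul_rpow_le {q π : ℝ} (hq : 2 ≤ q) (hπ : SumIneq X q π) (hπ1 : 1 ≤ π)
    {D h e : ℕ} {A C : ℝ} (hA : A = 32 * π * (4 * π) ^ e) (hD : 4 * π * A ≤ D) (hCD : 8 * C ≤ D)
    (he0 : 1 ≤ e) (he : (h : ℝ) * q / 2 ≤ e * (1 - 1 / q) + 2)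
    (hh : 2 * (h : ℝ) + 6 * q + 1 ≤ h * q - q) (heh : (e : ℝ) + 1 ≤ h * q - q)
    (x : ι → X)
    (hx : ∀ t : X →L[ℝ] ℝ, ‖t‖ ≤ 1 → ∑ i, t (x i) ^ 2 ≤ (((D : ℝ) ^ 3)⁻¹) ^ 2)
    (s : Finset ι) (p : ι → ℝ) (hs : ∀ i ∈ s, ((D : ℝ) ^ h)⁻¹ ≤ ‖x i‖ + p i)
    (hps : ∑ i ∈ s, p i ^ 2 ≤ C * ((D : ℝ) ^ 3) ^ (2 * q))
    (hs1 : (s.card : ℝ) * ((D : ℝ) ^ h)⁻¹ ^ q ≤ 1) :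
    (s.card : ℝ) * ((D : ℝ) ^ h)⁻¹ ^ q ≤
      (D : ℝ)⁻¹ ^ q + 2 * (A ^ q * (D * partAvg (Fin D) x ^ q)) := by
  have hq0 : 0 < q := by linarith
  have hA1 : 1 ≤ A := by
    have := one_le_pow₀ (by linarith : 1 ≤ 4 * π) (n := e)
    rw [hA]; nlinarith
  have hD2 : (2 : ℝ) ≤ D := by nlinarith
  have hD1 : (1 : ℝ) ≤ D := by linarith
  have hD0 : (0 : ℝ) < D := by linarith
  have hψ := partAvg_nonneg (Fin D) x
  by_cases hsmall : (s.card : ℝ) * ((D : ℝ) ^ h)⁻¹ ^ q ≤ (D : ℝ)⁻¹ ^ q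
  · have : 0 ≤ 2 * (A ^ q * (D * partAvg (Fin D) x ^ q)) := by positivity
    linarith
  push Not at hsmall
  set a := ((D : ℝ) ^ h)⁻¹ with ha
  have ha0 : 0 < a := by positivity
  have hcardD : (D : ℝ) ^ ((h : ℝ) * q - q) ≤ s.card := by
    rw [Real.rpow_sub hD0, Real.rpow_mul hD0.le, Real.rpow_natCast, div_eq_mul_inv,
      ← Real.inv_rpow hD0.le]
    calc ((D : ℝ) ^ h) ^ q * (D : ℝ)⁻¹ ^ q ≤ ((D : ℝ) ^ h) ^ q * (s.card * a ^ q) := by gcongr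
      _ = s.card := by
        rw [ha, Real.inv_rpow (by positivity)]
        field_simp
  set G := s.filter fun i => p i ≤ a / 2 with hG
  have hbad : ((s.filter fun i => ¬ p i ≤ a / 2).card : ℝ) ≤ s.card / 2 := by
    have h1 : ((s.filter fun i => ¬ p i ≤ a / 2).card : ℝ) * (a / 2) ^ 2 ≤
        C * ((D : ℝ) ^ 3) ^ (2 * q) := by
      refine le_trans ?_ hps
      rw [← nsmul_eq_mul]
      refine (Finset.card_nsmul_le_sum _ (fun i => p i ^ 2) _ fun i hi => ?_).trans
        (Finset.sum_le_sum_of_subset_of_nonneg (Finset.filter_subset _ _)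
          fun _ _ _ => sq_nonneg _)
      have := (Finset.mem_filter.1 hi).2
      push Not at this
      exact pow_le_pow_left₀ (by positivity) this.le 2
    have h2 : 8 * (C * ((D : ℝ) ^ 3) ^ (2 * q)) * ((D : ℝ) ^ h) ^ 2 ≤ s.card := by
      refine le_trans ?_ hcardD
      calc 8 * (C * ((D : ℝ) ^ 3) ^ (2 * q)) * ((D : ℝ) ^ h) ^ 2 =
            8 * C * (((D : ℝ) ^ 3) ^ (2 * q) * ((D : ℝ) ^ h) ^ 2) := by ring
        _ ≤ D * (((D : ℝ) ^ 3) ^ (2 * q) * ((D : ℝ) ^ h) ^ 2) := by gcongr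
        _ = (D : ℝ) ^ (2 * (h : ℝ) + 6 * q + 1) := by
          rw [Real.rpow_add hD0, Real.rpow_one, Real.rpow_add hD0, ← Real.rpow_natCast (D : ℝ) 3,
            ← Real.rpow_mul hD0.le, ← pow_mul, ← Real.rpow_natCast (D : ℝ) (h * 2)]
          push_cast
          rw [mul_comm (h : ℝ) 2, show (3 : ℝ) * (2 * q) = 6 * q by ring]
          ring
        _ ≤ _ := Real.rpow_le_rpow_of_exponent_le hD1 hh
    have h3 : a * (D : ℝ) ^ h = 1 := inv_mul_cancel₀ (by positivity)
    have h4 := mul_le_mul_of_nonneg_right h1 (by positivity : 0 ≤ 4 * ((D : ℝ) ^ h) ^ 2)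
    have h5 : ((s.filter fun i => ¬ p i ≤ a / 2).card : ℝ) * (a / 2) ^ 2 *
        (4 * ((D : ℝ) ^ h) ^ 2) = (s.filter fun i => ¬ p i ≤ a / 2).card := by
      calc _ = ((s.filter fun i => ¬ p i ≤ a / 2).card : ℝ) * (a * (D : ℝ) ^ h) ^ 2 := by ring
        _ = _ := by rw [h3]; ring
    rw [h5] at h4
    linarith
  have hGs : (s.card : ℝ) ≤ 2 * G.card := by
    have : G.card + (s.filter fun i => ¬ p i ≤ a / 2).card = s.card :=
      Finset.card_filter_add_card_filter_not _
    have : (G.card : ℝ) + (s.filter fun i => ¬ p i ≤ a / 2).card = s.card := by exact_mod_cast this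
    linarith
  have hGc : (G.card : ℝ) ≤ s.card := by exact_mod_cast Finset.card_filter_le _ _
  have hDe : D ^ e ≤ G.card := by
    have h1 : (D : ℝ) ^ (e + 1) ≤ s.card := by
      refine le_trans ?_ hcardD
      rw [← Real.rpow_natCast]
      push_cast
      exact Real.rpow_le_rpow_of_exponent_le hD1 heh
    have h2 : ((D ^ e : ℕ) : ℝ) ≤ G.card := by
      push_cast
      rw [pow_succ] at h1
      have : 0 ≤ (D : ℝ) ^ e := by positivity
      nlinarith
    exact_mod_cast h2
  have hG1 : (G.card : ℝ) ≤ ((D : ℝ) ^ h) ^ q := by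
    refine hGc.trans ?_
    rw [ha, Real.inv_rpow (by positivity)] at hs1
    rwa [← div_eq_mul_inv, div_le_one (by positivity)] at hs1
  have hrt : ((G.card : ℝ) ^ (1 / q) * a) ^ q = G.card * a ^ q := by
    rw [Real.mul_rpow (by positivity) ha0.le, one_div, Real.rpow_inv_rpow (by positivity) hq0.ne']
  have hu : (D : ℝ)⁻¹ / 2 ≤ (G.card : ℝ) ^ (1 / q) * a := by
    have h1 : (D : ℝ)⁻¹ ≤ (s.card : ℝ) ^ (1 / q) * a := by
      rw [← Real.rpow_le_rpow_iff (by positivity) (by positivity) hq0,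
        Real.mul_rpow (by positivity) ha0.le, one_div, Real.rpow_inv_rpow (by positivity) hq0.ne']
      exact hsmall.le
    have h2 : (s.card : ℝ) ^ (1 / q) ≤ 2 * (G.card : ℝ) ^ (1 / q) :=
      (Real.rpow_le_rpow (by positivity) hGs (by positivity)).trans
        (half_mul_rpow_le (by linarith) (by positivity))
    have := mul_le_mul_of_nonneg_right h2 ha0.le
    linarith
  have hmain := card_rpow_mul_le_partAvg_fin hq hπ hπ1 (hA ▸ hD) he0 he x hx G (fun i hi => by
    obtain ⟨h1, h2⟩ := Finset.mem_filter.1 hi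
    have := hs i h1
    change a / 2 ≤ _
    linarith) hDe hG1 hu
  rw [← hA] at hmain
  have h6 := Real.rpow_le_rpow (by positivity) hmain hq0.le
  rw [hrt, Real.mul_rpow (by positivity) hψ, Real.mul_rpow (by positivity) (by positivity), one_div,
    Real.rpow_inv_rpow (by positivity) hq0.ne', mul_assoc] at h6
  have h7 := mul_le_mul_of_nonneg_right hGs (Real.rpow_nonneg ha0.le q)
  have h8 : 0 ≤ (D : ℝ)⁻¹ ^ q := by positivity
  linarith

lemma sum_half_pow_le (j₀ J : ℕ) :
    ∑ k ∈ Finset.range J, (if j₀ ≤ k then (1 / 2 : ℝ) ^ k else 0) ≤ 2 * (1 / 2) ^ j₀ := by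
  rw [← Finset.sum_filter]
  have : (Finset.range J).filter (fun k => j₀ ≤ k) = Finset.Ico j₀ J := by
    ext k; simp [and_comm]
  rw [this]
  refine (geom_sum_Ico_le_of_lt_one (by norm_num) (by norm_num)).trans (le_of_eq ?_)
  ring

set_option maxHeartbeats 1000000 in
/-- The self-improvement step. -/
lemma exists_sum_le_half [CompleteSpace X] {q π : ℝ} (hq : 2 < q) (hπ : SumIneq X q π)
    (hπ1 : 1 ≤ π) :
    ∃ (h j₀ : ℕ) (l : ℝ), 1 ≤ h ∧ 0 < l ∧ ∀ (ι : Type) [Fintype ι] [DecidableEq ι] (x : ι → X)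
      (j : ι → ℕ), (∀ i, j₀ ≤ j i) → (∀ i, (((2 : ℝ) ^ j i) ^ h)⁻¹ ≤ ‖x i‖) → rad2 x ≤ l →
      ∑ i, (((2 : ℝ) ^ j i) ^ h)⁻¹ ^ q ≤ 1 → ∑ i, (((2 : ℝ) ^ j i) ^ h)⁻¹ ^ q ≤ 1 / 2 := by
  obtain ⟨C, hC0, hC⟩ := exists_weakly_small (X := X) (by linarith) hπ (by linarith)
  obtain ⟨h, e, hh1, he1, h1, h2, h3⟩ := exists_scale_exponents hq
  have hq0 : 0 < q := by linarith
  set A := 32 * π * (4 * π) ^ e with hA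
  have hA1 : 1 ≤ A := by
    have := one_le_pow₀ (by linarith : 1 ≤ 4 * π) (n := e)
    rw [hA]; nlinarith
  obtain ⟨j₀, hj₀⟩ := pow_unbounded_of_one_lt (32 * π * A + 8 * C) (by norm_num : (1 : ℝ) < 2)
  have hπA : 1 ≤ π * A := by nlinarith
  have hl1 : 0 < 32 * A * π * C + C + 1 := by positivity
  refine ⟨h, j₀, 1 / (32 * A * π * C + C + 1), hh1, by positivity,
    fun ι _ _ x j hj hx hr hsum => ?_⟩
  have hr1 : rad2 x * (32 * A * π * C + C + 1) ≤ 1 := by rwa [le_div_iff₀ hl1] at hr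
  have hr0 := rad2_nonneg x
  have hApi : 0 ≤ rad2 x * (32 * A * π * C) := by positivity
  have hrC : 0 ≤ rad2 x * C := by positivity
  have hCr : C * rad2 x ≤ 1 := by linarith
  have hAr : A * π * (2 * (C * rad2 x)) ≤ 1 / 16 := by linarith
  have hr2 : rad2 x ≤ 1 := by linarith
  obtain ⟨x', p, hx', hrx', hp, hxx', hps⟩ := hC ι x j (fun k => (((2 : ℝ) ^ k) ^ 3)⁻¹)
    fun k => by positivity
  obtain ⟨J, hJ⟩ : ∃ J, ∀ i, j i < J :=
    ⟨Finset.univ.sup j + 1, fun i => Nat.lt_succ_of_le (Finset.le_sup (Finset.mem_univ i))⟩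
  have hempty : ∀ k, k < j₀ → (Finset.univ.filter fun i => j i = k) = ∅ := fun k hk =>
    Finset.filter_eq_empty_iff.2 fun i _ hik => by have := hj i; omega
  set ψ : ℕ → ℝ := fun k => partAvg (Fin (2 ^ k))
    (restrictFam (Finset.univ.filter fun i => j i = k) x') with hψ
  have hψ0 : ∀ k, 0 ≤ ψ k := fun k => partAvg_nonneg _ _
  have hsplit : ∑ i, (((2 : ℝ) ^ j i) ^ h)⁻¹ ^ q = ∑ k ∈ Finset.range J,
      ((Finset.univ.filter fun i => j i = k).card : ℝ) * (((2 : ℝ) ^ k) ^ h)⁻¹ ^ q := by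
    rw [← Finset.sum_fiberwise_of_maps_to (t := Finset.range J) (g := j)
      (fun i _ => Finset.mem_range.2 (hJ i))]
    refine Finset.sum_congr rfl fun k _ => ?_
    rw [← nsmul_eq_mul, ← Finset.sum_const]
    exact Finset.sum_congr rfl fun i hi => by rw [(Finset.mem_filter.1 hi).2]
  have hscale : ∀ k ∈ Finset.range J,
      ((Finset.univ.filter fun i => j i = k).card : ℝ) * (((2 : ℝ) ^ k) ^ h)⁻¹ ^ q ≤
        (if j₀ ≤ k then (1 / 2 : ℝ) ^ k else 0) +
          2 * A ^ q * (((2 ^ k : ℕ) : ℝ) * ψ k ^ q) := by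
    intro k hk
    have hψk := hψ0 k
    split_ifs with hjk
    · have hD : 32 * π * A + 8 * C ≤ ((2 ^ k : ℕ) : ℝ) := by
        push_cast
        exact hj₀.le.trans (pow_le_pow_right₀ (by norm_num) hjk)
      have hw : ∀ t : X →L[ℝ] ℝ, ‖t‖ ≤ 1 →
          ∑ i, t (restrictFam (Finset.univ.filter fun i => j i = k) x' i) ^ 2 ≤
            ((((2 ^ k : ℕ) : ℝ) ^ 3)⁻¹) ^ 2 := by
        intro t ht
        refine le_trans (le_of_eq ?_) ((hx' t ht k).trans (le_of_eq (by push_cast; rfl)))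
        rw [Finset.sum_filter]
        refine Finset.sum_congr rfl fun i _ => ?_
        by_cases hik : j i = k <;> simp [restrictFam, hik]
      have hone : ((Finset.univ.filter fun i => j i = k).card : ℝ) *
          ((((2 ^ k : ℕ) : ℝ)) ^ h)⁻¹ ^ q ≤ 1 := by
        refine le_trans ?_ (hsplit ▸ hsum)
        push_cast
        exact Finset.single_le_sum (f := fun k =>
          ((Finset.univ.filter fun i => j i = k).card : ℝ) * (((2 : ℝ) ^ k) ^ h)⁻¹ ^ q)
          (fun k _ => by positivity) hk
      have key := card_mul_rpow_le (C := C) hq.le hπ hπ1 hA (by linarith) (by linarith) he1 h1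
        h2 h3 (restrictFam (Finset.univ.filter fun i => j i = k) x') hw
        (Finset.univ.filter fun i => j i = k) p (fun i hi => by
          rw [restrictFam_of_mem hi]
          have h5 := hx i
          rw [(Finset.mem_filter.1 hi).2] at h5
          push_cast
          have h6 := hxx' i
          have h7 := mul_le_mul_of_nonneg_left hCr (hp i)
          linarith) ((hps k).trans (by
            push_cast
            gcongr
            rw [div_inv_eq_mul]
            exact mul_le_of_le_one_left (by positivity) hr2)) hone
      have h5 : (((2 ^ k : ℕ) : ℝ))⁻¹ ^ q ≤ (1 / 2) ^ k := by
        push_cast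
        rw [one_div, inv_pow]
        refine (Real.rpow_le_rpow_of_exponent_ge (by positivity) (inv_le_one_of_one_le₀
          (one_le_pow₀ (by norm_num))) (by linarith : 1 ≤ q)).trans (le_of_eq (Real.rpow_one _))
      push_cast at key h5 ⊢
      linarith
    · rw [hempty k (by omega)]
      simp only [Finset.card_empty, Nat.cast_zero, zero_mul, zero_add]
      positivity
  have hcomb := sum_partAvg_le (by linarith) hπ (by linarith) J j hJ (fun k => 2 ^ k)
    (fun k => by positivity) (fun k => if j₀ ≤ k then (((2 : ℝ) ^ k) ^ 3)⁻¹ else 0)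
    (fun k => by split_ifs <;> positivity) x' (fun t ht k => by
      split_ifs with hjk
      · exact hx' t ht k
      · rw [hempty k (by omega)]; simp)
  set η := (1 / 2 : ℝ) ^ j₀ with hη
  have hη0 : 0 < η := by positivity
  have hη1 : η * (32 * (π * A)) ≤ 1 := by
    have : η * 2 ^ j₀ = 1 := by rw [hη, ← mul_pow]; norm_num
    rw [← this]
    gcongr
    linarith
  have hsq : ∑ k ∈ Finset.range J, Real.sqrt ((2 ^ k : ℕ) : ℝ) *
      (if j₀ ≤ k then (((2 : ℝ) ^ k) ^ 3)⁻¹ else 0) ≤ 2 * η := by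
    refine le_trans (Finset.sum_le_sum fun k _ => ?_) (sum_half_pow_le j₀ J)
    split_ifs
    · have h5 : (1 : ℝ) ≤ 2 ^ k := one_le_pow₀ (by norm_num)
      have h6 : Real.sqrt ((2 ^ k : ℕ) : ℝ) ≤ ((2 : ℝ) ^ k) ^ 2 := by
        push_cast
        rw [Real.sqrt_le_left (by positivity)]
        nlinarith [one_le_pow₀ h5 (n := 3)]
      calc _ ≤ ((2 : ℝ) ^ k) ^ 2 * (((2 : ℝ) ^ k) ^ 3)⁻¹ := by gcongr
        _ = (1 / 2) ^ k := by rw [one_div, inv_pow]; field_simp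
    · simp
  have hav : avgNorm boolSign x' ≤ C * rad2 x := (avgNorm_le_rad2 x').trans hrx'
  set Ψ := ∑ k ∈ Finset.range J, ((2 ^ k : ℕ) : ℝ) * ψ k ^ q with hΨ
  have hΨ0 : 0 ≤ Ψ := Finset.sum_nonneg fun k _ => mul_nonneg (Nat.cast_nonneg _)
    (Real.rpow_nonneg (hψ0 k) q)
  have hΨ1 : A * Ψ ^ (1 / q) ≤ 1 / 8 := by
    calc A * Ψ ^ (1 / q) ≤ A * (π * (2 * η + 2 * (C * rad2 x))) := by
          gcongr
          refine hcomb.trans ?_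
          gcongr
      _ = A * π * (2 * η) + A * π * (2 * (C * rad2 x)) := by ring
      _ ≤ 1 / 8 := by
          have : A * π * (2 * η) = η * (32 * (π * A)) / 16 := by ring
          linarith
  have hΨ2 : A ^ q * Ψ ≤ 1 / 8 := by
    have h5 := Real.rpow_le_rpow (by positivity) hΨ1 hq0.le
    rw [Real.mul_rpow (by positivity) (by positivity), one_div, Real.rpow_inv_rpow hΨ0 hq0.ne']
      at h5
    exact h5.trans ((Real.rpow_le_rpow_of_exponent_ge (by norm_num) (by norm_num)
      (by linarith : 1 ≤ q)).trans (by norm_num))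
  rw [hsplit]
  refine (Finset.sum_le_sum hscale).trans ?_
  rw [Finset.sum_add_distrib, ← Finset.mul_sum]
  have h5 := sum_half_pow_le j₀ J
  have h6 : η * 1 ≤ η * (π * A) := mul_le_mul_of_nonneg_left hπA hη0.le
  linarith

end

lemma expect_comp_restrict {ι : Type} [Fintype ι] [DecidableEq ι] (s : Finset ι)
    (g : (s → Bool) → ℝ) : 𝔼 ε : ι → Bool, g (fun i => ε i) = 𝔼 ε : s → Bool, g ε := by
  rw [Fintype.expect_equiv (Equiv.piEquivPiSubtypeProd (fun i => i ∈ s) fun _ => Bool)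
    (fun ε => g fun i => ε i) (fun z => g z.1) fun _ => rfl, ← Finset.univ_product_univ,
    Finset.expect_product]
  simp

section
variable {X : Type*} [NormedAddCommGroup X] [NormedSpace ℝ X]
variable {ι : Type} [Fintype ι] [DecidableEq ι]

lemma rad2_subfamily_le (s : Finset ι) (x : ι → X) : rad2 (fun i : s => x i) ≤ rad2 x := by
  refine le_trans (le_of_eq ?_) (rad2_restrictFam_le s x)
  unfold rad2
  congr 1
  rw [← expect_comp_restrict s fun ε => ‖∑ i : s, boolSign (ε i) • x i‖ ^ 2]
  refine Finset.expect_congr rfl fun ε _ => ?_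
  congr 2
  rw [Finset.sum_coe_sort s fun i => boolSign (ε i) • x i]
  simp [restrictFam, Finset.sum_ite_mem, smul_ite]

lemma exists_dyadic_scale {h : ℕ} (hh : 1 ≤ h) {r : ℝ} (hr0 : 0 < r) (hr1 : r < 1) :
    ∃ j : ℕ, (((2 : ℝ) ^ j) ^ h)⁻¹ ≤ r ∧ r ≤ 2 ^ h * (((2 : ℝ) ^ j) ^ h)⁻¹ := by
  have hex : ∃ j : ℕ, (((2 : ℝ) ^ j) ^ h)⁻¹ ≤ r := by
    obtain ⟨n, hn⟩ := pow_unbounded_of_one_lt r⁻¹ (by norm_num : (1 : ℝ) < 2)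
    refine ⟨n, inv_le_of_inv_le₀ hr0 (hn.le.trans ?_)⟩
    exact le_self_pow₀ (one_le_pow₀ (by norm_num)) (by omega)
  classical
  refine ⟨Nat.find hex, Nat.find_spec hex, ?_⟩
  cases hj : Nat.find hex with
  | zero =>
    have := Nat.find_spec hex
    rw [hj] at this
    simp at this
    linarith
  | succ k =>
    have := Nat.find_min hex (m := k) (by omega)
    push Not at this
    refine this.le.trans (le_of_eq ?_)
    rw [pow_succ, mul_pow]
    field_simp

lemma sum_rpow_le_of_rad2_le {q : ℝ} (hq : 1 ≤ q) {h j₀ : ℕ} {l : ℝ}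
    (H : ∀ (ι : Type) [Fintype ι] [DecidableEq ι] (x : ι → X)
      (j : ι → ℕ), (∀ i, j₀ ≤ j i) → (∀ i, (((2 : ℝ) ^ j i) ^ h)⁻¹ ≤ ‖x i‖) → rad2 x ≤ l →
      ∑ i, (((2 : ℝ) ^ j i) ^ h)⁻¹ ^ q ≤ 1 → ∑ i, (((2 : ℝ) ^ j i) ^ h)⁻¹ ^ q ≤ 1 / 2)
    (x : ι → X) (j : ι → ℕ) (hj : ∀ i, x i ≠ 0 → j₀ ≤ j i)
    (hjx : ∀ i, x i ≠ 0 → (((2 : ℝ) ^ j i) ^ h)⁻¹ ≤ ‖x i‖)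
    (hl : rad2 x ≤ l) (hl2 : rad2 x ≤ 1 / 2) (s : Finset ι) (hs : ∀ i ∈ s, x i ≠ 0) :
    ∑ i ∈ s, (((2 : ℝ) ^ j i) ^ h)⁻¹ ^ q ≤ 1 / 2 := by
  induction s using Finset.induction_on with
  | empty => norm_num
  | insert i s his ih =>
    rw [← Finset.sum_coe_sort]
    refine H _ (fun i : ↥(insert i s) => x i) (fun i => j i) (fun k => hj k (hs k k.2))
      (fun k => hjx k (hs k k.2)) ((rad2_subfamily_le _ x).trans hl) ?_
    rw [Finset.sum_coe_sort (insert i s) fun i => (((2 : ℝ) ^ j i) ^ h)⁻¹ ^ q,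
      Finset.sum_insert his]
    have h1 := ih fun k hk => hs k (Finset.mem_insert_of_mem hk)
    have h2 : (((2 : ℝ) ^ j i) ^ h)⁻¹ ≤ 1 / 2 :=
      (hjx i (hs i (Finset.mem_insert_self i s))).trans ((norm_le_rad2 x i).trans hl2)
    have h3 : (((2 : ℝ) ^ j i) ^ h)⁻¹ ^ q ≤ (((2 : ℝ) ^ j i) ^ h)⁻¹ ^ (1 : ℝ) :=
      Real.rpow_le_rpow_of_exponent_ge (by positivity) (by linarith) hq
    rw [Real.rpow_one] at h3
    linarith

theorem SumIneq.exists_rad2_bound [CompleteSpace X] {q π : ℝ} (hq : 2 < q) (hπ : SumIneq X q π)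
    (hπ1 : 1 ≤ π) : ∃ C : ℝ, 0 ≤ C ∧ ∀ (ι : Type) [Fintype ι] [DecidableEq ι] (x : ι → X),
      (∑ i, ‖x i‖ ^ q) ^ (1 / q) ≤ C * rad2 x := by
  obtain ⟨h, j₀, l, hh, hl, H⟩ := exists_sum_le_half hq hπ hπ1
  have hq0 : 0 < q := by linarith
  set b := (((2 : ℝ) ^ j₀) ^ h)⁻¹ with hb
  have hb0 : 0 < b := by positivity
  set m := min l (min (1 / 2) (b / 2)) with hm
  have hm0 : 0 < m := lt_min hl (lt_min (by norm_num) (by positivity))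
  have hml : m ≤ l := min_le_left _ _
  have hm2 : m ≤ 1 / 2 := (min_le_right _ _).trans (min_le_left _ _)
  have hmb : m ≤ b / 2 := (min_le_right _ _).trans (min_le_right _ _)
  have small : ∀ (ι : Type) [Fintype ι] [DecidableEq ι] (x : ι → X), rad2 x ≤ m →
      ∑ i, ‖x i‖ ^ q ≤ (2 ^ h) ^ q := by
    intro ι _ _ x hx
    classical
    have hex : ∀ i, ∃ j : ℕ, x i ≠ 0 →
        (((2 : ℝ) ^ j) ^ h)⁻¹ ≤ ‖x i‖ ∧ ‖x i‖ ≤ 2 ^ h * (((2 : ℝ) ^ j) ^ h)⁻¹ := by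
      intro i
      by_cases hi : x i = 0
      · exact ⟨0, fun h => absurd hi h⟩
      · have := norm_le_rad2 x i
        obtain ⟨j, hj⟩ := exists_dyadic_scale hh (norm_pos_iff.2 hi) (by linarith)
        exact ⟨j, fun _ => hj⟩
    choose j hj using hex
    have hj₀ : ∀ i, x i ≠ 0 → j₀ ≤ j i := by
      intro i hi
      by_contra! hlt
      have h1 : b ≤ (((2 : ℝ) ^ j i) ^ h)⁻¹ := by
        rw [hb]
        gcongr
        norm_num
      have := (hj i hi).1
      have := norm_le_rad2 x i
      linarith
    have h1 := sum_rpow_le_of_rad2_le (by linarith) H x j hj₀ (fun i hi => (hj i hi).1)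
      (hx.trans hml) (hx.trans hm2) (Finset.univ.filter fun i => x i ≠ 0) fun i hi =>
        (Finset.mem_filter.1 hi).2
    calc ∑ i, ‖x i‖ ^ q = ∑ i ∈ Finset.univ.filter (fun i => x i ≠ 0), ‖x i‖ ^ q := by
          refine (Finset.sum_filter_of_ne (p := fun i => x i ≠ 0) fun i _ hi h0 => hi ?_).symm
          rw [h0, norm_zero, Real.zero_rpow hq0.ne']
      _ ≤ ∑ i ∈ Finset.univ.filter (fun i => x i ≠ 0),
          (2 ^ h) ^ q * (((2 : ℝ) ^ j i) ^ h)⁻¹ ^ q := by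
        refine Finset.sum_le_sum fun i hi => ?_
        rw [← Real.mul_rpow (by positivity) (by positivity)]
        exact Real.rpow_le_rpow (norm_nonneg _) (hj i (Finset.mem_filter.1 hi).2).2 hq0.le
      _ ≤ (2 ^ h) ^ q * 1 := by
        rw [← Finset.mul_sum]
        gcongr
        linarith
      _ = _ := mul_one _
  refine ⟨2 ^ h / m, by positivity, fun ι _ _ x => ?_⟩
  rcases (rad2_nonneg x).eq_or_lt with h0 | h0
  · have : ∀ i, ‖x i‖ ^ q = 0 := fun i => by
      have h1 := norm_le_rad2 x i
      rw [← h0] at h1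
      rw [le_antisymm h1 (norm_nonneg _), Real.zero_rpow hq0.ne']
    simp only [this, Finset.sum_const_zero, ← h0, mul_zero]
    rw [Real.zero_rpow (by positivity)]
  · have hc : 0 < m / rad2 x := by positivity
    have h1 := small ι (fun i => (m / rad2 x) • x i) (by
      rw [rad2_smul, abs_of_pos hc, div_mul_cancel₀ _ h0.ne'])
    simp_rw [norm_smul, Real.norm_eq_abs, abs_of_pos hc,
      Real.mul_rpow hc.le (norm_nonneg _)] at h1
    rw [← Finset.mul_sum] at h1
    have h2 := Real.rpow_le_rpow (by positivity) h1 (by positivity : 0 ≤ 1 / q)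
    rw [Real.mul_rpow (by positivity) (by positivity), one_div, Real.rpow_rpow_inv hc.le hq0.ne',
      Real.rpow_rpow_inv (by positivity) hq0.ne'] at h2
    rw [one_div, div_mul_eq_mul_div, le_div_iff₀ hm0]
    rw [div_mul_eq_mul_div, div_le_iff₀ h0] at h2
    linarith

end

section
variable {𝕂 : Type*} [RCLike 𝕂] {X : Type*} [NormedAddCommGroup X] [NormedSpace 𝕂 X]

lemma WeaklySummable.exists_norm_signed_sum_le {x : ℕ → X} (hx : WeaklySummable 𝕂 x) :
    ∃ A : ℝ, ∀ (k : ℕ) (ε : Fin k → Bool),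
      ‖∑ j : Fin k, (if ε j then x j else -x j)‖ ≤ A := by
  obtain ⟨A, hA⟩ := banach_steinhaus
    (g := fun z : Σ k, Fin k → Bool => NormedSpace.inclusionInDoubleDual 𝕂 X
      (∑ j : Fin z.1, (if z.2 j then x j else -x j))) (fun φ => by
    refine ⟨∑' j, ‖φ (x j)‖, fun z => ?_⟩
    rw [NormedSpace.dual_def, map_sum]
    refine (norm_sum_le _ _).trans ?_
    calc _ = ∑ j : Fin z.1, ‖φ (x j)‖ :=
          Finset.sum_congr rfl fun j _ => by split_ifs <;> simp
      _ = ∑ j ∈ Finset.range z.1, ‖φ (x j)‖ := Fin.sum_univ_eq_sum_range (fun j => ‖φ (x j)‖) _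
      _ ≤ _ := (hx φ).sum_le_tsum _ fun _ _ => norm_nonneg _)
  refine ⟨A, fun k ε => ?_⟩
  rw [← (NormedSpace.inclusionInDoubleDualLi 𝕂 (E := X)).norm_map]
  exact hA ⟨k, ε⟩

theorem HasCotype.summable_of_weaklySummable {q : ℝ} (hq : 0 < q) (h : HasCotype X q) {x : ℕ → X}
    (hx : WeaklySummable 𝕂 x) : Summable fun j => ‖x j‖ ^ q := by
  obtain ⟨C, hC0, hC⟩ := h
  obtain ⟨A, hA⟩ := hx.exists_norm_signed_sum_le
  have hA0 : 0 ≤ A := (norm_nonneg _).trans (hA 0 fun _ => true)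
  refine summable_of_sum_range_le (c := (C * A) ^ q) (fun _ => by positivity) fun k => ?_
  rw [← Fin.sum_univ_eq_sum_range (fun j => ‖x j‖ ^ q)]
  have h1 := (hC k fun j => x j).trans (mul_le_mul_of_nonneg_left (b := _) (c := A) ?_ hC0)
  · have h2 := Real.rpow_le_rpow (by positivity) h1 hq.le
    rwa [one_div, Real.rpow_inv_rpow (by positivity) hq.ne'] at h2
  · refine Real.sqrt_le_iff.2 ⟨hA0, ?_⟩
    rw [inv_mul_le_iff₀ (by positivity)]
    refine (Finset.sum_le_card_nsmul _ _ (A ^ 2) fun ε _ =>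
      pow_le_pow_left₀ (norm_nonneg _) (hA k ε) 2).trans (le_of_eq ?_)
    simp

end

section
variable {X : Type*} [NormedAddCommGroup X] [NormedSpace ℝ X]

lemma sum_abs_apply_le {K : Type} [Fintype K] {y : K → X} {A : ℝ}
    (h : ∀ t : X →L[ℝ] ℝ, ‖t‖ ≤ 1 → ∑ k, |t (y k)| ≤ A) (t : X →L[ℝ] ℝ) :
    ∑ k, |t (y k)| ≤ ‖t‖ * A := by
  rcases (norm_nonneg t).eq_or_lt with h0 | h0
  · rw [← h0, norm_eq_zero.1 h0.symm]; simp
  · have := h (‖t‖⁻¹ • t) (by rw [norm_smul, norm_inv, norm_norm, inv_mul_cancel₀ h0.ne'])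
    simp only [smul_apply, smul_eq_mul, abs_mul, abs_inv, abs_norm,
      ← Finset.mul_sum] at this
    rwa [inv_mul_le_iff₀ h0] at this

/-- Failure of the summing inequality yields weakly small families of `q`-mass one. -/
lemma exists_family_of_not_sumIneq {q π : ℝ} (hq : 0 < q) (hπ : 0 < π) (h : ¬ SumIneq X q π) :
    ∃ (n : ℕ) (y : Fin n → X), ∑ k, ‖y k‖ ^ q = 1 ∧
      ∀ t : X →L[ℝ] ℝ, ∑ k, |t (y k)| ≤ ‖t‖ * π⁻¹ := by
  unfold SumIneq at h
  push Not at h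
  obtain ⟨K, _, y, A, hA, hlt⟩ := h
  have hA0 : 0 ≤ A := by simpa using hA 0 (by simp)
  set S := (∑ k, ‖y k‖ ^ q) ^ (1 / q) with hS
  have hS0 : 0 < S := lt_of_le_of_lt (by positivity) hlt
  have e := (Fintype.equivFin K).symm
  refine ⟨_, fun k => S⁻¹ • y (e k), ?_, fun t => ?_⟩
  · rw [e.sum_comp fun k => ‖S⁻¹ • y k‖ ^ q]
    simp_rw [norm_smul, Real.norm_eq_abs, abs_of_pos (inv_pos.2 hS0),
      Real.mul_rpow (inv_pos.2 hS0).le (norm_nonneg _)]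
    rw [← Finset.mul_sum, Real.inv_rpow hS0.le]
    have : S ^ q = ∑ k, ‖y k‖ ^ q := by
      rw [hS, one_div, Real.rpow_inv_rpow (by positivity) hq.ne']
    rw [← this]
    exact inv_mul_cancel₀ (by positivity)
  · rw [e.sum_comp fun k => |t (S⁻¹ • y k)|]
    simp only [map_smul, smul_eq_mul, abs_mul, abs_inv, abs_of_pos hS0, ← Finset.mul_sum]
    have h1 := sum_abs_apply_le hA t
    have h2 : S⁻¹ * A ≤ π⁻¹ := by
      rw [inv_mul_le_iff₀ hS0, ← div_eq_mul_inv, le_div_iff₀ hπ]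
      linarith
    calc _ ≤ S⁻¹ * (‖t‖ * A) := by gcongr
      _ = ‖t‖ * (S⁻¹ * A) := by ring
      _ ≤ _ := by gcongr

variable {𝕂 : Type*} [RCLike 𝕂] [NormedSpace 𝕂 X] [IsScalarTower ℝ 𝕂 X]

lemma sum_norm_apply_le {n : ℕ} {y : Fin n → X} {A : ℝ}
    (h : ∀ t : X →L[ℝ] ℝ, ∑ k, |t (y k)| ≤ ‖t‖ * A) (φ : X →L[𝕂] 𝕂) :
    ∑ k, ‖φ (y k)‖ ≤ (‖RCLike.reCLM.comp (φ.restrictScalars ℝ)‖ +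
      ‖RCLike.imCLM.comp (φ.restrictScalars ℝ)‖) * A := by
  have h1 := h (RCLike.reCLM.comp (φ.restrictScalars ℝ))
  have h2 := h (RCLike.imCLM.comp (φ.restrictScalars ℝ))
  rw [add_mul]
  refine le_trans ?_ (add_le_add h1 h2)
  rw [← Finset.sum_add_distrib]
  refine Finset.sum_le_sum fun k _ => ?_
  conv_lhs => rw [← RCLike.re_add_im (φ (y k))]
  refine (norm_add_le _ _).trans (add_le_add (by simp) ?_)
  rw [norm_mul, RCLike.norm_ofReal]
  exact mul_le_of_le_one_right (abs_nonneg _) <| by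
    rcases eq_or_ne (RCLike.I : 𝕂) 0 with h0 | h0
    · simp [h0]
    · exact (RCLike.norm_I_of_ne_zero h0).le

theorem exists_sumIneq_of_summable {q : ℝ} (hq : 0 < q)
    (H : ∀ x : ℕ → X, WeaklySummable 𝕂 x → Summable fun j => ‖x j‖ ^ q) :
    ∃ π : ℝ, 1 ≤ π ∧ SumIneq X q π := by
  by_contra! hno
  choose N y hy1 hyt using fun n : ℕ => exists_family_of_not_sumIneq (X := X) hq
    (by positivity : (0 : ℝ) < 2 ^ n) (hno _ (one_le_pow₀ (by norm_num)))
  obtain ⟨f, hf⟩ := exists_injective_nat (Σ n, Fin (N n))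
  set z : (Σ n, Fin (N n)) → X := fun k => y k.1 k.2 with hz
  have hout : ∀ m, m ∉ Set.range f → Function.extend f z 0 m = 0 := fun m hm =>
    Function.extend_apply' _ _ _ hm
  have hw : WeaklySummable 𝕂 (Function.extend f z 0) := by
    intro φ
    rw [← hf.summable_iff fun m hm => by simp [hout m hm]]
    have : (fun m => ‖φ (Function.extend f z 0 m)‖) ∘ f = fun k => ‖φ (z k)‖ := by
      ext k; simp [hf.extend_apply]
    rw [this, summable_sigma_of_nonneg fun _ => norm_nonneg _]
    refine ⟨fun n => Summable.of_finite, ?_⟩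
    simp only [tsum_fintype]
    refine Summable.of_nonneg_of_le (fun n => by positivity)
      (fun n => sum_norm_apply_le (hyt n) φ) (Summable.mul_left _ ?_)
    simpa using summable_geometric_two
  have h1 := H _ hw
  rw [← hf.summable_iff fun m hm => by simp [hout m hm, Real.zero_rpow hq.ne']] at h1
  have : (fun m => ‖Function.extend f z 0 m‖ ^ q) ∘ f = fun k => ‖z k‖ ^ q := by
    ext k; simp [hf.extend_apply]
  rw [this, summable_sigma_of_nonneg fun _ => by positivity] at h1
  have h2 := h1.2
  simp only [tsum_fintype, hz, hy1] at h2
  exact one_ne_zero ((summable_const_iff (1 : ℝ)).1 h2)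

theorem hasCotype_of_rad2_bound {q C : ℝ} (hC : 0 ≤ C)
    (h : ∀ (ι : Type) [Fintype ι] [DecidableEq ι] (x : ι → X),
      (∑ i, ‖x i‖ ^ q) ^ (1 / q) ≤ C * rad2 x) : HasCotype X q := by
  refine ⟨C, hC, fun k x => (h _ x).trans (le_of_eq ?_)⟩
  unfold rad2
  rw [Fintype.expect_eq_sum_div_card, div_eq_inv_mul]
  congr 3
  · simp
  · refine Finset.sum_congr rfl fun ε _ => ?_
    congr 2
    refine Finset.sum_congr rfl fun j _ => ?_
    cases ε j <;> simp [boolSign]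

end

/-- Maurey–Talagrand: if `X` has cotype `q` then `id_X` is `(q;1)`-summing, and conversely
for `q ≠ 2`. -/
theorem stmt2 (𝕂 : Type*) [RCLike 𝕂] (X : Type*) [NormedAddCommGroup X] [NormedSpace 𝕂 X]
    [CompleteSpace X] (q : ℝ) (hq : 2 ≤ q) :
    (HasCotype X q → ∀ x : ℕ → X, WeaklySummable 𝕂 x → Summable fun j => ‖x j‖ ^ q) ∧
    (q ≠ 2 → (∀ x : ℕ → X, WeaklySummable 𝕂 x → Summable fun j => ‖x j‖ ^ q) →
      HasCotype X q) := by
  refine ⟨fun h x hx => h.summable_of_weaklySummable (by linarith) hx, fun hq2 H => ?_⟩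
  let _ : NormedSpace ℝ X := NormedSpace.restrictScalars ℝ 𝕂 X
  have : IsScalarTower ℝ 𝕂 X := IsScalarTower.of_algebraMap_smul fun _ _ => rfl
  obtain ⟨π, hπ1, hπ⟩ := exists_sumIneq_of_summable (by linarith) H
  obtain ⟨C, hC, h⟩ := hπ.exists_rad2_bound (lt_of_le_of_ne hq hq2.symm) hπ1
  exact hasCotype_of_rad2_bound hC h
end

section
/- Let m ∈ ℕ and let Y be a Banach space having cotype q with 2 ≤ q < ∞. Then for every Banach space X, every continuous m-homogeneous polynomial P : X → Y is absolutely (q;1)-summing, i.e., ∑_j ‖P(x_j)‖^q < ∞ for every weakly 1-summable sequence (x_j) in X. -/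
open scoped BigOperators

/-- `P` is a continuous `m`-homogeneous polynomial. -/
def IsHomogPoly (𝕂 : Type*) [RCLike 𝕂] {X Y : Type*} [NormedAddCommGroup X] [NormedSpace 𝕂 X]
    [NormedAddCommGroup Y] [NormedSpace 𝕂 Y] (m : ℕ) (P : X → Y) : Prop :=
  ∃ T : ContinuousMultilinearMap 𝕂 (fun _ : Fin m => X) Y, ∀ x, P x = T fun _ => x

/-- Distinct coordinates of a uniformly random sign vector are orthogonal. -/
theorem sum_signs_mul {ι : Type*} [Fintype ι] [DecidableEq ι] (i j : ι) :
    ∑ ε : ι → ℤˣ, ((ε j * ε i : ℤˣ) : ℤ) = if i = j then (Fintype.card (ι → ℤˣ) : ℤ) else 0 := by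
  split_ifs with h
  · subst h
    simp [Int.units_mul_self]
  · have key := Equiv.sum_comp (Equiv.mulLeft (Pi.mulSingle i (-1) : ι → ℤˣ))
      fun ε => ((ε j * ε i : ℤˣ) : ℤ)
    simp only [Equiv.coe_mulLeft, Pi.mul_apply, Pi.mulSingle_eq_same,
      Pi.mulSingle_eq_of_ne (Ne.symm h)] at key
    simp only [one_mul, neg_mul, mul_neg, Units.val_neg, Finset.sum_neg_distrib] at key
    omega

/-- Averaging a double sum over random signs extracts its diagonal. -/
theorem sum_signs_smul {ι Y : Type*} [Fintype ι] [DecidableEq ι] [AddCommGroup Y]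
    (b : ι → ι → Y) :
    ∑ ε : ι → ℤˣ, ∑ j, ∑ i, (ε j * ε i) • b i j = Fintype.card (ι → ℤˣ) • ∑ j, b j j := by
  rw [Finset.sum_comm, Finset.smul_sum]
  refine Finset.sum_congr rfl fun j _ => ?_
  rw [Finset.sum_comm]
  simp only [Units.smul_def, ← Finset.sum_smul, sum_signs_mul, ite_smul, zero_smul,
    Finset.sum_ite_eq', Finset.mem_univ, if_true, natCast_zsmul]

/-- If all signed sums of the `x j` are bounded by `K`, then the signed sums of the values of a
multilinear map on the diagonal are bounded by `‖T‖ * K ^ (m + 1)`. -/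
theorem norm_sum_signs_smul_multilinear_le {𝕂 ι X Y : Type*} [RCLike 𝕂] [Fintype ι]
    [NormedAddCommGroup X] [NormedSpace 𝕂 X] [NormedAddCommGroup Y] [NormedSpace 𝕂 Y]
    {x : ι → X} {K : ℝ} (hK : ∀ ε : ι → ℤˣ, ‖∑ j, ε j • x j‖ ≤ K) (m : ℕ)
    (T : ContinuousMultilinearMap 𝕂 (fun _ : Fin (m + 1) => X) Y) (r : ι → ℤˣ) :
    ‖∑ j, r j • T fun _ => x j‖ ≤ ‖T‖ * K ^ (m + 1) := by
  classical
  have hK0 : 0 ≤ K := (norm_nonneg _).trans (hK 1)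
  induction m generalizing r with
  | zero =>
    have h : ∑ j, r j • (T fun _ => x j) = T fun _ => ∑ j, r j • x j := by
      have hT : ∀ y, (T fun _ => y) = T.curryLeft y 0 := fun y => by
        rw [ContinuousMultilinearMap.curryLeft_apply]
        congr 1
        ext i
        rw [Fin.fin_one_eq_zero i, Fin.cons_zero]
      simp only [hT, map_sum, sum_apply, Units.smul_def, map_zsmul]
      rfl
    rw [h]
    refine (T.le_opNorm _).trans ?_
    simpa using mul_le_mul_of_nonneg_left (hK r) (norm_nonneg T)
  | succ m ih =>
    set N := Fintype.card (ι → ℤˣ)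
    have hN : (0 : ℝ) < N := Nat.cast_pos.2 Fintype.card_pos
    have havg : N • ∑ j, r j • (T fun _ => x j) =
        ∑ ε : ι → ℤˣ, ∑ j, (ε j * r j) • T.curryLeft (∑ i, ε i • x i) fun _ => x j := by
      have hdiag : ∀ j, (T fun _ => x j) = T.curryLeft (x j) fun _ => x j := fun j => by
        rw [ContinuousMultilinearMap.curryLeft_apply]
        congr 1
        ext i
        refine Fin.cases ?_ (fun _ => ?_) i <;> simp
      simp only [hdiag]
      rw [← sum_signs_smul fun i j => r j • T.curryLeft (x i) fun _ => x j]
      refine Finset.sum_congr rfl fun ε _ => Finset.sum_congr rfl fun j _ => ?_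
      have hsum : (T.curryLeft (∑ i, ε i • x i) fun _ => x j) =
          ∑ i, ε i • T.curryLeft (x i) fun _ => x j := by
        simp only [map_sum, sum_apply, Units.smul_def, map_zsmul]
        rfl
      rw [hsum, Finset.smul_sum]
      refine Finset.sum_congr rfl fun i _ => ?_
      simp only [smul_smul]
      congr 1
      ac_rfl
    have hle : N * ‖∑ j, r j • T fun _ => x j‖ ≤ N * (‖T‖ * K ^ (m + 1 + 1)) := by
      rw [← nsmul_eq_mul, ← RCLike.norm_nsmul 𝕂, havg]
      refine (norm_sum_le_of_le _ (n := fun _ => ‖T‖ * K ^ (m + 1 + 1)) fun ε _ => ?_).trans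
        (by simp [N])
      refine (ih (T.curryLeft (∑ i, ε i • x i)) fun j => ε j * r j).trans ?_
      have := (T.curryLeft.le_opNorm (∑ i, ε i • x i)).trans
        (mul_le_mul_of_nonneg_left (hK ε) (norm_nonneg _))
      rw [ContinuousMultilinearMap.curryLeft_norm] at this
      calc _ ≤ ‖T‖ * K * K ^ (m + 1) := by gcongr
        _ = _ := by ring
    exact le_of_mul_le_mul_left hle hN

/-- The finite signed sums of a weakly summable sequence are uniformly bounded. -/
theorem WeaklySummable.exists_norm_sum_signs_le {𝕂 X : Type*} [RCLike 𝕂] [NormedAddCommGroup X]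
    [NormedSpace 𝕂 X] {x : ℕ → X} (hx : WeaklySummable 𝕂 x) :
    ∃ K : ℝ, ∀ (k : ℕ) (ε : Fin k → ℤˣ), ‖∑ j, ε j • x j‖ ≤ K := by
  let g : (Σ k : ℕ, Fin k → ℤˣ) → (X →L[𝕂] 𝕂) →L[𝕂] 𝕂 := fun p =>
    NormedSpace.inclusionInDoubleDual 𝕂 X (∑ j, p.2 j • x j)
  obtain ⟨K, hK⟩ := banach_steinhaus (g := g) fun φ => by
    refine ⟨∑' j, ‖φ (x j)‖, fun p => ?_⟩
    have hsign : ∀ (u : ℤˣ) (y : X), ‖φ (u • y)‖ = ‖φ y‖ := fun u y => by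
      rcases Int.units_eq_one_or u with rfl | rfl <;> simp
    calc ‖g p φ‖ = ‖∑ j, φ (p.2 j • x j)‖ := by
          rw [NormedSpace.dual_def, map_sum]
      _ ≤ ∑ j, ‖φ (p.2 j • x j)‖ := norm_sum_le _ _
      _ = ∑ j ∈ Finset.range p.1, ‖φ (x j)‖ := by
          simp only [hsign]
          exact Fin.sum_univ_eq_sum_range (fun j => ‖φ (x j)‖) p.1
      _ ≤ _ := (hx φ).sum_le_tsum _ fun _ _ => norm_nonneg _
  refine ⟨K, fun k ε => ?_⟩
  rw [← (NormedSpace.inclusionInDoubleDualLi 𝕂 (E := X)).norm_map]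
  exact hK ⟨k, ε⟩

/-- If `Y` has cotype `q`, then every continuous `m`-homogeneous polynomial from any Banach
space `X` into `Y` is absolutely `(q;1)`-summing. -/
theorem stmt6 (𝕂 : Type*) [RCLike 𝕂] (m : ℕ) (hm : 0 < m)
    (Y : Type*) [NormedAddCommGroup Y] [NormedSpace 𝕂 Y] [CompleteSpace Y]
    (q : ℝ) (hq2 : 2 ≤ q) (hcot : HasCotype Y q)
    (X : Type*) [NormedAddCommGroup X] [NormedSpace 𝕂 X] [CompleteSpace X]
    (P : X → Y) (hP : IsHomogPoly 𝕂 m P)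
    (x : ℕ → X) (hx : WeaklySummable 𝕂 x) :
    Summable fun j => ‖P (x j)‖ ^ q := by
  obtain ⟨T, hT⟩ := hP
  obtain ⟨C, hC0, hC⟩ := hcot
  obtain ⟨K, hK⟩ := hx.exists_norm_sum_signs_le
  obtain ⟨n, rfl⟩ := Nat.exists_eq_succ_of_ne_zero hm.ne'
  have hq0 : 0 < q := by linarith
  set B := ‖T‖ * K ^ (n + 1)
  have hB : ∀ k (r : Fin k → ℤˣ), ‖∑ j, r j • P (x j)‖ ≤ B := fun k r => by
    simpa only [hT] using norm_sum_signs_smul_multilinear_le (hK k) n T r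
  have hB0 : 0 ≤ B := (norm_nonneg _).trans (hB 0 1)
  refine summable_of_sum_range_le (c := (C * B) ^ q) (fun _ => by positivity) fun k => ?_
  rw [← Fin.sum_univ_eq_sum_range (fun j => ‖P (x j)‖ ^ q) k]
  have hS : 0 ≤ ∑ j : Fin k, ‖P (x j)‖ ^ q := Finset.sum_nonneg fun _ _ => by positivity
  rw [← Real.rpow_inv_le_iff_of_pos hS (by positivity) hq0, ← one_div]
  refine (hC k fun j => P (x j)).trans (mul_le_mul_of_nonneg_left ?_ hC0)
  rw [Real.sqrt_le_left hB0, inv_mul_le_iff₀ (by positivity)]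
  refine (Finset.sum_le_sum (g := fun _ => B ^ 2) fun ε _ => ?_).trans (by simp)
  have hε : ∑ j, (if ε j then P (x j) else -P (x j)) =
      ∑ j, (if ε j then 1 else -1 : ℤˣ) • P (x j) :=
    Finset.sum_congr rfl fun j _ => by split_ifs <;> simp
  rw [hε]
  exact pow_le_pow_left₀ (norm_nonneg _) (hB k _) 2
end
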